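/- Let β ∈ {1,−1} and let f₀ : ℝ³×ℝ³ → [0,∞) be a C¹, compactly supported function. Then for every δ > 0 there exist a global classical solution f of the Vlasov–Poisson system with parameter β and initial datum f(0,·,·) = f₀, and a constant C > 0 (depending on f₀ and δ), such that the momentum support function satisfies Q(t) ≤ C(1+t)^{(51+δ)/11} for all t ≥ 0 (Pfaffelmoser's global existence theorem for general data). -/

import Mathlib

open MeasureTheory Real Bornology

noncomputable section

/-- Three-dimensional Euclidean space. -/
abbrev E3 := EuclideanSpace ℝ (Fin 3)

/-- The spatial density `ρ(t,x) = ∫ f(t,x,v) dv` induced by a distribution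
function `F` on `ℝ × ℝ³ × ℝ³`. -/
def vpDensity (F : ℝ × E3 × E3 → ℝ) (t : ℝ) (x : E3) : ℝ :=
  ∫ v : E3, F (t, x, v)

/-- The field `E(t,x) = (1/4π) ∫ ρ(t,y)(x−y)/|x−y|³ dy` (so `E = ∇φ`, `Δφ = ρ`). -/
def vpField (F : ℝ × E3 × E3 → ℝ) (t : ℝ) (x : E3) : E3 :=
  (4 * π)⁻¹ • ∫ y : E3, (vpDensity F t y / ‖x - y‖ ^ 3) • (x - y)

/-- `F` is a global classical solution of the (nonrelativistic) Vlasov–Poisson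
system with parameter `β`: it is a nonnegative `C¹` function, it satisfies
`∂_t f + v·∇_x f + β E·∇_v f = 0` pointwise for `t ≥ 0`, and for each `t` the
set `{(s,x,v) : 0 ≤ s ≤ t, f(s,x,v) ≠ 0}` is bounded. -/
structure IsGlobalVPSolution (β : ℝ) (F : ℝ × E3 × E3 → ℝ) : Prop where
  nonneg : ∀ z, 0 ≤ F z
  smooth : ContDiff ℝ 1 F
  pde : ∀ t x v, 0 ≤ t →
    fderiv ℝ F (t, x, v) (1, v, β • vpField F t x) = 0
  support_bounded : ∀ t, 0 ≤ t →
    IsBounded {z : ℝ × E3 × E3 | 0 ≤ z.1 ∧ z.1 ≤ t ∧ F z ≠ 0}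

/-- The momentum support function
`Q(t) = sup{|v| : ∃ s ∈ [0,t], x ∈ ℝ³, f(s,x,v) ≠ 0}`. -/
def vpQ (F : ℝ × E3 × E3 → ℝ) (t : ℝ) : ℝ :=
  sSup {r : ℝ | ∃ s x v, 0 ≤ s ∧ s ≤ t ∧ F (s, x, v) ≠ 0 ∧ r = ‖v‖}

section VPone
open Set Filter Topology
open scoped NNReal

/-- Radial retraction onto the closed ball of radius `a`. -/
def vpRetr {E : Type*} [NormedAddCommGroup E] [NormedSpace ℝ E] (a : ℝ) (x : E) : E :=
  (a / max a ‖x‖) • x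

lemma vpRetr_norm_le {E : Type*} [NormedAddCommGroup E] [NormedSpace ℝ E] {a : ℝ} (ha : 0 < a)
    (x : E) : ‖vpRetr a x‖ ≤ a := by
  have h : 0 < max a ‖x‖ := lt_max_of_lt_left ha
  rw [vpRetr, norm_smul, Real.norm_of_nonneg (by positivity), div_mul_eq_mul_div, div_le_iff₀ h]
  gcongr
  exact le_max_right _ _

lemma vpRetr_eq {E : Type*} [NormedAddCommGroup E] [NormedSpace ℝ E] {a : ℝ} (ha : 0 < a)
    {x : E} (hx : ‖x‖ ≤ a) : vpRetr a x = x := by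
  rw [vpRetr, max_eq_left hx, div_self ha.ne', one_smul]

lemma vpRetr_lip {E : Type*} [NormedAddCommGroup E] [NormedSpace ℝ E] {a : ℝ} (ha : 0 < a)
    (x y : E) : ‖vpRetr a x - vpRetr a y‖ ≤ 2 * ‖x - y‖ := by
  have hx : 0 < max a ‖x‖ := lt_max_of_lt_left ha
  have hy : 0 < max a ‖y‖ := lt_max_of_lt_left ha
  have e : vpRetr a x - vpRetr a y = (a / max a ‖x‖) • (x - y) +
      (a / max a ‖x‖ - a / max a ‖y‖) • y := by
    simp only [vpRetr, smul_sub, sub_smul]; abel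
  have h1 : ‖(a / max a ‖x‖) • (x - y)‖ ≤ ‖x - y‖ := by
    rw [norm_smul, Real.norm_of_nonneg (by positivity)]
    have : a / max a ‖x‖ ≤ 1 := (div_le_one hx).2 (le_max_left _ _)
    nlinarith [norm_nonneg (x - y)]
  have h2 : ‖(a / max a ‖x‖ - a / max a ‖y‖) • y‖ ≤ ‖x - y‖ := by
    rw [norm_smul, Real.norm_eq_abs]
    have e2 : a / max a ‖x‖ - a / max a ‖y‖ =
        (a / max a ‖x‖) * ((max a ‖y‖ - max a ‖x‖) / max a ‖y‖) := by
      field_simp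
    rw [e2, abs_mul, abs_of_nonneg (by positivity : 0 ≤ a / max a ‖x‖), abs_div, abs_of_pos hy]
    have h3 : a / max a ‖x‖ ≤ 1 := (div_le_one hx).2 (le_max_left _ _)
    have h4 : |max a ‖y‖ - max a ‖x‖| ≤ ‖x - y‖ := by
      rw [abs_sub_comm]
      refine (abs_max_sub_max_le_max a ‖x‖ a ‖y‖).trans ?_
      simp only [sub_self, abs_zero]
      exact max_le (norm_nonneg _) (abs_norm_sub_norm_le x y)
    have h5 : ‖y‖ / max a ‖y‖ ≤ 1 := (div_le_one hy).2 (le_max_right _ _)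
    calc a / max a ‖x‖ * (|max a ‖y‖ - max a ‖x‖| / max a ‖y‖) * ‖y‖
        = a / max a ‖x‖ * |max a ‖y‖ - max a ‖x‖| * (‖y‖ / max a ‖y‖) := by ring
      _ ≤ 1 * ‖x - y‖ * 1 := by gcongr
      _ = ‖x - y‖ := by ring
  rw [e]
  linarith [norm_add_le ((a / max a ‖x‖) • (x - y)) ((a / max a ‖x‖ - a / max a ‖y‖) • y)]

/-- Comparison (Gronwall) lemma with variable coefficients. -/
lemma vp_cmp {E : Type*} [NormedAddCommGroup E] [NormedSpace ℝ E] {T A : ℝ}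
    {u u' : ℝ → E} {B B' a b : ℝ → ℝ}
    (hu : ∀ s ∈ Icc 0 T, HasDerivWithinAt u (u' s) (Icc 0 T) s)
    (hB : ∀ s, HasDerivAt B (B' s) s)
    (h0 : ‖u 0‖ ≤ B 0)
    (haA : ∀ s ∈ Icc 0 T, a s ≤ A)
    (hu' : ∀ s ∈ Icc 0 T, ‖u' s‖ ≤ a s * ‖u s‖ + b s)
    (hBB : ∀ s ∈ Icc 0 T, a s * B s + b s ≤ B' s) :
    ∀ s ∈ Icc 0 T, ‖u s‖ ≤ B s := by
  intro s hs
  have key : ∀ η > 0, ‖u s‖ ≤ B s + η * exp ((A + 1) * s) := by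
    intro η hη
    refine image_norm_le_of_norm_deriv_right_lt_deriv_boundary (f := u) (f' := u') (a := 0) (b := T)
      (B := fun s => B s + η * exp ((A + 1) * s))
      (B' := fun s => B' s + η * (exp ((A + 1) * s) * ((A + 1) * 1)))
      (fun x hx => (hu x hx).continuousWithinAt) ?_ ?_ ?_ ?_ hs
    · intro x hx
      have := hu x ⟨hx.1, hx.2.le⟩
      exact (this.mono_of_mem_nhdsWithin (Icc_mem_nhdsGE_of_mem hx))
    · simp; linarith
    · intro x
      exact (hB x).add ((((hasDerivAt_id x).const_mul (A + 1)).exp).const_mul η)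
    · intro x hx he
      have hx' : x ∈ Icc 0 T := ⟨hx.1, hx.2.le⟩
      have h1 := hu' x hx'
      have h2 := hBB x hx'
      have h3 := haA x hx'
      have h4 : 0 < η * exp ((A + 1) * x) := by positivity
      rw [he] at h1
      nlinarith
  by_contra! hcon
  have hp := exp_pos ((A + 1) * s)
  have := key ((‖u s‖ - B s) / (2 * exp ((A + 1) * s))) (by apply div_pos <;> linarith)
  have e : (‖u s‖ - B s) / (2 * exp ((A + 1) * s)) * exp ((A + 1) * s) = (‖u s‖ - B s) / 2 := by
    field_simp
  linarith

lemma vp_ode_Icc {E : Type*} [NormedAddCommGroup E] [NormedSpace ℝ E] [CompleteSpace E]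
    (f : ℝ → E → E) (hc : ∀ x, Continuous fun t => f t x) (t₀ T : ℝ) (hT : 0 < T)
    (K : ℝ≥0) (hK : ∀ t ∈ Icc (t₀ - T) (t₀ + T), LipschitzWith K (f t)) (x₀ : E) :
    ∃ γ : ℝ → E, γ t₀ = x₀ ∧
      ∀ t ∈ Icc (t₀ - T) (t₀ + T), HasDerivWithinAt γ (f t (γ t)) (Icc (t₀ - T) (t₀ + T)) t := by
  obtain ⟨B, hB⟩ := (isCompact_Icc (a := t₀ - T) (b := t₀ + T)).exists_bound_of_continuousOn
    (hc x₀).continuousOn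
  have hB0 : 0 ≤ B := (norm_nonneg _).trans (hB t₀ ⟨by linarith, by linarith⟩)
  -- a priori radius
  set a : ℝ := (B + 1) * T * exp ((K + 1) * T) + 1 with ha
  have hapos : 0 < a := by positivity
  set g : ℝ → E → E := fun t x => f t (x₀ + vpRetr a (x - x₀)) with hg
  set L : ℝ := B + K * a with hL
  have hgb : ∀ t ∈ Icc (t₀ - T) (t₀ + T), ∀ x, ‖g t x‖ ≤ L := by
    intro t ht x
    have h1 := (hK t ht).dist_le_mul (x₀ + vpRetr a (x - x₀)) x₀
    rw [dist_eq_norm, dist_eq_norm, add_sub_cancel_left] at h1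
    have h2 := vpRetr_norm_le hapos (x - x₀)
    have h3 := hB t ht
    have h4 : ‖g t x‖ ≤ ‖f t (x₀ + vpRetr a (x - x₀)) - f t x₀‖ + ‖f t x₀‖ := by
      simpa [hg] using norm_add_le (f t (x₀ + vpRetr a (x - x₀)) - f t x₀) (f t x₀)
    have : (K:ℝ) * ‖vpRetr a (x - x₀)‖ ≤ K * a := by gcongr
    linarith
  have hL0 : 0 ≤ L := by positivity
  have hPL : IsPicardLindelof g (⟨t₀, by constructor <;> linarith⟩ : Icc (t₀ - T) (t₀ + T)) x₀
      (⟨L * T, by positivity⟩) 0 ⟨L, hL0⟩ (K * 2) := by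
    refine ⟨?_, ?_, ?_, ?_⟩
    · intro t ht
      refine LipschitzWith.lipschitzOnWith (LipschitzWith.of_dist_le_mul fun x y => ?_)
      refine ((hK t ht).dist_le_mul _ _).trans ?_
      rw [dist_eq_norm, dist_eq_norm, add_sub_add_left_eq_sub]
      have := vpRetr_lip hapos (x - x₀) (y - x₀)
      rw [sub_sub_sub_cancel_right] at this
      push_cast
      rw [mul_assoc]
      gcongr
    · intro x _
      exact (hc _).continuousOn
    · intro t ht x _
      exact hgb t ht x
    · simp
      exact le_rfl
  obtain ⟨γ, hγ0, hγ⟩ := hPL.exists_eq_forall_mem_Icc_hasDerivWithinAt₀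
  simp only at hγ0
  -- growth bound
  have hlin' : ∀ t ∈ Icc (t₀ - T) (t₀ + T), ∀ x, ‖g t x‖ ≤ K * ‖x - x₀‖ + B := by
    intro t ht x
    have h1 := (hK t ht).dist_le_mul (x₀ + vpRetr a (x - x₀)) x₀
    rw [dist_eq_norm, dist_eq_norm, add_sub_cancel_left] at h1
    have h3 := hB t ht
    have h4 : ‖g t x‖ ≤ ‖f t (x₀ + vpRetr a (x - x₀)) - f t x₀‖ + ‖f t x₀‖ := by
      simpa [hg] using norm_add_le (f t (x₀ + vpRetr a (x - x₀)) - f t x₀) (f t x₀)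
    have h5 : ‖vpRetr a (x - x₀)‖ ≤ ‖x - x₀‖ := by
      have hx : 0 < max a ‖x - x₀‖ := lt_max_of_lt_left hapos
      rw [vpRetr, norm_smul, Real.norm_of_nonneg (by positivity)]
      have : a / max a ‖x - x₀‖ ≤ 1 := (div_le_one hx).2 (le_max_left _ _)
      nlinarith [norm_nonneg (x - x₀)]
    have : (K:ℝ) * ‖vpRetr a (x - x₀)‖ ≤ K * ‖x - x₀‖ := by gcongr
    linarith
  have hBd : ∀ s, HasDerivAt (fun s => (B + 1) * s * exp ((K + 1) * s))
      ((B + 1) * 1 * exp ((K + 1) * s) + (B + 1) * s * (exp ((K + 1) * s) * ((K + 1) * 1))) s := by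
    intro s
    exact ((hasDerivAt_id s).const_mul (B + 1)).mul
      (((hasDerivAt_id s).const_mul ((K:ℝ) + 1)).exp)
  have hBB : ∀ s ∈ Icc (0:ℝ) T, K * ((B + 1) * s * exp ((K + 1) * s)) + B ≤
      ((B + 1) * 1 * exp ((K + 1) * s) + (B + 1) * s * (exp ((K + 1) * s) * ((K + 1) * 1))) := by
    intro s hs
    have h1 : 1 ≤ exp ((K + 1) * s) := one_le_exp (mul_nonneg (by positivity) hs.1)
    have h2 : 0 ≤ (B + 1) * s * exp ((K + 1) * s) :=
      mul_nonneg (mul_nonneg (by positivity) hs.1) (exp_pos _).le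
    nlinarith
  have hsmall : ∀ s ∈ Icc (0:ℝ) T, (B + 1) * s * exp ((K + 1) * s) ≤ a := by
    intro s hs
    have : (B + 1) * s * exp ((K + 1) * s) ≤ (B + 1) * T * exp ((K + 1) * T) := by
      have := hs.2
      have := hs.1
      gcongr
    linarith
  have hbound : ∀ t ∈ Icc (t₀ - T) (t₀ + T), ‖γ t - x₀‖ ≤ a := by
    intro t ht
    rcases le_total t₀ t with h | h
    · have := vp_cmp (T := T) (A := K) (u := fun s => γ (t₀ + s) - x₀)
        (u' := fun s => g (t₀ + s) (γ (t₀ + s)))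
        (a := fun _ => (K:ℝ)) (b := fun _ => B) ?_ hBd ?_ (fun _ _ => le_rfl) ?_ hBB (t - t₀)
        ⟨by linarith, by linarith [ht.2]⟩
      · simp only [add_sub_cancel] at this
        exact this.trans (hsmall _ ⟨by linarith, by linarith [ht.2]⟩)
      · intro s hs
        have h1 := hγ (t₀ + s) ⟨by linarith [hs.1], by linarith [hs.2]⟩
        have h2 : HasDerivWithinAt (fun s => t₀ + s) (1:ℝ) (Icc 0 T) s :=
          ((hasDerivAt_id s).const_add t₀).hasDerivWithinAt
        have h3 := h1.scomp s h2 (fun r hr => ⟨by linarith [hr.1], by linarith [hr.2]⟩)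
        rw [one_smul] at h3
        exact h3.sub_const x₀
      · simp [hγ0]
      · intro s hs
        exact hlin' _ ⟨by linarith [hs.1], by linarith [hs.2]⟩ _
    · have := vp_cmp (T := T) (A := K) (u := fun s => γ (t₀ - s) - x₀)
        (u' := fun s => - g (t₀ - s) (γ (t₀ - s)))
        (a := fun _ => (K:ℝ)) (b := fun _ => B) ?_ hBd ?_ (fun _ _ => le_rfl) ?_ hBB (t₀ - t)
        ⟨by linarith, by linarith [ht.1]⟩
      · simp only [sub_sub_cancel] at this
        exact this.trans (hsmall _ ⟨by linarith, by linarith [ht.1]⟩)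
      · intro s hs
        have h1 := hγ (t₀ - s) ⟨by linarith [hs.2], by linarith [hs.1]⟩
        have h2 : HasDerivWithinAt (fun s => t₀ - s) (-1:ℝ) (Icc 0 T) s :=
          ((hasDerivAt_id s).const_sub t₀).hasDerivWithinAt
        have h3 := h1.scomp s h2 (fun r hr => ⟨by linarith [hr.2], by linarith [hr.1]⟩)
        rw [neg_one_smul] at h3
        exact h3.sub_const x₀
      · simp [hγ0]
      · intro s hs
        rw [norm_neg]
        exact hlin' _ ⟨by linarith [hs.2], by linarith [hs.1]⟩ _
  refine ⟨γ, hγ0, fun t ht => ?_⟩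
  have h1 := hγ t ht
  have h2 : g t (γ t) = f t (γ t) := by
    simp only [hg]
    rw [vpRetr_eq hapos (hbound t ht), add_sub_cancel]
  rwa [h2] at h1

/-- Global existence for globally Lipschitz ODEs. -/
lemma vp_ode_global {E : Type*} [NormedAddCommGroup E] [NormedSpace ℝ E] [CompleteSpace E]
    (f : ℝ → E → E) (hc : ∀ x, Continuous fun t => f t x)
    (hL : ∀ T : ℝ, ∃ K : ℝ≥0, ∀ t, |t| ≤ T → LipschitzWith K (f t)) (t₀ : ℝ) (x₀ : E) :
    ∃ γ : ℝ → E, γ t₀ = x₀ ∧ ∀ t, HasDerivAt γ (f t (γ t)) t := by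
  have hL' : ∀ n : ℕ, ∃ K : ℝ≥0, ∀ t ∈ Icc (t₀ - ((n:ℝ)+1)) (t₀ + ((n:ℝ)+1)),
      LipschitzWith K (f t) := by
    intro n
    obtain ⟨K, hK⟩ := hL (|t₀| + (n + 1))
    refine ⟨K, fun t ht => hK t ?_⟩
    rw [abs_le]
    have := neg_abs_le t₀
    have := le_abs_self t₀
    constructor <;> linarith [ht.1, ht.2]
  choose K hK using hL'
  choose γ hγ0 hγ using fun n : ℕ => vp_ode_Icc f hc t₀ ((n:ℝ)+1) (by positivity) (K n) (hK n) x₀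
  have hder : ∀ n : ℕ, ∀ t ∈ Ioo (t₀ - ((n:ℝ)+1)) (t₀ + ((n:ℝ)+1)),
      HasDerivAt (γ n) (f t (γ n t)) t := fun n t ht =>
    (hγ n t ⟨ht.1.le, ht.2.le⟩).hasDerivAt (Icc_mem_nhds ht.1 ht.2)
  have huniq : ∀ m n : ℕ, m ≤ n → ∀ t ∈ Ioo (t₀ - ((m:ℝ)+1)) (t₀ + ((m:ℝ)+1)), γ m t = γ n t := by
    intro m n hmn
    have hmn' : (m:ℝ) ≤ n := by exact_mod_cast hmn
    refine ODE_solution_unique_of_mem_Ioo (v := f) (s := fun _ => univ) (K := K m) (t₀ := t₀)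
      (fun t ht => (hK m t ⟨ht.1.le, ht.2.le⟩).lipschitzOnWith)
      ⟨by linarith [(Nat.cast_nonneg m : (0:ℝ) ≤ m)], by linarith [(Nat.cast_nonneg m : (0:ℝ) ≤ m)]⟩
      (fun t ht => ⟨hder m t ht, mem_univ _⟩)
      (fun t ht => ⟨hder n t ⟨by linarith [ht.1], by linarith [ht.2]⟩, mem_univ _⟩)
      (by rw [hγ0, hγ0])
  refine ⟨fun t => γ ⌈|t - t₀|⌉₊ t, by simp [hγ0], fun t => ?_⟩
  obtain ⟨N, hN⟩ := exists_nat_gt (|t - t₀| + 1)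
  have heq : ∀ s, |s - t₀| < N → γ ⌈|s - t₀|⌉₊ s = γ N s := by
    intro s hs
    apply huniq _ _ (Nat.ceil_le.2 hs.le)
    have h1 := Nat.le_ceil |s - t₀|
    have h2 := abs_le.1 h1
    constructor <;> linarith [h2.1, h2.2]
  have hev : (fun s => γ ⌈|s - t₀|⌉₊ s) =ᶠ[𝓝 t] γ N := by
    have : ∀ᶠ s in 𝓝 t, |s - t₀| < N := by
      have hc : Continuous fun s : ℝ => |s - t₀| := by fun_prop
      exact hc.continuousAt.eventually_lt continuousAt_const (by linarith)
    filter_upwards [this] with s hs using heq s hs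
  have h1 : |t - t₀| < N := by linarith
  have h2 := abs_lt.1 h1
  have := hder N t ⟨by linarith [h2.1], by linarith [h2.2]⟩
  simp only [heq t h1]
  exact this.congr_of_eventuallyEq hev
end VPone

section VPtwo
open Set Filter Topology
open scoped NNReal

/-- The phase space vector field associated with a force field `G`. -/
def vpVF (G : ℝ → E3 → E3) (t : ℝ) (z : E3 × E3) : E3 × E3 := (z.2, G t z.1)

/-- Regularity of a force field: jointly continuous and Lipschitz in space, locally uniformly in
time. -/
structure VPReg (G : ℝ → E3 → E3) : Prop where
  cont : Continuous fun p : ℝ × E3 => G p.1 p.2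
  lip : ∀ T : ℝ, ∃ K : ℝ≥0, ∀ t, |t| ≤ T → LipschitzWith K (G t)

lemma vpVF_lip {G : ℝ → E3 → E3} {t : ℝ} {K : ℝ≥0} (h : LipschitzWith K (G t)) :
    LipschitzWith (1 + K) (vpVF G t) := by
  refine LipschitzWith.of_dist_le_mul fun z z' => ?_
  have h1 := h.dist_le_mul z.1 z'.1
  have h2 : dist z.1 z'.1 ≤ dist z z' := le_max_left _ _
  have h3 : dist z.2 z'.2 ≤ dist z z' := le_max_right _ _
  have h4 : (K:ℝ) * dist z.1 z'.1 ≤ K * dist z z' := by gcongr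
  have h5 : 0 ≤ (K:ℝ) * dist z z' := by positivity
  have h6 : 0 ≤ dist z z' := dist_nonneg
  push_cast
  rw [Prod.dist_eq]
  simp only [vpVF]
  exact max_le (by linarith) (by linarith)

lemma VPReg.exists_curve {G : ℝ → E3 → E3} (h : VPReg G) (t₀ : ℝ) (z₀ : E3 × E3) :
    ∃ γ : ℝ → E3 × E3, γ t₀ = z₀ ∧ ∀ t, HasDerivAt γ (vpVF G t (γ t)) t := by
  refine vp_ode_global (vpVF G) (fun z => ?_) (fun T => ?_) t₀ z₀
  · have := h.cont
    unfold vpVF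
    fun_prop
  · obtain ⟨K, hK⟩ := h.lip T
    exact ⟨1 + K, fun t ht => vpVF_lip (hK t ht)⟩

/-- The characteristic curve through `z₀` at time `t₀`. -/
def vpCurve {G : ℝ → E3 → E3} (h : VPReg G) (t₀ : ℝ) (z₀ : E3 × E3) : ℝ → E3 × E3 :=
  Classical.choose (h.exists_curve t₀ z₀)

lemma vpCurve_self {G : ℝ → E3 → E3} (h : VPReg G) (t₀ : ℝ) (z₀ : E3 × E3) :
    vpCurve h t₀ z₀ t₀ = z₀ := (Classical.choose_spec (h.exists_curve t₀ z₀)).1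

lemma vpCurve_deriv {G : ℝ → E3 → E3} (h : VPReg G) (t₀ : ℝ) (z₀ : E3 × E3) (t : ℝ) :
    HasDerivAt (vpCurve h t₀ z₀) (vpVF G t (vpCurve h t₀ z₀ t)) t :=
  (Classical.choose_spec (h.exists_curve t₀ z₀)).2 t

lemma vpCurve_continuous {G : ℝ → E3 → E3} (h : VPReg G) (t₀ : ℝ) (z₀ : E3 × E3) :
    Continuous (vpCurve h t₀ z₀) :=
  continuous_iff_continuousAt.2 fun t => (vpCurve_deriv h t₀ z₀ t).continuousAt

lemma vpCurve_deriv_fst {G : ℝ → E3 → E3} (h : VPReg G) (t₀ : ℝ) (z₀ : E3 × E3) (t : ℝ) :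
    HasDerivAt (fun s => (vpCurve h t₀ z₀ s).1) ((vpCurve h t₀ z₀ t).2) t :=
  ((ContinuousLinearMap.fst ℝ E3 E3).hasFDerivAt.comp_hasDerivAt t (vpCurve_deriv h t₀ z₀ t))

lemma vpCurve_deriv_snd {G : ℝ → E3 → E3} (h : VPReg G) (t₀ : ℝ) (z₀ : E3 × E3) (t : ℝ) :
    HasDerivAt (fun s => (vpCurve h t₀ z₀ s).2) (G t (vpCurve h t₀ z₀ t).1) t :=
  ((ContinuousLinearMap.snd ℝ E3 E3).hasFDerivAt.comp_hasDerivAt t (vpCurve_deriv h t₀ z₀ t))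

/-- Comparison of two characteristic flows. -/
lemma vp_curve_cmp {G G' : ℝ → E3 → E3} (h : VPReg G) {γ γ' : ℝ → E3 × E3}
    (hγ : ∀ t, HasDerivAt γ (vpVF G t (γ t)) t) (hγ' : ∀ t, HasDerivAt γ' (vpVF G' t (γ' t)) t)
    (σ : ℝ) (hσ : |σ| = 1) (a T A : ℝ) (hT : 0 ≤ T)
    (ℓ b B B' : ℝ → ℝ)
    (hℓ0 : ∀ s ∈ Icc 0 T, 0 ≤ ℓ s) (hℓA : ∀ s ∈ Icc 0 T, ℓ s ≤ A)
    (hb0 : ∀ s ∈ Icc 0 T, 0 ≤ b s)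
    (hlip : ∀ s ∈ Icc 0 T, ∀ x y, ‖G (a + σ * s) x - G (a + σ * s) y‖ ≤ ℓ s * ‖x - y‖)
    (hdiff : ∀ s ∈ Icc 0 T, ∀ x, ‖G (a + σ * s) x - G' (a + σ * s) x‖ ≤ b s)
    (hB : ∀ s, HasDerivAt B (B' s) s) (h0 : ‖γ a - γ' a‖ ≤ B 0)
    (hBB : ∀ s ∈ Icc 0 T, (1 + ℓ s) * B s + b s ≤ B' s) :
    ‖γ (a + σ * T) - γ' (a + σ * T)‖ ≤ B T := by
  refine vp_cmp (T := T) (A := 1 + A) (u := fun s => γ (a + σ * s) - γ' (a + σ * s))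
    (u' := fun s => σ • vpVF G (a + σ * s) (γ (a + σ * s)) -
      σ • vpVF G' (a + σ * s) (γ' (a + σ * s))) (a := fun s => 1 + ℓ s) (b := b)
    ?_ hB (by simpa using h0) (fun s hs => by linarith [hℓA s hs]) ?_ hBB T ⟨hT, le_rfl⟩
  · intro s _
    have e : HasDerivAt (fun s => a + σ * s) σ s := by
      simpa using ((hasDerivAt_id s).const_mul σ).const_add a
    exact (((hγ _).scomp s e).sub ((hγ' _).scomp s e)).hasDerivWithinAt
  · intro s hs
    rw [← smul_sub, norm_smul, Real.norm_eq_abs, hσ, one_mul]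
    set t := a + σ * s
    have h1 := hlip s hs (γ t).1 (γ' t).1
    have h2 := hdiff s hs (γ' t).1
    have h3 : ‖(γ t).1 - (γ' t).1‖ ≤ ‖γ t - γ' t‖ := norm_fst_le (γ t - γ' t)
    have h4 : ‖(γ t).2 - (γ' t).2‖ ≤ ‖γ t - γ' t‖ := norm_snd_le (γ t - γ' t)
    have h5 := hℓ0 s hs
    have h6 := hb0 s hs
    have h7 : ℓ s * ‖(γ t).1 - (γ' t).1‖ ≤ ℓ s * ‖γ t - γ' t‖ := by gcongr
    have h8 : 0 ≤ ℓ s * ‖γ t - γ' t‖ := by positivity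
    have h9 : ‖G t (γ t).1 - G' t (γ' t).1‖ ≤
        ‖G t (γ t).1 - G t (γ' t).1‖ + ‖G t (γ' t).1 - G' t (γ' t).1‖ := norm_sub_le_norm_sub_add_norm_sub _ _ _
    have h10 : 0 ≤ ‖γ t - γ' t‖ := norm_nonneg _
    have e : ‖vpVF G t (γ t) - vpVF G' t (γ' t)‖ =
      max ‖(γ t).2 - (γ' t).2‖ ‖G t (γ t).1 - G' t (γ' t).1‖ := rfl
    rw [e]
    refine max_le ?_ ?_ <;> nlinarith

lemma vp_curve_lip {G : ℝ → E3 → E3} (h : VPReg G) {γ γ' : ℝ → E3 × E3}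
    (hγ : ∀ t, HasDerivAt γ (vpVF G t (γ t)) t) (hγ' : ∀ t, HasDerivAt γ' (vpVF G t (γ' t)) t)
    {T : ℝ} {K : ℝ≥0} (hK : ∀ t, |t| ≤ T → LipschitzWith K (G t)) {a b : ℝ} (ha : |a| ≤ T)
    (hb : |b| ≤ T) :
    ‖γ b - γ' b‖ ≤ exp ((1 + K) * |b - a|) * ‖γ a - γ' a‖ := by
  obtain ⟨σ, hσ, hba⟩ : ∃ σ : ℝ, |σ| = 1 ∧ b = a + σ * |b - a| := by
    rcases le_total a b with h | h
    · exact ⟨1, by simp, by rw [abs_of_nonneg (by linarith)]; ring⟩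
    · exact ⟨-1, by simp, by rw [abs_of_nonpos (by linarith)]; ring⟩
  have hseg : ∀ s ∈ Icc 0 |b - a|, |a + σ * s| ≤ T := by
    intro s hs
    rcases le_total a b with h | h
    · rw [abs_of_nonneg (by linarith)] at hs hba
      rcases (abs_eq one_pos.le).1 hσ with h' | h' <;> rw [h'] at hba ⊢ <;> rw [abs_le] at * <;>
        constructor <;> linarith [hs.1, hs.2]
    · rw [abs_of_nonpos (by linarith)] at hs hba
      rcases (abs_eq one_pos.le).1 hσ with h' | h' <;> rw [h'] at hba ⊢ <;> rw [abs_le] at * <;>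
        constructor <;> linarith [hs.1, hs.2]
  have := vp_curve_cmp (G := G) (G' := G) h hγ hγ' σ hσ a |b - a| K (abs_nonneg _)
    (fun _ => K) (fun _ => 0) (fun s => exp ((1 + K) * s) * ‖γ a - γ' a‖)
    (fun s => (exp ((1 + K) * s) * ((1 + K) * 1)) * ‖γ a - γ' a‖)
    (fun _ _ => by positivity) (fun _ _ => le_rfl) (fun _ _ => le_rfl)
    (fun s hs x y => by
      simpa [dist_eq_norm] using (hK _ (hseg s hs)).dist_le_mul x y)
    (fun _ _ _ => by simp)
    (fun s => (((hasDerivAt_id s).const_mul ((1:ℝ) + K)).exp).mul_const _)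
    (by simp) (fun s _ => by apply le_of_eq; ring)
  rwa [← hba] at this

lemma vp_curve_unique {G : ℝ → E3 → E3} (h : VPReg G) {γ γ' : ℝ → E3 × E3}
    (hγ : ∀ t, HasDerivAt γ (vpVF G t (γ t)) t) (hγ' : ∀ t, HasDerivAt γ' (vpVF G t (γ' t)) t)
    {a : ℝ} (hab : γ a = γ' a) (b : ℝ) : γ b = γ' b := by
  obtain ⟨K, hK⟩ := h.lip (max |a| |b|)
  have := vp_curve_lip h hγ hγ' hK (le_max_left |a| |b|) (le_max_right |a| |b|)
  rw [hab, sub_self, norm_zero, mul_zero] at this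
  exact sub_eq_zero.1 (norm_le_zero_iff.1 this)

lemma vpCurve_trans {G : ℝ → E3 → E3} (h : VPReg G) (a b c : ℝ) (z : E3 × E3) :
    vpCurve h b (vpCurve h a z b) c = vpCurve h a z c :=
  vp_curve_unique h (vpCurve_deriv h _ _) (vpCurve_deriv h _ _) (a := b) (vpCurve_self h _ _) c

lemma vpCurve_inv {G : ℝ → E3 → E3} (h : VPReg G) (a b : ℝ) (z : E3 × E3) :
    vpCurve h b (vpCurve h a z b) a = z := by
  rw [vpCurve_trans, vpCurve_self]

lemma vpCurve_lip {G : ℝ → E3 → E3} (h : VPReg G) {T : ℝ} {K : ℝ≥0}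
    (hK : ∀ t, |t| ≤ T → LipschitzWith K (G t)) {a b : ℝ} (ha : |a| ≤ T) (hb : |b| ≤ T)
    (z z' : E3 × E3) :
    ‖vpCurve h a z b - vpCurve h a z' b‖ ≤ exp ((1 + K) * (2 * T)) * ‖z - z'‖ := by
  have := vp_curve_lip h (vpCurve_deriv h a z) (vpCurve_deriv h a z') hK ha hb
  rw [vpCurve_self, vpCurve_self] at this
  refine this.trans ?_
  have : |b - a| ≤ 2 * T := by
    rw [abs_le] at *; constructor <;> linarith
  gcongr

lemma vpCurve_continuous_start {G : ℝ → E3 → E3} (h : VPReg G) (a b : ℝ) :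
    Continuous fun z => vpCurve h a z b := by
  obtain ⟨K, hK⟩ := h.lip (max |a| |b|)
  refine (LipschitzWith.of_dist_le_mul (K := ⟨exp ((1 + K) * (2 * max |a| |b|)), (exp_pos _).le⟩)
    fun z z' => ?_).continuous
  rw [dist_eq_norm, dist_eq_norm]
  exact vpCurve_lip h hK (le_max_left |a| |b|) (le_max_right |a| |b|) z z'

/-- joint continuity of the forward flow -/
lemma vpCurve_continuous_fwd {G : ℝ → E3 → E3} (h : VPReg G) :
    Continuous fun p : ℝ × E3 × E3 => vpCurve h 0 p.2 p.1 := by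
  rw [continuous_iff_continuousAt]
  rintro ⟨t, z⟩
  obtain ⟨K, hK⟩ := h.lip (|t| + 1)
  have h1 : Tendsto (fun p : ℝ × E3 × E3 => exp ((1 + K) * (2 * (|t| + 1))) * ‖p.2 - z‖ +
      ‖vpCurve h 0 z p.1 - vpCurve h 0 z t‖) (𝓝 (t, z)) (𝓝 0) := by
    have hc : Continuous (fun p : ℝ × E3 × E3 => exp ((1 + K) * (2 * (|t| + 1))) * ‖p.2 - z‖ +
      ‖vpCurve h 0 z p.1 - vpCurve h 0 z t‖) := by
      have := vpCurve_continuous h 0 z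
      fun_prop
    simpa using hc.tendsto (t, z)
  have hev : ∀ᶠ p : ℝ × E3 × E3 in 𝓝 (t, z), |p.1| ≤ |t| + 1 := by
    have hc : Continuous (fun p : ℝ × E3 × E3 => |p.1|) := by fun_prop
    filter_upwards [hc.continuousAt.eventually_lt (continuousAt_const (y := |t| + 1))
      (by simp)] with p hp using hp.le
  rw [ContinuousAt, tendsto_iff_norm_sub_tendsto_zero]
  refine squeeze_zero' (Eventually.of_forall fun _ => norm_nonneg _) ?_ h1
  filter_upwards [hev] with p hp
  have h2 := vpCurve_lip h hK (a := 0) (by simp; positivity) hp p.2 z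
  have h3 := norm_sub_le_norm_sub_add_norm_sub (vpCurve h 0 p.2 p.1) (vpCurve h 0 z p.1)
    (vpCurve h 0 z t)
  linarith

/-- joint continuity of the backward flow -/
lemma vpCurve_continuous_bwd {G : ℝ → E3 → E3} (h : VPReg G) :
    Continuous fun p : ℝ × E3 × E3 => vpCurve h p.1 p.2 0 := by
  rw [continuous_iff_continuousAt]
  rintro ⟨t, z⟩
  obtain ⟨K, hK⟩ := h.lip (|t| + 1)
  set w := vpCurve h t z 0 with hw
  have hwz : vpCurve h 0 w t = z := vpCurve_inv h t 0 z
  have h1 : Tendsto (fun p : ℝ × E3 × E3 => exp ((1 + K) * (2 * (|t| + 1))) *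
      ‖p.2 - vpCurve h 0 w p.1‖) (𝓝 (t, z)) (𝓝 0) := by
    have hc : Continuous (fun p : ℝ × E3 × E3 => exp ((1 + K) * (2 * (|t| + 1))) *
      ‖p.2 - vpCurve h 0 w p.1‖) := by
      have := vpCurve_continuous h 0 w
      fun_prop
    simpa [hwz] using hc.tendsto (t, z)
  have hev : ∀ᶠ p : ℝ × E3 × E3 in 𝓝 (t, z), |p.1| ≤ |t| + 1 := by
    have hc : Continuous (fun p : ℝ × E3 × E3 => |p.1|) := by fun_prop
    filter_upwards [hc.continuousAt.eventually_lt (continuousAt_const (y := |t| + 1))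
      (by simp)] with p hp using hp.le
  rw [ContinuousAt, tendsto_iff_norm_sub_tendsto_zero]
  refine squeeze_zero' (Eventually.of_forall fun _ => norm_nonneg _) ?_ h1
  filter_upwards [hev] with p hp
  have h2 := vpCurve_lip h hK (a := p.1) (b := 0) hp (by simp; positivity) p.2
    (vpCurve h 0 w p.1)
  rw [vpCurve_inv] at h2
  exact h2

end VPtwo

section VPthree
open Set Filter Topology
open scoped NNReal

/-- One step of the symplectic Euler scheme. -/
def vpStep (g : E3 → E3) (τ : ℝ) (z : E3 × E3) : E3 × E3 :=
  (z.1 + τ • z.2, z.2 + τ • g (z.1 + τ • z.2))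

lemma vpStep_mp {g : E3 → E3} (hg : Continuous g) (τ : ℝ) :
    MeasurePreserving (vpStep g τ) volume volume := by
  have shear : ∀ k : E3 → E3, Continuous k →
      MeasurePreserving (fun z : E3 × E3 => (z.1, z.2 + k z.1)) volume volume := by
    intro k hk
    rw [Measure.volume_eq_prod]
    refine (MeasurePreserving.id (volume : Measure E3)).skew_product
      (g := fun x v => v + k x) ?_ ?_
    · exact (by fun_prop : Continuous fun z : E3 × E3 => z.2 + k z.1).measurable
    · refine Eventually.of_forall fun x => ?_
      exact (measurePreserving_add_right (volume : Measure E3) (k x)).map_eq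
  have sw : MeasurePreserving (Prod.swap : E3 × E3 → E3 × E3) volume volume := by
    rw [Measure.volume_eq_prod]; exact Measure.measurePreserving_swap
  have h1 := (shear (fun x => τ • g x) (by fun_prop)).comp
    (sw.comp ((shear (fun x => τ • x) (by fun_prop)).comp sw))
  exact h1

lemma vpStep_lip {g : E3 → E3} {K : ℝ≥0} (hg : LipschitzWith K g) {τ : ℝ} (hτ : |τ| ≤ 1)
    (p q : E3 × E3) :
    ‖vpStep g τ p - vpStep g τ q‖ ≤ (1 + (1 + 2 * K) * |τ|) * ‖p - q‖ := by
  have h1 : ‖(vpStep g τ p).1 - (vpStep g τ q).1‖ ≤ (1 + |τ|) * ‖p - q‖ := by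
    have e : (vpStep g τ p).1 - (vpStep g τ q).1 = (p - q).1 + τ • (p - q).2 := by
      simp [vpStep, smul_sub]; abel
    rw [e]
    refine (norm_add_le _ _).trans ?_
    rw [norm_smul, Real.norm_eq_abs, add_mul, one_mul]
    have := norm_fst_le (p - q)
    have := norm_snd_le (p - q)
    gcongr
  have h2 : ‖(vpStep g τ p).2 - (vpStep g τ q).2‖ ≤ ‖p - q‖ + |τ| * (K * ((1 + |τ|) * ‖p - q‖)) := by
    have e : (vpStep g τ p).2 - (vpStep g τ q).2 = (p - q).2 +
        τ • (g (vpStep g τ p).1 - g (vpStep g τ q).1) := by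
      simp [vpStep, smul_sub]; abel
    rw [e]
    refine (norm_add_le _ _).trans ?_
    rw [norm_smul, Real.norm_eq_abs]
    have h3 := norm_snd_le (p - q)
    have h4 := hg.dist_le_mul (vpStep g τ p).1 (vpStep g τ q).1
    rw [dist_eq_norm, dist_eq_norm] at h4
    have h5 : ‖g (vpStep g τ p).1 - g (vpStep g τ q).1‖ ≤ K * ((1 + |τ|) * ‖p - q‖) :=
      h4.trans (by gcongr)
    gcongr
  have h0 := norm_nonneg (p - q)
  have hτ0 := abs_nonneg τ
  have hK : (0:ℝ) ≤ K := K.2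
  rw [Prod.norm_def]
  refine max_le (h1.trans ?_) (h2.trans ?_)
  · gcongr
    nlinarith
  · have h6 : |τ| * (K * ((1 + |τ|) * ‖p - q‖)) ≤ |τ| * (K * ((1 + 1) * ‖p - q‖)) := by gcongr
    nlinarith [mul_nonneg hτ0 h0]

/-- Iterated Euler steps. -/
def vpEuler (G : ℝ → E3 → E3) (a τ : ℝ) : ℕ → E3 × E3 → E3 × E3
  | 0 => id
  | n + 1 => fun z => vpStep (G (a + n * τ)) τ (vpEuler G a τ n z)

lemma vpEuler_mp {G : ℝ → E3 → E3} (h : VPReg G) (a τ : ℝ) (n : ℕ) :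
    MeasurePreserving (vpEuler G a τ n) volume volume := by
  induction n with
  | zero => exact MeasurePreserving.id _
  | succ n ih =>
    refine (vpStep_mp (g := G (a + n * τ)) ?_ τ).comp ih
    have := h.cont
    fun_prop

lemma vpStep_consistent {G : ℝ → E3 → E3} (h : VPReg G) (a b : ℝ) {γ : ℝ → E3 × E3}
    (hγ : ∀ t, HasDerivAt γ (vpVF G t (γ t)) t) {η : ℝ} (hη : 0 < η) :
    ∃ δ > 0, ∀ t ∈ uIcc a b, ∀ τ, |τ| < δ → ‖γ (t + τ) - vpStep (G t) τ (γ t)‖ ≤ η * |τ| := by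
  have hγc : Continuous γ := continuous_iff_continuousAt.2 fun t => (hγ t).continuousAt
  have hG := h.cont
  have hc : Continuous fun q : (ℝ × ℝ) × ℝ => (vpVF G (q.2 + q.1.1) (γ (q.2 + q.1.1)) -
      ((γ q.2).2, G q.2 ((γ q.2).1 + q.1.2 • (γ q.2).2)) : E3 × E3) := by
    unfold vpVF
    fun_prop
  have hev := isCompact_uIcc (a := a) (b := b) |>.eventually_forall_of_forall_eventually
    (x₀ := ((0:ℝ), (0:ℝ))) (P := fun q t => ‖vpVF G (t + q.1) (γ (t + q.1)) -
      ((γ t).2, G t ((γ t).1 + q.2 • (γ t).2))‖ < η) (fun t _ => by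
        refine hc.norm.continuousAt.eventually_lt continuousAt_const ?_
        simpa [vpVF] using hη)
  rw [Metric.eventually_nhds_iff] at hev
  obtain ⟨δ, hδ, hH⟩ := hev
  refine ⟨δ, hδ, fun t ht τ hτ => ?_⟩
  have hd : ∀ σ ∈ segment ℝ 0 τ, HasDerivWithinAt (fun σ => γ (t + σ) - σ •
      (((γ t).2, G t ((γ t).1 + τ • (γ t).2)) : E3 × E3))
      (vpVF G (t + σ) (γ (t + σ)) - ((γ t).2, G t ((γ t).1 + τ • (γ t).2))) (segment ℝ 0 τ) σ := by
    intro σ _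
    have h1 : HasDerivAt (fun σ => γ (t + σ)) (vpVF G (t + σ) (γ (t + σ))) σ :=
      (hγ (t + σ)).comp_const_add t σ
    have h2 := h1.sub ((hasDerivAt_id σ).smul_const
      (((γ t).2, G t ((γ t).1 + τ • (γ t).2)) : E3 × E3))
    rw [one_smul] at h2
    exact h2.hasDerivWithinAt
  have hb : ∀ σ ∈ segment ℝ 0 τ,
      ‖vpVF G (t + σ) (γ (t + σ)) - ((γ t).2, G t ((γ t).1 + τ • (γ t).2))‖ ≤ η := by
    intro σ hσ
    refine (hH (y := (σ, τ)) ?_ t ht).le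
    have : |σ| ≤ |τ| := by
      have := norm_sub_le_of_mem_segment hσ
      simpa using this
    rw [Prod.dist_eq]
    simp only [dist_zero_right, Real.norm_eq_abs]
    exact max_lt (this.trans_lt hτ) hτ
  have := (convex_segment (0:ℝ) τ).norm_image_sub_le_of_norm_hasDerivWithin_le hd hb
    (left_mem_segment ℝ 0 τ) (right_mem_segment ℝ 0 τ)
  simp only [zero_smul, sub_zero, add_zero, Real.norm_eq_abs] at this
  have e : γ (t + τ) - vpStep (G t) τ (γ t) =
      γ (t + τ) - τ • ((γ t).2, G t ((γ t).1 + τ • (γ t).2)) - γ t := by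
    rw [sub_sub]
    congr 1
    ext1 <;> simp [vpStep, add_comm]
  rw [e]
  exact this

lemma vpEuler_tendsto {G : ℝ → E3 → E3} (h : VPReg G) (a b : ℝ) (z : E3 × E3) :
    Tendsto (fun N : ℕ => vpEuler G a ((b - a) / N) N z) atTop (𝓝 (vpCurve h a z b)) := by
  obtain ⟨K, hK⟩ := h.lip (max |a| |b|)
  set C : ℝ := 1 + 2 * K with hC
  have hC0 : 0 ≤ C := by positivity
  set D := |b - a| * exp (C * |b - a|) + 1 with hD
  have hD0 : 0 < D := by positivity
  rw [Metric.tendsto_atTop]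
  intro ε hε
  obtain ⟨δ, hδ, hcons⟩ := vpStep_consistent h a b (vpCurve_deriv h a z)
    (η := ε / D) (by positivity)
  obtain ⟨N0, hN0⟩ := exists_nat_gt (|b - a| / min δ 1)
  refine ⟨N0 + 1, fun N hN => ?_⟩
  have hNpos : 0 < (N:ℝ) := by
    have : 0 < N := by omega
    exact_mod_cast this
  set τ := (b - a) / N with hτ
  have hτN : |τ| * N = |b - a| := by
    rw [hτ, abs_div, abs_of_pos hNpos]; field_simp
  have hτs : |τ| < min δ 1 := by
    have hm : 0 < min δ 1 := by positivity
    have h1 : (N0:ℝ) < N := by exact_mod_cast (by omega : N0 < N)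
    rw [hτ, abs_div, abs_of_pos hNpos, div_lt_iff₀ hNpos]
    rw [div_lt_iff₀ hm] at hN0
    nlinarith
  have hτ1 : |τ| ≤ 1 := hτs.le.trans (min_le_right _ _)
  have hτδ : |τ| < δ := hτs.trans_le (min_le_left _ _)
  have hmem : ∀ k : ℕ, k ≤ N → a + k * τ ∈ uIcc a b := by
    intro k hk
    have hk' : (k:ℝ) / N ≤ 1 := (div_le_one hNpos).2 (by exact_mod_cast hk)
    have hk0 : 0 ≤ (k:ℝ) / N := by positivity
    have : a + k * τ = a + (k / N) * (b - a) := by rw [hτ]; ring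
    rw [this, ← segment_eq_uIcc, segment_eq_image']
    exact ⟨k / N, ⟨hk0, hk'⟩, rfl⟩
  have hbd : ∀ t ∈ uIcc a b, |t| ≤ max |a| |b| := by
    intro t ht
    rcases mem_uIcc.1 ht with h | h
    · exact abs_le_max_abs_abs h.1 h.2
    · rw [max_comm]; exact abs_le_max_abs_abs h.1 h.2
  have hq1 : 1 ≤ 1 + C * |τ| := by
    have : 0 ≤ C * |τ| := by positivity
    linarith
  have key : ∀ k : ℕ, k ≤ N → ‖vpEuler G a τ k z - vpCurve h a z (a + k * τ)‖ ≤
      k * (ε / D * |τ|) * (1 + C * |τ|) ^ k := by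
    intro k
    induction k with
    | zero => intro _; simp [vpEuler, vpCurve_self]
    | succ k ih =>
      intro hk
      have ih' := ih (by omega)
      have h1 := vpStep_lip (hK _ (hbd _ (hmem k (by omega)))) hτ1 (vpEuler G a τ k z)
        (vpCurve h a z (a + k * τ))
      have h2 := hcons _ (hmem k (by omega)) τ hτδ
      have e : a + ((k + 1 : ℕ):ℝ) * τ = a + k * τ + τ := by push_cast; ring
      rw [e]
      change ‖vpStep (G (a + k * τ)) τ (vpEuler G a τ k z) - _‖ ≤ _
      have h3 := norm_sub_le_norm_sub_add_norm_sub
        (vpStep (G (a + k * τ)) τ (vpEuler G a τ k z))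
        (vpStep (G (a + k * τ)) τ (vpCurve h a z (a + k * τ))) (vpCurve h a z (a + k * τ + τ))
      rw [norm_sub_rev (vpCurve h a z (a + k * τ + τ))] at h2
      have h4 : (1 + C * |τ|) * ‖vpEuler G a τ k z - vpCurve h a z (a + k * τ)‖ ≤
        (1 + C * |τ|) * (k * (ε / D * |τ|) * (1 + C * |τ|) ^ k) := by gcongr
      have h5 : (ε / D * |τ|) * 1 ≤ (ε / D * |τ|) * (1 + C * |τ|) ^ (k + 1) := by
        gcongr
        exact one_le_pow₀ hq1
      push_cast
      calc _ ≤ _ := h3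
        _ ≤ (1 + C * |τ|) * (k * (ε / D * |τ|) * (1 + C * |τ|) ^ k) +
            (ε / D * |τ|) * (1 + C * |τ|) ^ (k + 1) := by linarith
        _ = _ := by ring
  have h1 := key N le_rfl
  have e : a + N * τ = b := by rw [hτ]; field_simp; ring
  rw [e] at h1
  rw [dist_eq_norm]
  refine h1.trans_lt ?_
  have h2 : (1 + C * |τ|) ^ N ≤ exp (C * |b - a|) := by
    calc (1 + C * |τ|) ^ N ≤ (exp (C * |τ|)) ^ N := by
          gcongr
          linarith [add_one_le_exp (C * |τ|)]
      _ = exp (C * |b - a|) := by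
          rw [← exp_nat_mul, ← hτN]; congr 1; ring
  calc N * (ε / D * |τ|) * (1 + C * |τ|) ^ N ≤ N * (ε / D * |τ|) * exp (C * |b - a|) := by gcongr
    _ = ε / D * (|b - a| * exp (C * |b - a|)) := by rw [← hτN]; ring
    _ < ε / D * D := by
        gcongr
        linarith
    _ = ε := by field_simp

lemma vpCurve_le {G : ℝ → E3 → E3} (h : VPReg G) (a b : ℝ) (s : Set (E3 × E3))
    : volume ((fun z => vpCurve h a z b) ⁻¹' s) ≤ volume s := by
  have hopen : ∀ U : Set (E3 × E3), IsOpen U →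
      volume ((fun z => vpCurve h a z b) ⁻¹' U) ≤ volume U := by
    intro U hU
    set A : ℕ → Set (E3 × E3) := fun n => ⋂ m ≥ n, (vpEuler G a ((b - a) / m) m) ⁻¹' U with hA
    have hmono : Monotone A := by
      intro n m hnm
      exact biInter_subset_biInter_left fun k (hk : m ≤ k) => hnm.trans hk
    have hsub : (fun z => vpCurve h a z b) ⁻¹' U ⊆ ⋃ n, A n := by
      intro z hz
      have := (vpEuler_tendsto h a b z).eventually (hU.mem_nhds hz)
      obtain ⟨n, hn⟩ := eventually_atTop.1 this
      exact mem_iUnion.2 ⟨n, mem_iInter₂.2 hn⟩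
    refine (measure_mono hsub).trans ?_
    rw [hmono.measure_iUnion]
    refine iSup_le fun n => ?_
    refine (measure_mono (biInter_subset_of_mem (le_refl n))).trans ?_
    rw [(vpEuler_mp h a _ n).measure_preimage hU.measurableSet.nullMeasurableSet]
  rw [Set.measure_eq_iInf_isOpen s]
  refine le_iInf₂ fun U hsU => le_iInf fun hU => ?_
  exact (measure_mono (preimage_mono hsU)).trans (hopen U hU)

/-- Liouville's theorem. -/
lemma vpCurve_mp {G : ℝ → E3 → E3} (h : VPReg G) (a b : ℝ) :
    MeasurePreserving (fun z => vpCurve h a z b) volume volume := by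
  refine ⟨(vpCurve_continuous_start h a b).measurable, ?_⟩
  ext s hs
  rw [Measure.map_apply (vpCurve_continuous_start h a b).measurable hs]
  refine le_antisymm (vpCurve_le h a b s) ?_
  refine le_trans (le_of_eq ?_) (vpCurve_le h b a _)
  congr 1
  ext z
  simp [vpCurve_inv]

end VPthree

section VPfour
open Set Filter Topology
open scoped NNReal ENNReal

/-- Area of the unit sphere. -/
def vpκ : ℝ := 3 * volume.real (Metric.ball (0 : E3) 1)

lemma vpκ_nonneg : 0 ≤ vpκ := by unfold vpκ; positivity

lemma vp_radial {g h : ℝ → ℝ} {B : ℝ} (hg0 : ∀ r, 0 ≤ r → 0 ≤ g r) (hgm : Measurable g)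
    (hle : ∀ r, 0 < r → r ^ 2 * g r ≤ h r) (hh : IntegrableOn h (Ioi 0))
    (hB : ∫ r in Ioi (0:ℝ), h r ≤ B) (x : E3) :
    ∫⁻ y : E3, ENNReal.ofReal (g ‖x - y‖) ≤ ENNReal.ofReal (vpκ * B) := by
  rw [lintegral_sub_left_eq_self (fun y : E3 => ENNReal.ofReal (g ‖y‖)) x]
  have hi : IntegrableOn (fun r : ℝ => r ^ 2 * g r) (Ioi 0) := by
    refine Integrable.mono' hh (by fun_prop) ?_
    refine (ae_restrict_iff' measurableSet_Ioi).2 (Eventually.of_forall fun r (hr : 0 < r) => ?_)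
    rw [Real.norm_of_nonneg (mul_nonneg (by positivity) (hg0 r hr.le))]
    exact hle r hr
  have hI : Integrable (fun y : E3 => g ‖y‖) := by
    rw [integrable_fun_norm_addHaar]
    simpa using hi
  rw [← ofReal_integral_eq_lintegral_ofReal hI
    (Eventually.of_forall fun y => hg0 _ (norm_nonneg y))]
  apply ENNReal.ofReal_le_ofReal
  rw [integral_fun_norm_addHaar]
  simp only [finrank_euclideanSpace, Fintype.card_fin, smul_eq_mul, nsmul_eq_mul]
  rw [vpκ, ← mul_assoc]
  push_cast
  refine mul_le_mul_of_nonneg_left (le_trans ?_ hB) (by positivity)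
  exact setIntegral_mono_on hi hh measurableSet_Ioi fun r hr => hle r hr

lemma vp_radial_ball {g : ℝ → ℝ} {a c : ℝ} (ha : 0 ≤ a) (hg0 : ∀ r, 0 ≤ r → 0 ≤ g r)
    (hgm : Measurable g) (hle : ∀ r, 0 < r → r ≤ a → r ^ 2 * g r ≤ c) (x : E3) :
    ∫⁻ y : E3, ENNReal.ofReal (if ‖x - y‖ ≤ a then g ‖x - y‖ else 0) ≤
      ENNReal.ofReal (vpκ * (c * a)) := by
  refine vp_radial (g := fun r => if r ≤ a then g r else 0) (h := (Ioc 0 a).indicator fun _ => c)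
    ?_ ?_ ?_ ?_ ?_ x
  · intro r hr; split_ifs; exacts [hg0 r hr, le_rfl]
  · exact Measurable.ite measurableSet_Iic hgm measurable_const
  · intro r hr
    by_cases h : r ≤ a
    · rw [indicator_of_mem (show r ∈ Ioc 0 a from ⟨hr, h⟩), if_pos h]; exact hle r hr h
    · rw [indicator_of_notMem (fun h' : r ∈ Ioc 0 a => h h'.2), if_neg h]; simp
  · refine Integrable.integrableOn ?_
    rw [integrable_indicator_iff measurableSet_Ioc]
    exact integrableOn_const (by simp)
  · have : ∫ r in Ioi (0:ℝ), (Ioc 0 a).indicator (fun _ => c) r = c * a := by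
      rw [setIntegral_indicator measurableSet_Ioc, inter_eq_self_of_subset_right (fun r hr => hr.1)]
      simp [ha, mul_comm]
    exact this.le

lemma vp_ball2 {a : ℝ} (ha : 0 ≤ a) (x : E3) :
    ∫⁻ y : E3, ENNReal.ofReal (if ‖x - y‖ ≤ a then (‖x - y‖ ^ 2)⁻¹ else 0) ≤
      ENNReal.ofReal (vpκ * a) := by
  have := vp_radial_ball (g := fun r => (r ^ 2)⁻¹) (c := 1) ha (fun r _ => by positivity)
    (by fun_prop) (fun r hr _ => by rw [mul_inv_cancel₀ (by positivity)]) x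
  simpa using this

lemma vp_ball1 {a : ℝ} (ha : 0 ≤ a) (x : E3) :
    ∫⁻ y : E3, ENNReal.ofReal (if ‖x - y‖ ≤ a then (‖x - y‖)⁻¹ else 0) ≤
      ENNReal.ofReal (vpκ * a ^ 2) := by
  have := vp_radial_ball (g := fun r => r⁻¹) (c := a) ha (fun r hr => by positivity)
    (by fun_prop) (fun r hr h => by field_simp; exact h) x
  simpa [pow_two] using this

lemma vp_ball0 {a : ℝ} (ha : 0 ≤ a) (x : E3) :
    ∫⁻ y : E3, ENNReal.ofReal (if ‖x - y‖ ≤ a then 1 else 0) ≤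
      ENNReal.ofReal (vpκ * a ^ 3) := by
  have := vp_radial_ball (g := fun r => 1) (c := a ^ 2) ha (fun r hr => by positivity)
    (by fun_prop) (fun r hr h => by rw [mul_one]; gcongr) x
  rwa [← pow_succ] at this

lemma vp_int4 (x : E3) :
    ∫⁻ y : E3, ENNReal.ofReal (((1 + ‖x - y‖ ^ 2) ^ 2)⁻¹) ≤ ENNReal.ofReal (vpκ * (π / 2)) := by
  refine vp_radial (g := fun r => ((1 + r ^ 2) ^ 2)⁻¹) (h := fun r => (1 + r ^ 2)⁻¹)
    (fun r _ => by positivity) (by fun_prop) (fun r hr => ?_)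
    integrable_inv_one_add_sq.integrableOn ?_ x
  · rw [← div_eq_mul_inv, div_le_iff₀ (by positivity)]
    field_simp
    linarith
  · rw [integral_Ioi_inv_one_add_sq]; simp

lemma vp_int_d {d : ℝ} (hd : 0 < d) (x : E3) :
    ∫⁻ y : E3, ENNReal.ofReal (d ^ 2 / (‖x - y‖ ^ 2 * (‖x - y‖ ^ 2 + d ^ 2))) ≤
      ENNReal.ofReal (vpκ * (2 * d)) := by
  have e : ∀ r : ℝ, (1 + (d⁻¹ * r) ^ 2)⁻¹ = d ^ 2 / (r ^ 2 + d ^ 2) := by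
    intro r; field_simp; ring
  refine vp_radial (g := fun r => d ^ 2 / (r ^ 2 * (r ^ 2 + d ^ 2)))
    (h := fun r => (1 + (d⁻¹ * r) ^ 2)⁻¹)
    (fun r _ => by positivity) (by fun_prop) (fun r hr => ?_) ?_ ?_ x
  · rw [e]
    apply le_of_eq
    field_simp
  · exact (integrable_inv_one_add_sq.comp_mul_left' (inv_ne_zero hd.ne')).integrableOn
  · rw [integral_comp_mul_left_Ioi (fun r => (1 + r ^ 2)⁻¹) 0 (inv_pos.2 hd), mul_zero,
      integral_Ioi_inv_one_add_sq]
    simp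
    nlinarith [pi_lt_four]

lemma vp_int_log {d R : ℝ} (hd : 0 < d) (hR : 0 ≤ R) (x : E3) :
    ∫⁻ y : E3, ENNReal.ofReal (if ‖x - y‖ ≤ R then (√(‖x - y‖ ^ 2 + d ^ 2) ^ 3)⁻¹ else 0) ≤
      ENNReal.ofReal (vpκ * (2 * log (1 + R / d))) := by
  refine vp_radial (g := fun r => if r ≤ R then (√(r ^ 2 + d ^ 2) ^ 3)⁻¹ else 0)
    (h := (Ioc 0 R).indicator fun r => 2 * (r + d)⁻¹)
    (fun r _ => by positivity) ?_ (fun r hr => ?_) ?_ ?_ x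
  · exact Measurable.ite measurableSet_Iic (by fun_prop) measurable_const
  · by_cases h : r ≤ R
    · rw [indicator_of_mem (show r ∈ Ioc 0 R from ⟨hr, h⟩), if_pos h]
      have h1 : r ≤ √(r ^ 2 + d ^ 2) := le_sqrt_of_sq_le (by nlinarith)
      have h2 : (r + d) / 2 ≤ √(r ^ 2 + d ^ 2) := le_sqrt_of_sq_le (by nlinarith [sq_nonneg (r - d)])
      set s := √(r ^ 2 + d ^ 2)
      have hs : 0 < s := by linarith
      calc r ^ 2 * (s ^ 3)⁻¹ ≤ s ^ 2 * (s ^ 3)⁻¹ := by gcongr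
        _ = s⁻¹ := by field_simp
        _ ≤ ((r + d) / 2)⁻¹ := by gcongr
        _ = 2 * (r + d)⁻¹ := by field_simp
    · rw [indicator_of_notMem (fun h' : r ∈ Ioc 0 R => h h'.2), if_neg h]; simp
  · refine Integrable.integrableOn ?_
    rw [integrable_indicator_iff measurableSet_Ioc]
    refine IntegrableOn.mono_set (ContinuousOn.integrableOn_Icc (a := 0) (b := R) ?_) Ioc_subset_Icc_self
    refine ContinuousOn.mul continuousOn_const (ContinuousOn.inv₀ (by fun_prop) fun r hr => ?_)
    linarith [hr.1]
  · rw [setIntegral_indicator measurableSet_Ioc, inter_eq_self_of_subset_right (fun r hr => hr.1),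
      ← intervalIntegral.integral_of_le hR, intervalIntegral.integral_const_mul,
      intervalIntegral.integral_comp_add_right (fun r => r⁻¹),
      integral_inv_of_pos (by linarith) (by linarith)]
    apply le_of_eq
    congr 2
    field_simp
    ring

end VPfour

section VPfive
open Set Filter Topology
open scoped NNReal ENNReal

/-- Softened distance. -/
def vpS (ε : ℝ) (x : E3) : ℝ := √(‖x‖ ^ 2 + ε ^ 2)

/-- Softened Newton kernel. -/
def vpK (ε : ℝ) (x : E3) : E3 := (vpS ε x ^ 3)⁻¹ • x

lemma vpS_sq (ε : ℝ) (x : E3) : vpS ε x ^ 2 = ‖x‖ ^ 2 + ε ^ 2 := sq_sqrt (by positivity)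
lemma vpS_nonneg (ε : ℝ) (x : E3) : 0 ≤ vpS ε x := sqrt_nonneg _
lemma vpS_ge (ε : ℝ) (x : E3) : ‖x‖ ≤ vpS ε x := le_sqrt_of_sq_le (by nlinarith [sq_nonneg ε])
lemma vpS_ge' {ε : ℝ} (x : E3) : ε ≤ vpS ε x :=
  le_sqrt_of_sq_le (by nlinarith [sq_nonneg ‖x‖])
lemma vpS_pos {ε : ℝ} (hε : 0 < ε) (x : E3) : 0 < vpS ε x := hε.trans_le (vpS_ge' x)
lemma vpS_zero (x : E3) : vpS 0 x = ‖x‖ := by simp [vpS]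

lemma vpS_continuous (ε : ℝ) : Continuous (vpS ε) := by unfold vpS; fun_prop

lemma vpK_norm_eq (ε : ℝ) (x : E3) : ‖vpK ε x‖ = (vpS ε x ^ 3)⁻¹ * ‖x‖ := by
  have := vpS_nonneg ε x
  rw [vpK, norm_smul, Real.norm_of_nonneg (by positivity)]

lemma vpK_norm (ε : ℝ) (x : E3) : ‖vpK ε x‖ ≤ (‖x‖ ^ 2 + ε ^ 2)⁻¹ := by
  rw [vpK_norm_eq, ← vpS_sq]
  have h1 := vpS_ge ε x
  rcases (vpS_nonneg ε x).eq_or_lt with h | h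
  · rw [← h]; simp
  · calc (vpS ε x ^ 3)⁻¹ * ‖x‖ ≤ (vpS ε x ^ 3)⁻¹ * vpS ε x := by gcongr
      _ = (vpS ε x ^ 2)⁻¹ := by field_simp

lemma vpK_norm' (ε : ℝ) (x : E3) : ‖vpK ε x‖ ≤ (‖x‖ ^ 2)⁻¹ := by
  by_cases hx : x = 0
  · simp [vpK, hx]
  · have : 0 < ‖x‖ := norm_pos_iff.2 hx
    refine (vpK_norm ε x).trans ?_
    gcongr
    nlinarith [sq_nonneg ε]

lemma vpK_neg (ε : ℝ) (x : E3) : vpK ε (-x) = - vpK ε x := by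
  simp [vpK, vpS]

lemma vpK_measurable (ε : ℝ) : Measurable (vpK ε) := by
  have := (vpS_continuous ε).measurable
  unfold vpK
  fun_prop

lemma vpK_contDiff {ε : ℝ} (hε : 0 < ε) : ContDiff ℝ 1 (vpK ε) := by
  have h1 : ContDiff ℝ 1 (vpS ε) := by
    unfold vpS
    have : ContDiff ℝ 1 fun x : E3 => ‖x‖ ^ 2 + ε ^ 2 := (contDiff_norm_sq ℝ).add contDiff_const
    exact this.sqrt fun x => by positivity
  have h2 : ContDiff ℝ 1 fun x => (vpS ε x ^ 3)⁻¹ :=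
    (ContDiff.pow h1 3).inv fun x => (pow_pos (vpS_pos hε x) 3).ne'
  exact h2.smul (contDiff_id (𝕜 := ℝ) (E := E3))

lemma vpK_continuous {ε : ℝ} (hε : 0 < ε) : Continuous (vpK ε) := (vpK_contDiff hε).continuous

lemma vpK_hasFDerivAt {ε : ℝ} (hε : 0 < ε) (x : E3) :
    HasFDerivAt (vpK ε) (fderiv ℝ (vpK ε) x) x :=
  ((vpK_contDiff hε).differentiable one_ne_zero x).hasFDerivAt

lemma vpS_hasFDerivAt {ε : ℝ} (hε : 0 < ε) (x : E3) :
    HasFDerivAt (vpS ε) ((1 / (2 * vpS ε x)) • (2 • innerSL ℝ x)) x := by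
  have h1 : HasFDerivAt (fun x : E3 => ‖x‖ ^ 2 + ε ^ 2) (2 • innerSL ℝ x) x :=
    (hasStrictFDerivAt_norm_sq x).hasFDerivAt.add_const _
  exact h1.sqrt (by positivity)

lemma vpK_fderiv_norm {ε : ℝ} (hε : 0 < ε) (x : E3) :
    ‖fderiv ℝ (vpK ε) x‖ ≤ 4 * (vpS ε x ^ 3)⁻¹ := by
  set s := vpS ε x with hs
  have hs0 : 0 < s := vpS_pos hε x
  have h2 : HasFDerivAt (fun x => (vpS ε x ^ 3)⁻¹)
      ((-(3 * s ^ 2) / (s ^ 3) ^ 2) • ((1 / (2 * vpS ε x)) • (2 • innerSL ℝ x))) x := by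
    have h3 : HasDerivAt (fun r : ℝ => (r ^ 3)⁻¹) (-(3 * s ^ 2) / (s ^ 3) ^ 2) (vpS ε x) := by
      have := (hasDerivAt_pow 3 s).inv (by positivity)
      simp only [Nat.cast_ofNat, Nat.add_one_sub_one] at this
      exact this
    exact h3.comp_hasFDerivAt x (vpS_hasFDerivAt hε x)
  have h4 := h2.smul (hasFDerivAt_id (𝕜 := ℝ) x)
  have h5 : fderiv ℝ (vpK ε) x = _ := h4.fderiv
  rw [h5]
  refine ContinuousLinearMap.opNorm_le_bound _ (by positivity) fun v => ?_
  simp only [_root_.add_apply, _root_.smul_apply, id_eq,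
    ContinuousLinearMap.smulRight_apply, ContinuousLinearMap.id_apply, innerSL_apply_apply,
    smul_eq_mul, nsmul_eq_mul, Nat.cast_ofNat, ← hs]
  refine (norm_add_le _ _).trans ?_
  rw [norm_smul, norm_smul, Real.norm_of_nonneg (by positivity : 0 ≤ (s ^ 3)⁻¹), Real.norm_eq_abs]
  have h6 : -(3 * s ^ 2) / (s ^ 3) ^ 2 * (1 / (2 * s) * (2 * inner ℝ x v)) =
      - (3 * (s ^ 5)⁻¹ * inner ℝ x v) := by
    field_simp
  rw [h6, abs_neg, abs_mul, abs_of_nonneg (by positivity : 0 ≤ 3 * (s ^ 5)⁻¹)]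
  have h7 := abs_real_inner_le_norm x v
  have h8 : ‖x‖ ≤ s := vpS_ge ε x
  have h9 : 3 * (s ^ 5)⁻¹ * |inner ℝ x v| * ‖x‖ ≤ 3 * (s ^ 5)⁻¹ * (s * ‖v‖) * s := by
    have : ‖x‖ * ‖v‖ ≤ s * ‖v‖ := by gcongr
    gcongr
    linarith
  calc _ ≤ (s ^ 3)⁻¹ * ‖v‖ + 3 * (s ^ 5)⁻¹ * (s * ‖v‖) * s := by linarith
    _ = _ := by field_simp; ring

lemma vpK_lip {ε : ℝ} (hε : 0 < ε) (x y : E3) :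
    ‖vpK ε x - vpK ε y‖ ≤ 4 * (ε ^ 3)⁻¹ * ‖x - y‖ := by
  refine convex_univ.norm_image_sub_le_of_norm_hasFDerivWithin_le (𝕜 := ℝ)
    (fun z _ => (vpK_hasFDerivAt hε z).hasFDerivWithinAt) (fun z _ => ?_) (mem_univ y) (mem_univ x)
  refine (vpK_fderiv_norm hε z).trans ?_
  have := vpS_ge' (ε := ε) z
  gcongr

lemma vpK_diff {d : ℝ} (hd : 0 < d) (x : E3) :
    ‖vpK 0 x - vpK d x‖ ≤ 3 * (d ^ 2 / (‖x‖ ^ 2 * (‖x‖ ^ 2 + d ^ 2))) := by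
  by_cases hx : x = 0
  · simp [vpK, hx]
  have ha : 0 < ‖x‖ := norm_pos_iff.2 hx
  have hs := vpS_pos hd x
  have hsq := vpS_sq d x
  have hge := vpS_ge d x
  rw [vpK, vpK, vpS_zero, ← sub_smul, norm_smul, Real.norm_eq_abs, ← hsq]
  set s := vpS d x
  set a := ‖x‖
  have h1 : (s ^ 3)⁻¹ ≤ (a ^ 3)⁻¹ := by gcongr
  rw [abs_of_nonneg (by linarith)]
  have h2 : d ^ 2 = (s - a) * (s + a) := by nlinarith
  rw [h2]
  have h3 : ((a ^ 3)⁻¹ - (s ^ 3)⁻¹) * a = (s - a) * (s ^ 2 + s * a + a ^ 2) / (a ^ 2 * s ^ 3) := by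
    field_simp; ring
  rw [h3, mul_div_assoc', div_le_div_iff₀ (by positivity) (by positivity)]
  have h4 : 0 ≤ s - a := by linarith
  have h5 : (s ^ 2 + s * a + a ^ 2) ≤ 3 * (s + a) * s := by nlinarith
  calc (s - a) * (s ^ 2 + s * a + a ^ 2) * (a ^ 2 * s ^ 2)
      ≤ (s - a) * (3 * (s + a) * s) * (a ^ 2 * s ^ 2) := by gcongr
    _ = _ := by ring

lemma vpK_diff_int0 {d : ℝ} (hd : 0 ≤ d) :
    ∫⁻ y : E3, ‖vpK 0 y - vpK d y‖ₑ ≤ ENNReal.ofReal (6 * vpκ * d) := by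
  rcases hd.eq_or_lt with h | hd
  · simp [← h]
  have h1 := vp_int_d hd (0:E3)
  simp only [zero_sub, norm_neg] at h1
  calc ∫⁻ y : E3, ‖vpK 0 y - vpK d y‖ₑ
      ≤ ∫⁻ y : E3, ENNReal.ofReal 3 * ENNReal.ofReal (d ^ 2 / (‖y‖ ^ 2 * (‖y‖ ^ 2 + d ^ 2))) := by
        refine lintegral_mono fun y => ?_
        rw [← ENNReal.ofReal_mul (by norm_num), ← ofReal_norm]
        exact ENNReal.ofReal_le_ofReal (vpK_diff hd y)
    _ = ENNReal.ofReal 3 * ∫⁻ y : E3, ENNReal.ofReal (d ^ 2 / (‖y‖ ^ 2 * (‖y‖ ^ 2 + d ^ 2))) := by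
        rw [lintegral_const_mul' _ _ (by simp)]
    _ ≤ ENNReal.ofReal 3 * ENNReal.ofReal (vpκ * (2 * d)) := by gcongr
    _ = ENNReal.ofReal (6 * vpκ * d) := by
        rw [← ENNReal.ofReal_mul (by norm_num)]; congr 1; ring

lemma vpK_diff_int {ε d : ℝ} (hε : 0 ≤ ε) (hd : 0 ≤ d) (x : E3) :
    ∫⁻ y : E3, ‖vpK ε (x - y) - vpK d (x - y)‖ₑ ≤ ENNReal.ofReal (6 * vpκ * (ε + d)) := by
  rw [lintegral_sub_left_eq_self (fun y : E3 => ‖vpK ε y - vpK d y‖ₑ) x]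
  have hk := vpκ_nonneg
  have m0 := vpK_measurable 0
  have m1 := vpK_measurable ε
  calc ∫⁻ y : E3, ‖vpK ε y - vpK d y‖ₑ
      ≤ ∫⁻ y : E3, (‖vpK 0 y - vpK ε y‖ₑ + ‖vpK 0 y - vpK d y‖ₑ) := by
        refine lintegral_mono fun y => ?_
        have : vpK ε y - vpK d y = - (vpK 0 y - vpK ε y) + (vpK 0 y - vpK d y) := by abel
        rw [this]
        refine (enorm_add_le _ _).trans ?_
        rw [enorm_neg]
    _ = (∫⁻ y : E3, ‖vpK 0 y - vpK ε y‖ₑ) + ∫⁻ y : E3, ‖vpK 0 y - vpK d y‖ₑ := by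
        rw [lintegral_add_left (by fun_prop)]
    _ ≤ ENNReal.ofReal (6 * vpκ * ε) + ENNReal.ofReal (6 * vpκ * d) :=
        add_le_add (vpK_diff_int0 hε) (vpK_diff_int0 hd)
    _ = _ := by rw [← ENNReal.ofReal_add (by positivity) (by positivity)]; congr 1; ring

/-- Splitting of integrals over a ball of a decreasing kernel. -/
lemma vp_ball_split {g : ℝ → ℝ} (hgm : Measurable g) {R b : ℝ} (hR : 0 < R)
    (hdec : ∀ r, R ≤ r → g r ≤ b * (R ^ 3)⁻¹) (hb : 0 ≤ b)
    {I : ℝ} (hI0 : 0 ≤ I) (x : E3)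
    (hI : ∫⁻ y : E3, ENNReal.ofReal (if ‖x - y‖ ≤ R then g ‖x - y‖ else 0) ≤ ENNReal.ofReal I) :
    ∫⁻ y in Metric.closedBall (0:E3) R, ENNReal.ofReal (g ‖x - y‖) ≤
      ENNReal.ofReal (I + vpκ * b) := by
  have hk := vpκ_nonneg
  have h0 := vp_ball0 hR.le (0 : E3)
  simp only [zero_sub, norm_neg] at h0
  rw [← lintegral_indicator Metric.isClosed_closedBall.measurableSet]
  calc ∫⁻ y, (Metric.closedBall (0:E3) R).indicator (fun y => ENNReal.ofReal (g ‖x - y‖)) y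
      ≤ ∫⁻ y : E3, (ENNReal.ofReal (if ‖x - y‖ ≤ R then g ‖x - y‖ else 0) +
          ENNReal.ofReal (b * (R ^ 3)⁻¹) * ENNReal.ofReal (if ‖y‖ ≤ R then 1 else 0)) := by
        refine lintegral_mono fun y => ?_
        by_cases hy : ‖y‖ ≤ R
        · rw [indicator_of_mem (by simpa using hy)]
          by_cases hxy : ‖x - y‖ ≤ R
          · simp [hxy]
          · simp only [hxy, hy, if_true, if_false]
            simp only [ENNReal.ofReal_zero, zero_add, ENNReal.ofReal_one, mul_one]
            exact ENNReal.ofReal_le_ofReal (hdec _ (not_le.1 hxy).le)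
        · rw [indicator_of_notMem (by simpa using hy)]
          exact zero_le
    _ = (∫⁻ y : E3, ENNReal.ofReal (if ‖x - y‖ ≤ R then g ‖x - y‖ else 0)) +
          ENNReal.ofReal (b * (R ^ 3)⁻¹) * ∫⁻ y : E3, ENNReal.ofReal (if ‖y‖ ≤ R then 1 else 0) := by
        rw [lintegral_add_left, lintegral_const_mul' _ _ (by simp)]
        refine ENNReal.measurable_ofReal.comp (Measurable.ite ?_ (by fun_prop) measurable_const)
        exact (isClosed_le (by fun_prop) continuous_const).measurableSet
    _ ≤ ENNReal.ofReal I + ENNReal.ofReal (b * (R ^ 3)⁻¹) * ENNReal.ofReal (vpκ * R ^ 3) := by gcongr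
    _ = _ := by
        rw [← ENNReal.ofReal_mul (by positivity), ← ENNReal.ofReal_add hI0 (by positivity)]
        congr 1
        field_simp

lemma vp_ball2' {R : ℝ} (hR : 0 < R) (x : E3) :
    ∫⁻ y in Metric.closedBall (0:E3) R, ENNReal.ofReal ((‖x - y‖ ^ 2)⁻¹) ≤
      ENNReal.ofReal (2 * vpκ * R) := by
  have hk := vpκ_nonneg
  have := vp_ball_split (g := fun r => (r ^ 2)⁻¹) (by fun_prop) hR (b := R)
    (fun r hr => by
      have : R * (R ^ 3)⁻¹ = (R ^ 2)⁻¹ := by field_simp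
      rw [this]; gcongr) hR.le (by positivity) x (vp_ball2 hR.le x)
  refine this.trans (ENNReal.ofReal_le_ofReal ?_)
  linarith

lemma vp_log' {d R : ℝ} (hd : 0 < d) (hR : 0 < R) (x : E3) :
    ∫⁻ y in Metric.closedBall (0:E3) R, ENNReal.ofReal ((vpS d (x - y) ^ 3)⁻¹) ≤
      ENNReal.ofReal (2 * vpκ * (1 + log (1 + R / d))) := by
  have hk := vpκ_nonneg
  have hl : 0 ≤ log (1 + R / d) := log_nonneg (by have : 0 < R / d := by positivity
                                                  linarith)
  have := vp_ball_split (g := fun r => (√(r ^ 2 + d ^ 2) ^ 3)⁻¹) (by fun_prop) hR (b := 1)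
    (fun r hr => by
      have : R ≤ √(r ^ 2 + d ^ 2) := le_sqrt_of_sq_le (by nlinarith)
      rw [one_mul]; gcongr) zero_le_one (by positivity) x (vp_int_log hd hR.le x)
  refine this.trans (ENNReal.ofReal_le_ofReal ?_)
  nlinarith

end VPfive

section VPsix
open Set Filter Topology
open scoped NNReal ENNReal

/-- The field generated by a density with the softened kernel. -/
def vpFld (ε : ℝ) (ρ : E3 → ℝ) (x : E3) : E3 := ∫ y : E3, ρ y • vpK ε (x - y)

/-- Bounded, compactly supported continuous density. -/
structure VPDen (ρ : E3 → ℝ) (M R : ℝ) : Prop where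
  cont : Continuous ρ
  bd : ∀ y, |ρ y| ≤ M
  supp : ∀ y, R < ‖y‖ → ρ y = 0
  hR : 0 < R

lemma VPDen.hM {ρ : E3 → ℝ} {M R : ℝ} (h : VPDen ρ M R) : 0 ≤ M :=
  (abs_nonneg _).trans (h.bd 0)

lemma vpFld_lint (ε : ℝ) {ρ : E3 → ℝ} {M R : ℝ} (h : VPDen ρ M R) (x : E3) :
    ∫⁻ y, ‖ρ y • vpK ε (x - y)‖ₑ ≤ ENNReal.ofReal (M * (2 * vpκ * R)) := by
  have hM := h.hM
  calc ∫⁻ y, ‖ρ y • vpK ε (x - y)‖ₑ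
      ≤ ∫⁻ y, (Metric.closedBall (0:E3) R).indicator
          (fun y => ENNReal.ofReal M * ENNReal.ofReal ((‖x - y‖ ^ 2)⁻¹)) y := by
        refine lintegral_mono fun y => ?_
        by_cases hy : R < ‖y‖
        · simp [h.supp y hy]
        · rw [indicator_of_mem (by simpa using hy), ← ENNReal.ofReal_mul hM, ← ofReal_norm]
          apply ENNReal.ofReal_le_ofReal
          rw [norm_smul]
          have := vpK_norm' ε (x - y)
          have := h.bd y
          rw [Real.norm_eq_abs]
          gcongr
    _ = ENNReal.ofReal M * ∫⁻ y in Metric.closedBall (0:E3) R, ENNReal.ofReal ((‖x - y‖ ^ 2)⁻¹) := by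
        rw [lintegral_indicator Metric.isClosed_closedBall.measurableSet,
          lintegral_const_mul' _ _ (by simp)]
    _ ≤ ENNReal.ofReal M * ENNReal.ofReal (2 * vpκ * R) := by
        gcongr; exact vp_ball2' h.hR x
    _ = _ := by rw [← ENNReal.ofReal_mul hM]

lemma vpFld_integrable (ε : ℝ) {ρ : E3 → ℝ} {M R : ℝ} (h : VPDen ρ M R) (x : E3) :
    Integrable fun y => ρ y • vpK ε (x - y) := by
  refine ⟨?_, (vpFld_lint ε h x).trans_lt ENNReal.ofReal_lt_top⟩
  have := h.cont.measurable
  have := vpK_measurable ε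
  exact (by fun_prop : Measurable fun y => ρ y • vpK ε (x - y)).aestronglyMeasurable

lemma vp_norm_integral_le {α : Type*} [MeasurableSpace α] {μ : Measure α}
    {E : Type*} [NormedAddCommGroup E] [NormedSpace ℝ E] {f : α → E} {C : ℝ} (hC : 0 ≤ C)
    (h : ∫⁻ a, ‖f a‖ₑ ∂μ ≤ ENNReal.ofReal C) : ‖∫ a, f a ∂μ‖ ≤ C := by
  have := (enorm_integral_le_lintegral_enorm f).trans h
  rw [← ofReal_norm] at this
  exact (ENNReal.ofReal_le_ofReal_iff hC).1 this

lemma vpFld_norm (ε : ℝ) {ρ : E3 → ℝ} {M R : ℝ} (h : VPDen ρ M R) (x : E3) :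
    ‖vpFld ε ρ x‖ ≤ M * (2 * vpκ * R) := by
  have := h.hM
  have := h.hR
  have := vpκ_nonneg
  exact vp_norm_integral_le (by positivity) (vpFld_lint ε h x)

lemma vpFld_sub (ε : ℝ) {ρ ρ' : E3 → ℝ} {M R M' R' : ℝ} (h : VPDen ρ M R) (h' : VPDen ρ' M' R')
    (x : E3) : vpFld ε ρ x - vpFld ε ρ' x = vpFld ε (fun y => ρ y - ρ' y) x := by
  unfold vpFld
  rw [← integral_sub (vpFld_integrable ε h x) (vpFld_integrable ε h' x)]
  simp [sub_smul]

lemma vp_conv_bound {ε d : ℝ} (hε : 0 ≤ ε) (hd : 0 ≤ d) {φ : E3 → ℝ} {B : ℝ} (hB : 0 ≤ B)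
    (hφ : ∀ y, |φ y| ≤ B) :
    ‖∫ y, φ y • (vpK ε y - vpK d y)‖ ≤ B * (6 * vpκ * (ε + d)) := by
  have hk := vpκ_nonneg
  refine vp_norm_integral_le (by positivity) ?_
  have h1 := vpK_diff_int hε hd (0:E3)
  rw [lintegral_sub_left_eq_self (fun y : E3 => ‖vpK ε y - vpK d y‖ₑ) 0] at h1
  calc ∫⁻ y, ‖φ y • (vpK ε y - vpK d y)‖ₑ
      ≤ ∫⁻ y, ENNReal.ofReal B * ‖vpK ε y - vpK d y‖ₑ := by
        refine lintegral_mono fun y => ?_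
        rw [enorm_smul]
        gcongr
        rw [← ofReal_norm]
        exact ENNReal.ofReal_le_ofReal (hφ y)
    _ = ENNReal.ofReal B * ∫⁻ y, ‖vpK ε y - vpK d y‖ₑ := lintegral_const_mul' _ _ (by simp)
    _ ≤ ENNReal.ofReal B * ENNReal.ofReal (6 * vpκ * (ε + d)) := by gcongr
    _ = _ := by rw [← ENNReal.ofReal_mul hB]

lemma vpFld_diff_eq (ε d : ℝ) {ρ : E3 → ℝ} {M R : ℝ} (h : VPDen ρ M R) (x : E3) :
    vpFld ε ρ x - vpFld d ρ x = ∫ y, ρ (x - y) • (vpK ε y - vpK d y) := by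
  unfold vpFld
  rw [← integral_sub (vpFld_integrable ε h x) (vpFld_integrable d h x)]
  rw [← integral_sub_left_eq_self (fun y => ρ (x - y) • (vpK ε y - vpK d y)) volume x]
  simp [smul_sub]

lemma vpFld_diff {ε d : ℝ} (hε : 0 ≤ ε) (hd : 0 ≤ d) {ρ : E3 → ℝ} {M R : ℝ} (h : VPDen ρ M R)
    (x : E3) : ‖vpFld ε ρ x - vpFld d ρ x‖ ≤ M * (6 * vpκ * (ε + d)) := by
  rw [vpFld_diff_eq ε d h]
  exact vp_conv_bound hε hd h.hM fun y => h.bd _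

lemma vpFld_diff_integrable (ε d : ℝ) {ρ : E3 → ℝ} {M R : ℝ} (h : VPDen ρ M R) (x : E3) :
    Integrable fun y => ρ (x - y) • (vpK ε y - vpK d y) := by
  have h1 := ((vpFld_integrable ε h x).sub (vpFld_integrable d h x)).comp_sub_left x
  simpa [smul_sub] using h1

lemma vpFld_diff_lip {ε d : ℝ} (hε : 0 ≤ ε) (hd : 0 ≤ d) {ρ : E3 → ℝ} {M R L : ℝ}
    (h : VPDen ρ M R) (hL0 : 0 ≤ L) (hL : ∀ y y', |ρ y - ρ y'| ≤ L * ‖y - y'‖) (x x' : E3) :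
    ‖(vpFld ε ρ x - vpFld d ρ x) - (vpFld ε ρ x' - vpFld d ρ x')‖ ≤
      6 * vpκ * (ε + d) * L * ‖x - x'‖ := by
  rw [vpFld_diff_eq ε d h, vpFld_diff_eq ε d h,
    ← integral_sub (vpFld_diff_integrable ε d h x) (vpFld_diff_integrable ε d h x')]
  simp_rw [← sub_smul]
  refine (vp_conv_bound hε hd (B := L * ‖x - x'‖) (by positivity) fun y => ?_).trans
    (le_of_eq (by ring))
  refine (hL _ _).trans (le_of_eq ?_)
  rw [sub_sub_sub_cancel_right]

lemma vpFld_fderiv_lint {d : ℝ} (hd : 0 < d) {ρ : E3 → ℝ} {M R : ℝ} (h : VPDen ρ M R) (x : E3) :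
    ∫⁻ y, ‖ρ y • fderiv ℝ (vpK d) (x - y)‖ₑ ≤
      ENNReal.ofReal (M * (8 * vpκ * (1 + log (1 + R / d)))) := by
  have hM := h.hM
  calc ∫⁻ y, ‖ρ y • fderiv ℝ (vpK d) (x - y)‖ₑ
      ≤ ∫⁻ y, (Metric.closedBall (0:E3) R).indicator
          (fun y => ENNReal.ofReal (M * 4) * ENNReal.ofReal ((vpS d (x - y) ^ 3)⁻¹)) y := by
        refine lintegral_mono fun y => ?_
        by_cases hy : R < ‖y‖
        · rw [enorm_smul, h.supp y hy, enorm_zero, zero_mul]; exact zero_le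
        · rw [indicator_of_mem (by simpa using hy), ← ENNReal.ofReal_mul (by positivity),
            ← ofReal_norm]
          apply ENNReal.ofReal_le_ofReal
          rw [norm_smul]
          have := vpK_fderiv_norm hd (x - y)
          have := h.bd y
          rw [Real.norm_eq_abs, mul_assoc]
          gcongr
    _ = ENNReal.ofReal (M * 4) *
        ∫⁻ y in Metric.closedBall (0:E3) R, ENNReal.ofReal ((vpS d (x - y) ^ 3)⁻¹) := by
        rw [lintegral_indicator Metric.isClosed_closedBall.measurableSet,
          lintegral_const_mul' _ _ (by simp)]
    _ ≤ ENNReal.ofReal (M * 4) * ENNReal.ofReal (2 * vpκ * (1 + log (1 + R / d))) := by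
        gcongr; exact vp_log' hd h.hR x
    _ = _ := by rw [← ENNReal.ofReal_mul (by positivity)]; congr 1; ring

/-- The derivative of the softened field. -/
def vpDFld (d : ℝ) (ρ : E3 → ℝ) (x : E3) : E3 →L[ℝ] E3 := ∫ y : E3, ρ y • fderiv ℝ (vpK d) (x - y)

lemma vpK_fderiv_continuous {d : ℝ} (hd : 0 < d) : Continuous (fderiv ℝ (vpK d)) :=
  (vpK_contDiff hd).continuous_fderiv one_ne_zero

lemma vpFld_hasFDerivAt {d : ℝ} (hd : 0 < d) {ρ : E3 → ℝ} {M R : ℝ} (h : VPDen ρ M R) (x : E3) :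
    HasFDerivAt (vpFld d ρ) (vpDFld d ρ x) x := by
  have hρ := h.cont
  have hK := vpK_continuous hd
  have hK' := vpK_fderiv_continuous hd
  refine hasFDerivAt_integral_of_dominated_of_fderiv_le (s := univ)
    (F := fun x y => ρ y • vpK d (x - y)) (F' := fun x y => ρ y • fderiv ℝ (vpK d) (x - y))
    (bound := (Metric.closedBall (0:E3) R).indicator fun _ => M * (4 * (d ^ 3)⁻¹)) univ_mem
    (Eventually.of_forall fun x =>
      (by fun_prop : Continuous fun y => ρ y • vpK d (x - y)).aestronglyMeasurable)
    (vpFld_integrable d h x)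
    (by fun_prop : Continuous fun y => ρ y • fderiv ℝ (vpK d) (x - y)).aestronglyMeasurable
    (Eventually.of_forall fun y x _ => ?_) ?_ (Eventually.of_forall fun y x _ => ?_)
  · by_cases hy : R < ‖y‖
    · rw [norm_smul, h.supp y hy, norm_zero, zero_mul]
      exact indicator_nonneg (fun _ _ => by have := h.hM; positivity) _
    · rw [indicator_of_mem (by simpa using hy), norm_smul]
      have h1 := h.bd y
      have h2 := vpK_fderiv_norm hd (x - y)
      have h3 : 4 * (vpS d (x - y) ^ 3)⁻¹ ≤ 4 * (d ^ 3)⁻¹ := by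
        have := vpS_ge' (ε := d) (x - y)
        gcongr
      rw [Real.norm_eq_abs]
      have := h.hM
      gcongr
      exact h2.trans h3
  · rw [integrable_indicator_iff Metric.isClosed_closedBall.measurableSet]
    exact integrableOn_const measure_closedBall_lt_top.ne
  · have h1 : HasFDerivAt (fun x => vpK d (x - y)) (fderiv ℝ (vpK d) (x - y)) x :=
      (hasFDerivAt_comp_sub y).2 (vpK_hasFDerivAt hd (x - y))
    exact h1.const_smul (ρ y)

lemma vpFld_lip {d : ℝ} (hd : 0 < d) {ρ : E3 → ℝ} {M R : ℝ} (h : VPDen ρ M R) (x x' : E3) :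
    ‖vpFld d ρ x - vpFld d ρ x'‖ ≤ M * (8 * vpκ * (1 + log (1 + R / d))) * ‖x - x'‖ := by
  have hM := h.hM
  have hR := h.hR
  have hk := vpκ_nonneg
  have hl : 0 ≤ log (1 + R / d) := log_nonneg (by
    have : 0 < R / d := by positivity
    linarith)
  refine convex_univ.norm_image_sub_le_of_norm_hasFDerivWithin_le (𝕜 := ℝ)
    (fun z _ => (vpFld_hasFDerivAt hd h z).hasFDerivWithinAt) (fun z _ => ?_) (mem_univ x')
    (mem_univ x)
  exact vp_norm_integral_le (by positivity) (vpFld_fderiv_lint hd h z)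

/-- The logarithmic Lipschitz estimate. -/
lemma vpFld_lip_all {ε d : ℝ} (hε : 0 ≤ ε) (hd : 0 < d) {ρ : E3 → ℝ} {M R L : ℝ}
    (h : VPDen ρ M R) (hL0 : 0 ≤ L) (hL : ∀ y y', |ρ y - ρ y'| ≤ L * ‖y - y'‖) (x x' : E3) :
    ‖vpFld ε ρ x - vpFld ε ρ x'‖ ≤
      (12 * vpκ * (d * L) + 8 * vpκ * M * (1 + log (1 + R / d))) * ‖x - x'‖ := by
  have hM := h.hM
  have hR := h.hR
  have hk := vpκ_nonneg
  have hn := norm_nonneg (x - x')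
  rcases le_total d ε with hde | hde
  · have hε' : 0 < ε := hd.trans_le hde
    refine (vpFld_lip hε' h x x').trans ?_
    have : log (1 + R / ε) ≤ log (1 + R / d) := by
      apply log_le_log (by positivity)
      gcongr
    have h2 : 0 ≤ 12 * vpκ * (d * L) := by positivity
    have h3 : M * (8 * vpκ * (1 + log (1 + R / ε))) ≤ 8 * vpκ * M * (1 + log (1 + R / d)) := by
      rw [← mul_assoc, mul_comm M]
      gcongr
    gcongr
    linarith
  · have h1 := vpFld_lip hd h x x'
    have h2 := vpFld_diff_lip hε hd.le h hL0 hL x x'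
    have e : vpFld ε ρ x - vpFld ε ρ x' = ((vpFld ε ρ x - vpFld d ρ x) -
      (vpFld ε ρ x' - vpFld d ρ x')) + (vpFld d ρ x - vpFld d ρ x') := by abel
    rw [e]
    refine (norm_add_le _ _).trans ?_
    have h3 : 6 * vpκ * (ε + d) * L * ‖x - x'‖ ≤ 6 * vpκ * (d + d) * L * ‖x - x'‖ := by gcongr
    nlinarith

end VPsix

section VPseven
open Set Filter Topology BoundedContinuousFunction
open scoped NNReal ENNReal

/-- Assumptions on the initial datum. -/
structure VPData (f₀ : E3 × E3 → ℝ) (A Lf R0 : ℝ) : Prop where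
  nonneg : ∀ z, 0 ≤ f₀ z
  cont : Continuous f₀
  bd : ∀ z, f₀ z ≤ A
  lip : ∀ z z', |f₀ z - f₀ z'| ≤ Lf * ‖z - z'‖
  supp : ∀ z, R0 < ‖z‖ → f₀ z = 0
  hR0 : 0 < R0
  hLf : 0 ≤ Lf

lemma VPData.hA {f₀ : E3 × E3 → ℝ} {A Lf R0 : ℝ} (h : VPData f₀ A Lf R0) : 0 ≤ A :=
  (h.nonneg 0).trans (h.bd 0)

/-- The initial measure. -/
def vpμ (f₀ : E3 × E3 → ℝ) : Measure (E3 × E3) :=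
  volume.withDensity fun z => ENNReal.ofReal (f₀ z)

lemma vpμ_lint_le {f₀ : E3 × E3 → ℝ} {A Lf R0 : ℝ} (h : VPData f₀ A Lf R0)
    (g : E3 × E3 → ℝ≥0∞) : ∫⁻ z, g z ∂(vpμ f₀) ≤ ENNReal.ofReal A * ∫⁻ z, g z := by
  have := h.cont.measurable
  refine (lintegral_withDensity_le_lintegral_mul _ (by fun_prop) g).trans ?_
  rw [← lintegral_const_mul' _ _ (by simp)]
  refine lintegral_mono fun z => ?_
  simp only [Pi.mul_apply]
  gcongr
  exact h.bd z

lemma vpμ_ae {f₀ : E3 × E3 → ℝ} {A Lf R0 : ℝ} (h : VPData f₀ A Lf R0) :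
    ∀ᵐ z ∂(vpμ f₀), ‖z‖ ≤ R0 := by
  have := h.cont.measurable
  rw [vpμ, ae_withDensity_iff (by fun_prop)]
  refine Eventually.of_forall fun z hz => ?_
  by_contra! hcon
  exact hz (by simp [h.supp z hcon])

lemma vpμ_finite {f₀ : E3 × E3 → ℝ} {A Lf R0 : ℝ} (h : VPData f₀ A Lf R0) :
    IsFiniteMeasure (vpμ f₀) := by
  have hm := vpμ_ae h
  constructor
  have h1 : vpμ f₀ univ = vpμ f₀ (Metric.closedBall 0 R0) := by
    refine measure_congr ?_
    filter_upwards [hm] with z hz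
    have : z ∈ Metric.closedBall (0 : E3 × E3) R0 := by simpa using hz
    exact propext ⟨fun _ => this, fun _ => trivial⟩
  rw [h1, ← setLIntegral_one, ← lintegral_indicator Metric.isClosed_closedBall.measurableSet]
  refine (vpμ_lint_le h _).trans_lt ?_
  rw [lintegral_indicator Metric.isClosed_closedBall.measurableSet, setLIntegral_one]
  exact ENNReal.mul_lt_top (by simp) measure_closedBall_lt_top

/-- The mean field. -/
def vpMF (c ε : ℝ) (μ : Measure (E3 × E3)) (X : E3 × E3 → E3) (x : E3) : E3 :=
  c • ∫ z, vpK ε (x - X z) ∂μ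

lemma vpMF_integrable {ε : ℝ} (hε : 0 < ε) {μ : Measure (E3 × E3)} [IsFiniteMeasure μ]
    {X : E3 × E3 → E3} (hX : Continuous X) (x : E3) : Integrable (fun z => vpK ε (x - X z)) μ := by
  have := vpK_continuous hε
  refine Integrable.mono' (integrable_const (ε ^ 2)⁻¹)
    (by fun_prop : Continuous fun z => vpK ε (x - X z)).aestronglyMeasurable
    (Eventually.of_forall fun z => (vpK_norm ε _).trans ?_)
  gcongr
  nlinarith [sq_nonneg ‖x - X z‖]

lemma vpMF_lip {c ε : ℝ} (hε : 0 < ε) {μ : Measure (E3 × E3)} [IsFiniteMeasure μ]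
    {X X' : E3 × E3 → E3} (hX : Continuous X) (hX' : Continuous X') {B : ℝ}
    (hB : ∀ z, ‖X z - X' z‖ ≤ B) (x x' : E3) :
    ‖vpMF c ε μ X x - vpMF c ε μ X' x'‖ ≤
      |c| * (μ.real univ * (4 * (ε ^ 3)⁻¹)) * (‖x - x'‖ + B) := by
  unfold vpMF
  rw [← smul_sub, norm_smul, Real.norm_eq_abs,
    ← integral_sub (vpMF_integrable hε hX x) (vpMF_integrable hε hX' x'), mul_assoc]
  gcongr
  have := norm_integral_le_of_norm_le_const (μ := μ) (f := fun z => vpK ε (x - X z) - vpK ε (x' - X' z))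
    (C := 4 * (ε ^ 3)⁻¹ * (‖x - x'‖ + B)) (Eventually.of_forall fun z => ?_)
  · refine this.trans (le_of_eq (by ring))
  · refine (vpK_lip hε _ _).trans ?_
    gcongr
    have e : x - X z - (x' - X' z) = (x - x') - (X z - X' z) := by abel
    rw [e]
    exact (norm_sub_le _ _).trans (by linarith [hB z])

lemma vpMF_norm {c ε : ℝ} (hε : 0 < ε) {μ : Measure (E3 × E3)} [IsFiniteMeasure μ]
    {X : E3 × E3 → E3} (x : E3) : ‖vpMF c ε μ X x‖ ≤ |c| * (μ.real univ * (ε ^ 2)⁻¹) := by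
  unfold vpMF
  rw [norm_smul, Real.norm_eq_abs]
  gcongr
  have := norm_integral_le_of_norm_le_const (μ := μ) (f := fun z => vpK ε (x - X z))
    (C := (ε ^ 2)⁻¹) (Eventually.of_forall fun z => ?_)
  · refine this.trans (le_of_eq (by ring))
  · refine (vpK_norm ε _).trans ?_
    gcongr
    nlinarith [sq_nonneg ‖x - X z‖]

lemma vpMF_continuous {c ε : ℝ} (hε : 0 < ε) {μ : Measure (E3 × E3)} [IsFiniteMeasure μ]
    {X : E3 × E3 → E3} (hX : Continuous X) : Continuous (vpMF c ε μ X) := by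
  refine (LipschitzWith.of_dist_le_mul
    (K := ⟨|c| * (μ.real univ * (4 * (ε ^ 3)⁻¹)), by positivity⟩) fun x x' => ?_).continuous
  have := vpMF_lip (c := c) (μ := μ) hε hX hX (B := 0) (by simp) x x'
  rw [add_zero] at this
  rw [dist_eq_norm, dist_eq_norm]
  exact this

/-- The vector field on the space of bounded continuous flows. -/
def vpBig (c : ℝ) {ε : ℝ} (hε : 0 < ε) (μ : Measure (E3 × E3)) [IsFiniteMeasure μ]
    (ζ : (E3 × E3) →ᵇ (E3 × E3)) : (E3 × E3) →ᵇ (E3 × E3) :=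
  BoundedContinuousFunction.ofNormedAddCommGroup
    (fun z => ((ζ z).2, vpMF c ε μ (fun z' => (ζ z').1) (ζ z).1))
    (by
      have := vpMF_continuous (c := c) (μ := μ) hε (X := fun z' => (ζ z').1) (by fun_prop)
      fun_prop)
    (max ‖ζ‖ (|c| * (μ.real univ * (ε ^ 2)⁻¹)))
    (fun z => by
      rw [Prod.norm_def]
      refine max_le_max ?_ (vpMF_norm hε _)
      exact (norm_snd_le (ζ z)).trans (ζ.norm_coe_le_norm z))

lemma vpBig_lip (c : ℝ) {ε : ℝ} (hε : 0 < ε) (μ : Measure (E3 × E3)) [IsFiniteMeasure μ] :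
    ∃ K : ℝ≥0, LipschitzWith K (vpBig c hε μ) := by
  set D : ℝ := |c| * (μ.real univ * (4 * (ε ^ 3)⁻¹)) with hD
  have hD0 : 0 ≤ D := by positivity
  refine ⟨⟨1 + 2 * D, by positivity⟩, LipschitzWith.of_dist_le_mul fun ζ ζ' => ?_⟩
  rw [dist_eq_norm, dist_eq_norm]
  have hn := norm_nonneg (ζ - ζ')
  change _ ≤ (1 + 2 * D) * ‖ζ - ζ'‖
  rw [BoundedContinuousFunction.norm_le (by positivity)]
  intro z
  have hz : ∀ z, ‖ζ z - ζ' z‖ ≤ ‖ζ - ζ'‖ := fun z => (ζ - ζ').norm_coe_le_norm z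
  have h1 : ∀ z, ‖(ζ z).1 - (ζ' z).1‖ ≤ ‖ζ - ζ'‖ := fun z => (norm_fst_le (ζ z - ζ' z)).trans (hz z)
  have h2 : ∀ z, ‖(ζ z).2 - (ζ' z).2‖ ≤ ‖ζ - ζ'‖ := fun z => (norm_snd_le (ζ z - ζ' z)).trans (hz z)
  have h3 := vpMF_lip (c := c) (μ := μ) hε (X := fun z' => (ζ z').1) (X' := fun z' => (ζ' z').1)
    (by fun_prop) (by fun_prop) h1 (ζ z).1 (ζ' z).1
  have h4 := h1 z
  change max ‖(ζ z).2 - (ζ' z).2‖ ‖vpMF c ε μ (fun z' => (ζ z').1) (ζ z).1 -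
    vpMF c ε μ (fun z' => (ζ' z').1) (ζ' z).1‖ ≤ _
  refine max_le ?_ (h3.trans ?_)
  · have := h2 z
    nlinarith
  · rw [← hD]; nlinarith

/-- Existence for the regularized problem. -/
lemma vp_reg_exists {f₀ : E3 × E3 → ℝ} {A Lf R0 : ℝ} (hf : VPData f₀ A Lf R0) (c : ℝ)
    {ε : ℝ} (hε : 0 < ε) : ∃ (G : ℝ → E3 → E3) (h : VPReg G), 
      (∃ K : ℝ, ∀ t x y, ‖G t x - G t y‖ ≤ K * ‖x - y‖) ∧
      (∃ K : ℝ, ∀ t x, ‖G t x‖ ≤ K) ∧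
      ∀ t x, G t x = c • ∫ z, vpK ε (x - (vpCurve h 0 z t).1) ∂(vpμ f₀) := by
  haveI := vpμ_finite hf
  obtain ⟨K, hK⟩ := vpBig_lip c hε (vpμ f₀)
  have hret : Continuous (vpRetr R0 : E3 × E3 → E3 × E3) :=
    (LipschitzWith.of_dist_le_mul (K := 2) fun x y => by
      rw [dist_eq_norm, dist_eq_norm]; exact vpRetr_lip hf.hR0 x y).continuous
  obtain ⟨γ, hγ0, hγ⟩ := vp_ode_global (fun _ => vpBig c hε (vpμ f₀)) (fun _ => continuous_const)
    (fun T => ⟨K, fun _ _ => hK⟩) 0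
    (BoundedContinuousFunction.ofNormedAddCommGroup (vpRetr R0) hret R0
      (fun z => vpRetr_norm_le hf.hR0 z))
  have hγc : Continuous γ := continuous_iff_continuousAt.2 fun t => (hγ t).continuousAt
  set G : ℝ → E3 → E3 := fun t => vpMF c ε (vpμ f₀) (fun z => (γ t z).1) with hG
  set D : ℝ := |c| * ((vpμ f₀).real univ * (4 * (ε ^ 3)⁻¹)) with hD
  have hD0 : 0 ≤ D := by positivity
  have hlip : ∀ t t' x y, ‖G t x - G t' y‖ ≤ D * (‖x - y‖ + ‖γ t - γ t'‖) := by
    intro t t' x y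
    refine vpMF_lip hε (by fun_prop) (by fun_prop) (fun z => ?_) x y
    exact (norm_fst_le (γ t z - γ t' z)).trans ((γ t - γ t').norm_coe_le_norm z)
  have hlip1 : ∀ t x y, ‖G t x - G t y‖ ≤ D * ‖x - y‖ := by
    intro t x y
    simpa using hlip t t x y
  have hreg : VPReg G := by
    refine ⟨?_, fun T => ⟨⟨D, hD0⟩, fun t _ => LipschitzWith.of_dist_le_mul fun x y => ?_⟩⟩
    · rw [continuous_iff_continuousAt]
      rintro ⟨t, x⟩
      rw [ContinuousAt, tendsto_iff_norm_sub_tendsto_zero]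
      have hc : Continuous fun p : ℝ × E3 => D * (‖p.2 - x‖ + ‖γ p.1 - γ t‖) := by fun_prop
      refine squeeze_zero (fun _ => norm_nonneg _) (fun p => hlip p.1 t p.2 x) ?_
      simpa using hc.tendsto (t, x)
    · rw [dist_eq_norm, dist_eq_norm]; exact hlip1 t x y
  have hcurve : ∀ z, ‖z‖ ≤ R0 → ∀ t, γ t z = vpCurve hreg 0 z t := by
    intro z hz t
    refine vp_curve_unique hreg (γ := fun t => γ t z) (fun t => ?_) (vpCurve_deriv hreg 0 z)
      (a := 0) ?_ t
    · exact (BoundedContinuousFunction.evalCLM ℝ z).hasFDerivAt.comp_hasDerivAt t (hγ t)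
    · rw [vpCurve_self]
      simp only [hγ0]
      exact vpRetr_eq hf.hR0 hz
  refine ⟨G, hreg, ⟨D, hlip1⟩, ⟨_, fun t x => vpMF_norm hε x⟩, fun t x => ?_⟩
  simp only [hG, vpMF]
  congr 1
  refine integral_congr_ae ?_
  filter_upwards [vpμ_ae hf] with z hz
  rw [hcurve z hz]

end VPseven

section VPeight
open Set Filter Topology
open scoped NNReal ENNReal

/-- A solution of the regularized problem. -/
structure VPSol (f₀ : E3 × E3 → ℝ) (c ε : ℝ) (G : ℝ → E3 → E3) : Prop where
  reg : VPReg G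
  lip : ∃ K : ℝ, ∀ t x y, ‖G t x - G t y‖ ≤ K * ‖x - y‖
  bd : ∃ K : ℝ, ∀ t x, ‖G t x‖ ≤ K
  eq : ∀ t x, G t x = c • ∫ z, vpK ε (x - (vpCurve reg 0 z t).1) ∂(vpμ f₀)

lemma vp_sol_exists {f₀ : E3 × E3 → ℝ} {A Lf R0 : ℝ} (hf : VPData f₀ A Lf R0) (c : ℝ)
    {ε : ℝ} (hε : 0 < ε) : ∃ G, VPSol f₀ c ε G := by
  obtain ⟨G, h, h1, h2, h3⟩ := vp_reg_exists hf c hε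
  exact ⟨G, h, h1, h2, h3⟩

/-- Transport of integrals along the flow. -/
lemma vp_transport {f₀ : E3 × E3 → ℝ} {A Lf R0 : ℝ} (hf : VPData f₀ A Lf R0)
    {G : ℝ → E3 → E3} (h : VPReg G) (s : ℝ) {g : E3 × E3 → ℝ≥0∞} (hg : Measurable g) :
    ∫⁻ z, g (vpCurve h 0 z s) ∂(vpμ f₀) ≤ ENNReal.ofReal A * ∫⁻ w, ∫⁻ y, g (y, w) := by
  refine (vpμ_lint_le hf _).trans (le_of_eq ?_)
  congr 1
  rw [(vpCurve_mp h 0 s).lintegral_comp hg]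
  change ∫⁻ z, g z ∂(volume.prod volume) = _
  rw [lintegral_prod_symm _ hg.aemeasurable]

/-- Speed bound from a force bound. -/
lemma vpCurve_snd_bound {G : ℝ → E3 → E3} (h : VPReg G) {K : ℝ} (hK : ∀ t x, ‖G t x‖ ≤ K)
    (z : E3 × E3) (s t : ℝ) : ‖(vpCurve h 0 z t).2 - (vpCurve h 0 z s).2‖ ≤ K * |t - s| := by
  have := convex_univ.norm_image_sub_le_of_norm_hasDerivWithin_le
    (f := fun s => (vpCurve h 0 z s).2) (f' := fun s => G s (vpCurve h 0 z s).1) (C := K)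
    (fun x _ => (vpCurve_deriv_snd h 0 z x).hasDerivWithinAt) (fun x _ => hK _ _)
    (mem_univ s) (mem_univ t)
  simpa [Real.norm_eq_abs] using this

lemma vpCurve_snd_le {G : ℝ → E3 → E3} (h : VPReg G) {K : ℝ} (hK : ∀ t x, ‖G t x‖ ≤ K)
    (z : E3 × E3) (t : ℝ) : ‖(vpCurve h 0 z t).2‖ ≤ ‖z‖ + K * |t| := by
  have h1 := vpCurve_snd_bound h hK z 0 t
  rw [vpCurve_self, sub_zero] at h1
  have h2 := norm_snd_le z
  have h3 := norm_le_norm_add_norm_sub' (vpCurve h 0 z t).2 z.2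
  linarith

/-- The kinetic energy. -/
def vpKin (f₀ : E3 × E3 → ℝ) {G : ℝ → E3 → E3} (h : VPReg G) (t : ℝ) : ℝ :=
  ∫ z, ‖(vpCurve h 0 z t).2‖ ^ 2 ∂(vpμ f₀)

lemma vpKin_nonneg (f₀ : E3 × E3 → ℝ) {G : ℝ → E3 → E3} (h : VPReg G) (t : ℝ) :
    0 ≤ vpKin f₀ h t := integral_nonneg fun _ => by positivity

lemma vpKin_integrable {f₀ : E3 × E3 → ℝ} {A Lf R0 : ℝ} (hf : VPData f₀ A Lf R0)
    {G : ℝ → E3 → E3} (h : VPReg G) (hK : ∃ K : ℝ, ∀ t x, ‖G t x‖ ≤ K) (t : ℝ) :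
    Integrable (fun z => ‖(vpCurve h 0 z t).2‖ ^ 2) (vpμ f₀) := by
  have := vpμ_finite hf
  obtain ⟨K, hK⟩ := hK
  have hc := vpCurve_continuous_start h 0 t
  refine Integrable.mono' (integrable_const ((R0 + K * |t|) ^ 2))
    (by fun_prop : Continuous fun z => ‖(vpCurve h 0 z t).2‖ ^ 2).aestronglyMeasurable ?_
  filter_upwards [vpμ_ae hf] with z hz
  rw [Real.norm_of_nonneg (by positivity)]
  have := vpCurve_snd_le h hK z t
  gcongr
  linarith

/-- Bound of the potential by the kinetic energy. -/
lemma vp_pot_bound {f₀ : E3 × E3 → ℝ} {A Lf R0 : ℝ} (hf : VPData f₀ A Lf R0)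
    {G : ℝ → E3 → E3} (h : VPReg G) (hK : ∃ K : ℝ, ∀ t x, ‖G t x‖ ≤ K) {ε : ℝ} (hε : 0 < ε)
    (t : ℝ) {R : ℝ} (hR : 0 < R) (x : E3) :
    ∫ z, (vpS ε (x - (vpCurve h 0 z t).1))⁻¹ ∂(vpμ f₀) ≤
      A * (vpκ * R ^ 2 * (vpκ * (π / 2))) + ((vpμ f₀).real univ + vpKin f₀ h t) / R := by
  have := vpμ_finite hf
  have hA := hf.hA
  have hκ := vpκ_nonneg
  have hkin := vpKin_nonneg f₀ h t
  have hintg := vpKin_integrable hf h hK t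
  have hc := vpCurve_continuous_start h 0 t
  set g : E3 × E3 → ℝ := fun p => if ‖x - p.1‖ ≤ R * (1 + ‖p.2‖ ^ 2)⁻¹ then
    (√(‖x - p.1‖ ^ 2 + ε ^ 2))⁻¹ else 0 with hg
  have hgm : Measurable g := by
    refine Measurable.ite (measurableSet_le (by fun_prop) (by fun_prop)) (by fun_prop) (by fun_prop)
  have hb : ∀ z, (vpS ε (x - (vpCurve h 0 z t).1))⁻¹ ≤ g (vpCurve h 0 z t) +
      (1 + ‖(vpCurve h 0 z t).2‖ ^ 2) / R := by
    intro z
    set p := vpCurve h 0 z t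
    by_cases hp : ‖x - p.1‖ ≤ R * (1 + ‖p.2‖ ^ 2)⁻¹
    · simp only [hg, if_pos hp]
      have : 0 ≤ (1 + ‖p.2‖ ^ 2) / R := by positivity
      unfold vpS
      linarith
    · simp only [hg, if_neg hp, zero_add]
      push Not at hp
      have h1 := (hp.le.trans (vpS_ge ε (x - p.1)))
      have h2 := inv_anti₀ (by positivity) h1
      rw [mul_inv, inv_inv] at h2
      rwa [div_eq_inv_mul]
  have key : ∫⁻ z, ‖(vpS ε (x - (vpCurve h 0 z t).1))⁻¹‖ₑ ∂(vpμ f₀) ≤ ENNReal.ofReal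
      (A * (vpκ * R ^ 2 * (vpκ * (π / 2))) + ((vpμ f₀).real univ + vpKin f₀ h t) / R) := by
    calc ∫⁻ z, ‖(vpS ε (x - (vpCurve h 0 z t).1))⁻¹‖ₑ ∂(vpμ f₀)
        ≤ ∫⁻ z, (ENNReal.ofReal (g (vpCurve h 0 z t)) +
          ENNReal.ofReal ((1 + ‖(vpCurve h 0 z t).2‖ ^ 2) / R)) ∂(vpμ f₀) := by
          refine lintegral_mono fun z => ?_
          rw [Real.enorm_of_nonneg (inv_nonneg.2 (vpS_nonneg _ _)), ← ENNReal.ofReal_add]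
          · exact ENNReal.ofReal_le_ofReal (hb z)
          · simp only [hg]; split_ifs <;> positivity
          · positivity
      _ = (∫⁻ z, ENNReal.ofReal (g (vpCurve h 0 z t)) ∂(vpμ f₀)) +
          ∫⁻ z, ENNReal.ofReal ((1 + ‖(vpCurve h 0 z t).2‖ ^ 2) / R) ∂(vpμ f₀) := by
          rw [lintegral_add_left]
          exact (hgm.comp hc.measurable).ennreal_ofReal
      _ ≤ ENNReal.ofReal A * ENNReal.ofReal (vpκ * R ^ 2 * (vpκ * (π / 2))) +
          ENNReal.ofReal (((vpμ f₀).real univ + vpKin f₀ h t) / R) := by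
          gcongr
          · refine (vp_transport hf h t hgm.ennreal_ofReal).trans ?_
            gcongr
            calc ∫⁻ w, ∫⁻ y, ENNReal.ofReal (g (y, w))
                ≤ ∫⁻ w : E3, ENNReal.ofReal (vpκ * R ^ 2) *
                  ENNReal.ofReal (((1 + ‖0 - w‖ ^ 2) ^ 2)⁻¹) := by
                  refine lintegral_mono fun w => ?_
                  have := vp_radial_ball (g := fun r => (√(r ^ 2 + ε ^ 2))⁻¹)
                    (a := R * (1 + ‖w‖ ^ 2)⁻¹) (c := R * (1 + ‖w‖ ^ 2)⁻¹) (by positivity)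
                    (fun r _ => by positivity) (by fun_prop) (fun r hr hra => ?_) x
                  · refine this.trans (le_of_eq ?_)
                    rw [← ENNReal.ofReal_mul (by positivity)]
                    congr 1
                    rw [zero_sub, norm_neg]
                    field_simp
                  · have h2 : r ≤ √(r ^ 2 + ε ^ 2) := le_sqrt_of_sq_le (by nlinarith [sq_nonneg ε])
                    refine le_trans ?_ hra
                    rw [← div_eq_mul_inv, div_le_iff₀ (by positivity)]
                    nlinarith
              _ ≤ _ := by
                  rw [lintegral_const_mul' _ _ (by simp),
                    ENNReal.ofReal_mul (p := vpκ * R ^ 2) (by positivity)]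
                  gcongr
                  exact vp_int4 0
          · rw [← ofReal_integral_eq_lintegral_ofReal]
            · refine ENNReal.ofReal_le_ofReal (le_of_eq ?_)
              rw [integral_div, integral_add (integrable_const _) hintg]
              simp [vpKin]
            · exact ((integrable_const _).add hintg).div_const _
            · exact Eventually.of_forall fun z => by positivity
      _ = _ := by
          rw [← ENNReal.ofReal_mul hA, ENNReal.ofReal_add (by positivity) (by positivity)]
  have := vp_norm_integral_le (by positivity) key
  exact (le_abs_self _).trans this

lemma vpS_inv_deriv {ε : ℝ} (hε : 0 < ε) {u : ℝ → E3} {u' : E3} {t : ℝ} (hu : HasDerivAt u u' t) :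
    HasDerivAt (fun s => (vpS ε (u s))⁻¹) (- inner ℝ (vpK ε (u t)) u') t := by
  have hp := vpS_pos hε (u t)
  have h1 := ((vpS_hasFDerivAt hε (u t)).comp_hasDerivAt t hu).inv hp.ne'
  refine HasDerivAt.congr_deriv h1 ?_
  simp only [vpK, inner_smul_left, Function.comp]
  rw [_root_.smul_apply, _root_.smul_apply, innerSL_apply_apply]
  simp
  field_simp

/-- Twice the potential energy (without constant). -/
def vpPot (f₀ : E3 × E3 → ℝ) (ε : ℝ) {G : ℝ → E3 → E3} (h : VPReg G) (t : ℝ) : ℝ :=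
  ∫ q, (vpS ε ((vpCurve h 0 q.1 t).1 - (vpCurve h 0 q.2 t).1))⁻¹ ∂((vpμ f₀).prod (vpμ f₀))

lemma vpKin_hasDeriv {f₀ : E3 × E3 → ℝ} {A Lf R0 : ℝ} (hf : VPData f₀ A Lf R0)
    {G : ℝ → E3 → E3} (h : VPReg G) (hK : ∃ K : ℝ, ∀ t x, ‖G t x‖ ≤ K) (t : ℝ) :
    HasDerivAt (vpKin f₀ h)
      (∫ z, 2 * inner ℝ (vpCurve h 0 z t).2 (G t (vpCurve h 0 z t).1) ∂(vpμ f₀)) t := by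
  have := vpμ_finite hf
  have hintg := vpKin_integrable hf h hK t
  obtain ⟨K, hK⟩ := hK
  have hK0 : 0 ≤ K := (norm_nonneg _).trans (hK 0 0)
  have hR0 := hf.hR0
  have hc := vpCurve_continuous_start h 0
  have hGc : ∀ s, Continuous (G s) := fun s => h.cont.comp (by fun_prop : Continuous fun x => (s, x))
  refine (hasDerivAt_integral_of_dominated_loc_of_deriv_le (μ := vpμ f₀) (s := Metric.ball t 1)
    (F := fun s z => ‖(vpCurve h 0 z s).2‖ ^ 2)
    (F' := fun s z => 2 * inner ℝ (vpCurve h 0 z s).2 (G s (vpCurve h 0 z s).1))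
    (bound := fun _ => 2 * ((R0 + K * (|t| + 1)) * K))
    (Metric.ball_mem_nhds t one_pos) (Eventually.of_forall fun s => ?_) hintg ?_ ?_
    (integrable_const _) ?_).2
  · have := hc s
    exact (by fun_prop : Continuous fun z => ‖(vpCurve h 0 z s).2‖ ^ 2).aestronglyMeasurable
  · have := hc t
    have := hGc t
    exact (by fun_prop : Continuous fun z => 2 * inner ℝ (vpCurve h 0 z t).2
      (G t (vpCurve h 0 z t).1)).aestronglyMeasurable
  · filter_upwards [vpμ_ae hf] with z hz s hs
    have h1 := vpCurve_snd_le h hK z s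
    have h2 : |s| ≤ |t| + 1 := by
      have := Metric.mem_ball.1 hs
      rw [Real.dist_eq] at this
      linarith [abs_sub_abs_le_abs_sub s t]
    have h3 : K * |s| ≤ K * (|t| + 1) := by gcongr
    rw [norm_mul, Real.norm_ofNat]
    gcongr
    refine (norm_inner_le_norm _ _).trans ?_
    gcongr
    · linarith
    · exact hK _ _
  · refine Eventually.of_forall fun z s _ => ?_
    exact (vpCurve_deriv_snd h 0 z s).norm_sq

lemma vpPot_integrable {f₀ : E3 × E3 → ℝ} {A Lf R0 : ℝ} (hf : VPData f₀ A Lf R0)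
    {G : ℝ → E3 → E3} (h : VPReg G) {ε : ℝ} (hε : 0 < ε) (t : ℝ) :
    Integrable (fun q : (E3 × E3) × (E3 × E3) =>
      (vpS ε ((vpCurve h 0 q.1 t).1 - (vpCurve h 0 q.2 t).1))⁻¹) ((vpμ f₀).prod (vpμ f₀)) := by
  have := vpμ_finite hf
  have hc := vpCurve_continuous_start h 0 t
  have hS := vpS_continuous ε
  refine Integrable.mono' (integrable_const ε⁻¹) (Continuous.aestronglyMeasurable ?_)
    (Eventually.of_forall fun q => ?_)
  · refine Continuous.inv₀ (by fun_prop) fun q => (vpS_pos hε _).ne'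
  · rw [Real.norm_of_nonneg (inv_nonneg.2 (vpS_nonneg _ _))]
    exact inv_anti₀ hε (vpS_ge' _)

lemma vpK_norm_eps {ε : ℝ} (hε : 0 < ε) (x : E3) : ‖vpK ε x‖ ≤ (ε ^ 2)⁻¹ := by
  refine (vpK_norm ε x).trans ?_
  gcongr
  nlinarith [sq_nonneg ‖x‖]

lemma vpPot_hasDeriv {f₀ : E3 × E3 → ℝ} {A Lf R0 : ℝ} (hf : VPData f₀ A Lf R0)
    {G : ℝ → E3 → E3} (h : VPReg G) (hK : ∃ K : ℝ, ∀ t x, ‖G t x‖ ≤ K) {ε : ℝ} (hε : 0 < ε)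
    (t : ℝ) : HasDerivAt (vpPot f₀ ε h)
      (∫ q, - inner ℝ (vpK ε ((vpCurve h 0 q.1 t).1 - (vpCurve h 0 q.2 t).1))
        ((vpCurve h 0 q.1 t).2 - (vpCurve h 0 q.2 t).2) ∂((vpμ f₀).prod (vpμ f₀))) t := by
  have := vpμ_finite hf
  obtain ⟨K, hK⟩ := hK
  have hK0 : 0 ≤ K := (norm_nonneg _).trans (hK 0 0)
  have hR0 := hf.hR0
  have hc := vpCurve_continuous_start h 0
  have hKc := vpK_continuous hε
  have hae : ∀ᵐ q ∂((vpμ f₀).prod (vpμ f₀)), ‖q.1‖ ≤ R0 ∧ ‖q.2‖ ≤ R0 := by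
    have h1 := Measure.quasiMeasurePreserving_fst (μ := vpμ f₀) (ν := vpμ f₀) |>.ae (vpμ_ae hf)
    have h2 := Measure.quasiMeasurePreserving_snd (μ := vpμ f₀) (ν := vpμ f₀) |>.ae (vpμ_ae hf)
    exact h1.and h2
  refine (hasDerivAt_integral_of_dominated_loc_of_deriv_le
    (μ := (vpμ f₀).prod (vpμ f₀)) (s := Metric.ball t 1)
    (F := fun s (q : (E3 × E3) × (E3 × E3)) =>
      (vpS ε ((vpCurve h 0 q.1 s).1 - (vpCurve h 0 q.2 s).1))⁻¹)
    (F' := fun s q => - inner ℝ (vpK ε ((vpCurve h 0 q.1 s).1 - (vpCurve h 0 q.2 s).1))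
        ((vpCurve h 0 q.1 s).2 - (vpCurve h 0 q.2 s).2))
    (bound := fun _ => (ε ^ 2)⁻¹ * (2 * (R0 + K * (|t| + 1))))
    (Metric.ball_mem_nhds t one_pos) (Eventually.of_forall fun s => ?_)
    (vpPot_integrable hf h hε t) ?_ ?_
    (integrable_const _) ?_).2
  · exact (vpPot_integrable hf h hε s).aestronglyMeasurable
  · have := hc t
    exact Continuous.aestronglyMeasurable (by fun_prop)
  · filter_upwards [hae] with q hq s hs
    have h1 := vpCurve_snd_le h hK q.1 s
    have h1' := vpCurve_snd_le h hK q.2 s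
    have h2 : |s| ≤ |t| + 1 := by
      have := Metric.mem_ball.1 hs
      rw [Real.dist_eq] at this
      linarith [abs_sub_abs_le_abs_sub s t]
    have h3 : K * |s| ≤ K * (|t| + 1) := by gcongr
    rw [norm_neg]
    refine (norm_inner_le_norm _ _).trans ?_
    gcongr
    · exact vpK_norm_eps hε _
    · refine (norm_sub_le _ _).trans ?_
      linarith [hq.1, hq.2]
  · refine Eventually.of_forall fun q s _ => ?_
    exact vpS_inv_deriv hε ((vpCurve_deriv_fst h 0 q.1 s).sub (vpCurve_deriv_fst h 0 q.2 s))

lemma vp_inner_integrable {f₀ : E3 × E3 → ℝ} {A Lf R0 : ℝ} (hf : VPData f₀ A Lf R0)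
    {G : ℝ → E3 → E3} (h : VPReg G) (hK : ∃ K : ℝ, ∀ t x, ‖G t x‖ ≤ K) {ε : ℝ} (hε : 0 < ε)
    (t : ℝ) : Integrable (fun q : (E3 × E3) × (E3 × E3) =>
      (inner ℝ (vpK ε ((vpCurve h 0 q.1 t).1 - (vpCurve h 0 q.2 t).1)) (vpCurve h 0 q.1 t).2 : ℝ))
      ((vpμ f₀).prod (vpμ f₀)) := by
  have := vpμ_finite hf
  obtain ⟨K, hK⟩ := hK
  have hc := vpCurve_continuous_start h 0 t
  have hKc := vpK_continuous hε
  have h1 := Measure.quasiMeasurePreserving_fst (μ := vpμ f₀) (ν := vpμ f₀) |>.ae (vpμ_ae hf)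
  refine Integrable.mono' (integrable_const ((ε ^ 2)⁻¹ * (R0 + K * |t|)))
    (Continuous.aestronglyMeasurable (by fun_prop)) ?_
  filter_upwards [h1] with q hq
  refine (norm_inner_le_norm _ _).trans ?_
  gcongr
  · exact vpK_norm_eps hε _
  · have := vpCurve_snd_le h hK q.1 t
    linarith

/-- Conservation of energy. -/
lemma vp_energy {f₀ : E3 × E3 → ℝ} {A Lf R0 : ℝ} (hf : VPData f₀ A Lf R0)
    {c ε : ℝ} (hε : 0 < ε) {G : ℝ → E3 → E3} (hs : VPSol f₀ c ε G) (t : ℝ) :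
    vpKin f₀ hs.reg t + c * vpPot f₀ ε hs.reg t = vpKin f₀ hs.reg 0 + c * vpPot f₀ ε hs.reg 0 := by
  have := vpμ_finite hf
  have hd : ∀ t, HasDerivAt (fun t => vpKin f₀ hs.reg t + c * vpPot f₀ ε hs.reg t) 0 t := by
    intro t
    set Φ := fun z => vpCurve hs.reg 0 z t with hΦ
    have hi := vp_inner_integrable hf hs.reg hs.bd hε t
    have h1 := (vpKin_hasDeriv hf hs.reg hs.bd t).add
      ((vpPot_hasDeriv hf hs.reg hs.bd hε t).const_mul c)
    refine HasDerivAt.congr_deriv h1 ?_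
    set I := ∫ q, (inner ℝ (vpK ε ((Φ q.1).1 - (Φ q.2).1)) (Φ q.1).2 : ℝ)
      ∂((vpμ f₀).prod (vpμ f₀)) with hI
    have e1 : ∫ z, 2 * inner ℝ (Φ z).2 (G t (Φ z).1) ∂(vpμ f₀) = 2 * (c * I) := by
      rw [integral_const_mul, hI, integral_prod _ hi, ← integral_const_mul c]
      congr 1
      refine integral_congr_ae (Eventually.of_forall fun z => ?_)
      simp only
      rw [hs.eq, inner_smul_right]
      congr 1
      have hX : Continuous fun z => (Φ z).1 := (vpCurve_continuous_start hs.reg 0 t).fst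
      refine (integral_inner (𝕜 := ℝ) (vpMF_integrable hε hX (Φ z).1) (Φ z).2).symm.trans ?_
      exact integral_congr_ae (Eventually.of_forall fun z' => real_inner_comm _ _)
    have e2 : ∫ q, - inner ℝ (vpK ε ((Φ q.1).1 - (Φ q.2).1)) ((Φ q.1).2 - (Φ q.2).2)
        ∂((vpμ f₀).prod (vpμ f₀)) = - 2 * I := by
      have hi2 := hi.swap
      have e3 : ∫ q, (inner ℝ (vpK ε ((Φ q.2).1 - (Φ q.1).1)) (Φ q.2).2 : ℝ)
          ∂((vpμ f₀).prod (vpμ f₀)) = I := by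
        rw [hI, ← integral_prod_swap]
        rfl
      have e4 : ∀ q : (E3 × E3) × (E3 × E3), - inner ℝ (vpK ε ((Φ q.1).1 - (Φ q.2).1)) ((Φ q.1).2 - (Φ q.2).2) =
          - (inner ℝ (vpK ε ((Φ q.1).1 - (Φ q.2).1)) (Φ q.1).2 : ℝ) -
          (inner ℝ (vpK ε ((Φ q.2).1 - (Φ q.1).1)) (Φ q.2).2 : ℝ) := by
        intro q
        rw [← neg_sub (Φ q.1).1, vpK_neg, inner_neg_left, inner_sub_right]
        ring
      simp_rw [e4]
      have e5 := integral_sub hi.neg hi2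
      refine e5.trans ?_
      have e6 : ∫ q, (-fun q : (E3 × E3) × (E3 × E3) =>
          (inner ℝ (vpK ε ((Φ q.1).1 - (Φ q.2).1)) (Φ q.1).2 : ℝ)) q
          ∂((vpμ f₀).prod (vpμ f₀)) = - I := integral_neg _
      refine (congrArg₂ (· - ·) e6 e3).trans ?_
      ring
    rw [e1, e2]
    ring
  exact is_const_of_deriv_eq_zero (fun t => (hd t).differentiableAt) (fun t => (hd t).deriv) t 0

lemma vpPot_bound {f₀ : E3 × E3 → ℝ} {A Lf R0 : ℝ} (hf : VPData f₀ A Lf R0)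
    {G : ℝ → E3 → E3} (h : VPReg G) (hK : ∃ K : ℝ, ∀ t x, ‖G t x‖ ≤ K) {ε : ℝ} (hε : 0 < ε)
    (t : ℝ) {R : ℝ} (hR : 0 < R) :
    |vpPot f₀ ε h t| ≤ (vpμ f₀).real univ *
      (A * (vpκ * R ^ 2 * (vpκ * (π / 2))) + ((vpμ f₀).real univ + vpKin f₀ h t) / R) := by
  have := vpμ_finite hf
  unfold vpPot
  rw [abs_of_nonneg (integral_nonneg fun q => inv_nonneg.2 (vpS_nonneg _ _)),
    integral_prod _ (vpPot_integrable hf h hε t)]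
  have := integral_mono (μ := vpμ f₀) (vpPot_integrable hf h hε t).integral_prod_left
    (integrable_const _)
    (fun z => vp_pot_bound hf h hK hε t hR (vpCurve h 0 z t).1)
  refine this.trans (le_of_eq ?_)
  simp

/-- Uniform bound of the kinetic energy. -/
lemma vpKin_bound {f₀ : E3 × E3 → ℝ} {A Lf R0 : ℝ} (hf : VPData f₀ A Lf R0) (c : ℝ) :
    ∃ CK : ℝ, 0 ≤ CK ∧ ∀ (ε : ℝ) (_ : 0 < ε) (G : ℝ → E3 → E3) (hs : VPSol f₀ c ε G) (t : ℝ),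
      vpKin f₀ hs.reg t ≤ CK := by
  have := vpμ_finite hf
  set M := (vpμ f₀).real univ with hM
  have hM0 : 0 ≤ M := by positivity
  have hA := hf.hA
  have hκ := vpκ_nonneg
  set R := 2 * |c| * M + 1 with hR
  have hR0 : 0 < R := by positivity
  set D := |c| * (M * (A * (vpκ * R ^ 2 * (vpκ * (π / 2))) + M / R)) with hD
  have hD0 : 0 ≤ D := by positivity
  refine ⟨3 * (R0 ^ 2 * M) + 4 * D, by positivity, fun ε hε G hs t => ?_⟩
  have hb : ∀ t, |c * vpPot f₀ ε hs.reg t| ≤ D + vpKin f₀ hs.reg t / 2 := by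
    intro t
    have hk := vpKin_nonneg f₀ hs.reg t
    rw [abs_mul]
    have h1 := vpPot_bound hf hs.reg hs.bd hε t hR0
    have h2 : |c| * |vpPot f₀ ε hs.reg t| ≤ _ := mul_le_mul_of_nonneg_left h1 (abs_nonneg c)
    refine h2.trans ?_
    have h3 : |c| * M * vpKin f₀ hs.reg t / R ≤ vpKin f₀ hs.reg t / 2 := by
      rw [div_le_div_iff₀ hR0 two_pos]
      have : |c| * M * 2 ≤ R := by rw [hR]; linarith
      nlinarith
    calc _ = D + |c| * M * vpKin f₀ hs.reg t / R := by rw [hD]; ring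
      _ ≤ _ := by linarith
  have h0 : vpKin f₀ hs.reg 0 ≤ R0 ^ 2 * M := by
    have := integral_mono_ae (μ := vpμ f₀) (vpKin_integrable hf hs.reg hs.bd 0)
      (integrable_const (R0 ^ 2)) (by
        filter_upwards [vpμ_ae hf] with z hz
        simp only [vpCurve_self]
        have := (norm_snd_le z).trans hz
        gcongr)
    refine this.trans (le_of_eq ?_)
    simp [hM, mul_comm]
  have h1 := abs_le.1 (hb t)
  have h2 := abs_le.1 (hb 0)
  have h3 := vp_energy hf hε hs t
  linarith [h1.1, h2.2]

end VPeight

section VPnine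
open Set Filter Topology
open scoped NNReal ENNReal

/-- Softened inverse square. -/
def vpq (ε : ℝ) (x : E3) : ℝ := (‖x‖ ^ 2 + ε ^ 2)⁻¹

lemma vpq_nonneg (ε : ℝ) (x : E3) : 0 ≤ vpq ε x := by unfold vpq; positivity

lemma vpq_le {ε l : ℝ} (hl : 0 < l) {x : E3} (hx : l ≤ ‖x‖) : vpq ε x ≤ (l ^ 2)⁻¹ := by
  unfold vpq
  gcongr
  nlinarith [sq_nonneg ε]

/-- Localized kernel. -/
def vpgq (ε : ℝ) (a : E3 → ℝ) (x : E3) (p : E3 × E3) : ℝ :=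
  if ‖x - p.1‖ ≤ a p.2 then vpq ε (x - p.1) else 0

lemma vpgq_nonneg (ε : ℝ) (a : E3 → ℝ) (x : E3) (p : E3 × E3) : 0 ≤ vpgq ε a x p := by
  unfold vpgq; split_ifs
  · exact vpq_nonneg _ _
  · exact le_rfl

lemma vpgq_measurable (ε : ℝ) {a : E3 → ℝ} (ha : Measurable a) :
    Measurable fun q : E3 × (E3 × E3) => vpgq ε a q.1 q.2 := by
  unfold vpgq vpq
  exact Measurable.ite (measurableSet_le (by fun_prop) (by fun_prop)) (by fun_prop) (by fun_prop)

lemma vp_loc {f₀ : E3 × E3 → ℝ} {A Lf R0 : ℝ} (hf : VPData f₀ A Lf R0)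
    {G : ℝ → E3 → E3} (h : VPReg G) (s : ℝ) {ε : ℝ} {a : E3 → ℝ} (ha : Measurable a)
    (ha0 : ∀ w, 0 ≤ a w) {B : ℝ} (hB : ∫⁻ w, ENNReal.ofReal (a w) ≤ ENNReal.ofReal B) (x : E3) :
    ∫⁻ z, ENNReal.ofReal (vpgq ε a x (vpCurve h 0 z s)) ∂(vpμ f₀) ≤
      ENNReal.ofReal (A * (vpκ * B)) := by
  have hm : Measurable fun p => vpgq ε a x p := by
    unfold vpgq vpq
    exact Measurable.ite (measurableSet_le (by fun_prop) (by fun_prop)) (by fun_prop) (by fun_prop)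
  refine (vp_transport hf h s hm.ennreal_ofReal).trans ?_
  rw [ENNReal.ofReal_mul hf.hA]
  gcongr
  calc ∫⁻ w, ∫⁻ y, ENNReal.ofReal (vpgq ε a x (y, w))
      ≤ ∫⁻ w, ENNReal.ofReal vpκ * ENNReal.ofReal (a w) := by
        refine lintegral_mono fun w => ?_
        have := vp_radial_ball (g := fun r => (r ^ 2 + ε ^ 2)⁻¹) (c := 1) (ha0 w)
          (fun r _ => by positivity) (by fun_prop) (fun r hr _ => ?_) x
        · rw [one_mul, ENNReal.ofReal_mul vpκ_nonneg] at this
          exact this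
        · rw [← div_eq_mul_inv, div_le_one (by positivity)]
          nlinarith [sq_nonneg ε]
    _ ≤ _ := by
        rw [lintegral_const_mul' _ _ (by simp), ENNReal.ofReal_mul vpκ_nonneg]
        gcongr

lemma vpG_enorm {f₀ : E3 × E3 → ℝ} {c ε : ℝ} {G : ℝ → E3 → E3} (hs : VPSol f₀ c ε G) (s : ℝ)
    (x : E3) : ‖G s x‖ₑ ≤ ENNReal.ofReal |c| *
      ∫⁻ z, ENNReal.ofReal (vpq ε (x - (vpCurve hs.reg 0 z s).1)) ∂(vpμ f₀) := by
  rw [hs.eq, enorm_smul]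
  have : ‖c‖ₑ = ENNReal.ofReal |c| := by rw [← ofReal_norm, Real.norm_eq_abs]
  rw [this]
  gcongr
  refine (enorm_integral_le_lintegral_enorm _).trans (lintegral_mono fun z => ?_)
  rw [← ofReal_norm]
  exact ENNReal.ofReal_le_ofReal (vpK_norm _ _)

/-- The force bound in terms of the maximal speed. -/
lemma vp_force_bound {f₀ : E3 × E3 → ℝ} {A Lf R0 : ℝ} (hf : VPData f₀ A Lf R0)
    {c ε : ℝ} {G : ℝ → E3 → E3} (hs : VPSol f₀ c ε G) {CK : ℝ}
    {s : ℝ} (hCK : vpKin f₀ hs.reg s ≤ CK)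
    {b : ℝ} (hb : 1 ≤ b) (hP : ∀ z, ‖z‖ ≤ R0 → ‖(vpCurve hs.reg 0 z s).2‖ ≤ b ^ 18) (x : E3) :
    ‖G s x‖ ≤ |c| * (A * (vpκ * vpκ) + 2 * ((vpμ f₀).real univ + CK)) * b ^ 24 := by
  have := vpμ_finite hf
  have hA := hf.hA
  have hκ := vpκ_nonneg
  have hb0 : 0 < b := by linarith
  have hkin := vpKin_nonneg f₀ hs.reg s
  have hintg := vpKin_integrable hf hs.reg hs.bd s
  have hCK0 := hkin.trans hCK
  set R := (b ^ 12)⁻¹ with hR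
  have hR0 : 0 < R := by positivity
  set a : E3 → ℝ := fun w => R * (if ‖0 - w‖ ≤ b ^ 18 then (1 + ‖0 - w‖)⁻¹ else 0) with ha
  have ham : Measurable a := by
    refine Measurable.const_mul (Measurable.ite (measurableSet_le (by fun_prop) (by fun_prop))
      (by fun_prop) (by fun_prop)) _
  have ha0 : ∀ w, 0 ≤ a w := fun w => by
    simp only [ha]; split_ifs <;> positivity
  have haB : ∫⁻ w, ENNReal.ofReal (a w) ≤ ENNReal.ofReal (R * (vpκ * (b ^ 18) ^ 2)) := by
    rw [ENNReal.ofReal_mul hR0.le]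
    have := vp_radial_ball (g := fun r => (1 + r)⁻¹) (a := b ^ 18) (c := b ^ 18) (by positivity)
      (fun r hr => by positivity) (by fun_prop) (fun r hr hra => by
        rw [← div_eq_mul_inv, div_le_iff₀ (by positivity)]; nlinarith) 0
    refine le_trans (le_of_eq ?_) (mul_le_mul' le_rfl (this.trans (le_of_eq ?_)))
    · rw [← lintegral_const_mul' _ _ (by simp)]
      refine lintegral_congr fun w => ?_
      rw [← ENNReal.ofReal_mul hR0.le]
    · congr 1; ring
  have key : ∫⁻ z, ENNReal.ofReal (vpq ε (x - (vpCurve hs.reg 0 z s).1)) ∂(vpμ f₀) ≤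
      ENNReal.ofReal ((A * (vpκ * vpκ) + 2 * ((vpμ f₀).real univ + CK)) * b ^ 24) := by
    calc ∫⁻ z, ENNReal.ofReal (vpq ε (x - (vpCurve hs.reg 0 z s).1)) ∂(vpμ f₀)
        ≤ ∫⁻ z, (ENNReal.ofReal (vpgq ε a x (vpCurve hs.reg 0 z s)) +
            ENNReal.ofReal (2 * (1 + ‖(vpCurve hs.reg 0 z s).2‖ ^ 2) * b ^ 24)) ∂(vpμ f₀) := by
          refine lintegral_mono_ae ?_
          filter_upwards [vpμ_ae hf] with z hz
          have hz' := hP z hz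
          rw [← ENNReal.ofReal_add (vpgq_nonneg _ _ _ _) (by positivity)]
          refine ENNReal.ofReal_le_ofReal ?_
          set p := vpCurve hs.reg 0 z s
          by_cases hp : ‖x - p.1‖ ≤ a p.2
          · rw [vpgq, if_pos hp]
            have : 0 ≤ 2 * (1 + ‖p.2‖ ^ 2) * b ^ 24 := by positivity
            linarith
          · rw [vpgq, if_neg hp, zero_add]
            push Not at hp
            have e : a p.2 = R * (1 + ‖p.2‖)⁻¹ := by
              simp only [ha]; rw [zero_sub, norm_neg, if_pos hz']
            rw [e] at hp
            refine (vpq_le (by positivity) hp.le).trans ?_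
            have e2 : ((R * (1 + ‖p.2‖)⁻¹) ^ 2)⁻¹ = (1 + ‖p.2‖) ^ 2 * b ^ 24 := by
              rw [hR]; field_simp
            rw [e2]
            gcongr
            nlinarith [sq_nonneg (1 - ‖p.2‖)]
      _ = (∫⁻ z, ENNReal.ofReal (vpgq ε a x (vpCurve hs.reg 0 z s)) ∂(vpμ f₀)) +
            ∫⁻ z, ENNReal.ofReal (2 * (1 + ‖(vpCurve hs.reg 0 z s).2‖ ^ 2) * b ^ 24) ∂(vpμ f₀) := by
          rw [lintegral_add_left]
          have := (vpCurve_continuous_start hs.reg 0 s).measurable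
          exact ((vpgq_measurable ε ham).comp
            (by fun_prop : Measurable fun z => (x, vpCurve hs.reg 0 z s))).ennreal_ofReal
      _ ≤ ENNReal.ofReal (A * (vpκ * (R * (vpκ * (b ^ 18) ^ 2)))) +
            ENNReal.ofReal (2 * ((vpμ f₀).real univ + CK) * b ^ 24) := by
          gcongr
          · exact vp_loc hf hs.reg s ham ha0 haB x
          · rw [← ofReal_integral_eq_lintegral_ofReal]
            · refine ENNReal.ofReal_le_ofReal ?_
              rw [integral_mul_const, integral_const_mul,
                integral_add (integrable_const _) hintg]
              simp only [integral_const, smul_eq_mul, mul_one]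
              gcongr
              exact hCK
            · exact (((integrable_const _).add hintg).const_mul _).mul_const _
            · exact Eventually.of_forall fun z => by positivity
      _ = _ := by
          rw [← ENNReal.ofReal_add (by positivity) (by positivity)]
          congr 1
          rw [hR]; field_simp
  have h1 := (vpG_enorm hs s x).trans (mul_le_mul' le_rfl key)
  rw [← ENNReal.ofReal_mul (abs_nonneg _), ← ofReal_norm,
    ENNReal.ofReal_le_ofReal_iff (by positivity)] at h1
  refine h1.trans (le_of_eq (by ring))

/-- Time integral along almost straight trajectories. -/
lemma vp_time_int {h h' : ℝ → ℝ} (hd : ∀ s, HasDerivAt h (h' s) s) (hc : Continuous h')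
    {t₁ t₂ m l : ℝ} (ht : t₁ ≤ t₂) (hm : 0 < m) (hl : 0 < l) (hle : ∀ s ∈ Icc t₁ t₂, m ≤ h' s) :
    ∫⁻ s in Icc t₁ t₂, ENNReal.ofReal (2 / (l ^ 2 + h s ^ 2)) ≤
      ENNReal.ofReal (2 * π / (m * l)) := by
  have hhc : Continuous h := continuous_iff_continuousAt.2 fun s => (hd s).continuousAt
  set k : ℝ → ℝ := fun s => (2 / (m * l)) * (1 / (1 + (h s / l) ^ 2) * (h' s / l)) with hk
  have hkc : Continuous k := by
    have : ∀ s, 1 + (h s / l) ^ 2 ≠ 0 := fun s => by positivity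
    fun_prop (disch := assumption)
  have hkd : ∀ s, HasDerivAt (fun s => (2 / (m * l)) * arctan (h s / l)) (k s) s := fun s =>
    (((hd s).div_const l).arctan).const_mul _
  have hk0 : ∀ s ∈ Icc t₁ t₂, 2 / (l ^ 2 + h s ^ 2) ≤ k s := by
    intro s hs
    have := hle s hs
    have e : k s = 2 / (l ^ 2 + h s ^ 2) * (h' s / m) := by
      simp only [hk]; field_simp
    rw [e]
    have h1 : 1 ≤ h' s / m := (one_le_div hm).2 this
    have h2 : 0 < 2 / (l ^ 2 + h s ^ 2) := by positivity
    nlinarith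
  calc ∫⁻ s in Icc t₁ t₂, ENNReal.ofReal (2 / (l ^ 2 + h s ^ 2))
      ≤ ∫⁻ s in Icc t₁ t₂, ENNReal.ofReal (k s) :=
        setLIntegral_mono (by fun_prop) fun s hs => ENNReal.ofReal_le_ofReal (hk0 s hs)
    _ = ENNReal.ofReal (∫ s in Icc t₁ t₂, k s) := by
        rw [← ofReal_integral_eq_lintegral_ofReal]
        · exact hkc.continuousOn.integrableOn_compact isCompact_Icc
        · filter_upwards [ae_restrict_mem measurableSet_Icc] with s hs
          refine le_trans ?_ (hk0 s hs)
          simp only [Pi.zero_apply]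
          positivity
    _ ≤ _ := by
        refine ENNReal.ofReal_le_ofReal ?_
        rw [integral_Icc_eq_integral_Ioc, ← intervalIntegral.integral_of_le ht,
          intervalIntegral.integral_eq_sub_of_hasDerivAt (fun s _ => hkd s)
            (hkc.intervalIntegrable _ _)]
        have h1 := arctan_lt_pi_div_two (h t₂ / l)
        have h2 := neg_pi_div_two_lt_arctan (h t₁ / l)
        have h3 : 0 < 2 / (m * l) := by positivity
        rw [← mul_sub, mul_div_right_comm]
        gcongr
        linarith

end VPnine

section VPten
open Set Filter Topology
open scoped NNReal ENNReal

lemma vp_speed_change {G : ℝ → E3 → E3} (h : VPReg G) {t₁ t₂ F p : ℝ}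
    (hF : ∀ s ∈ Icc t₁ t₂, ∀ x, ‖G s x‖ ≤ F) (hΔ : F * (t₂ - t₁) ≤ p / 4) (z : E3 × E3) {s : ℝ}
    (hs : s ∈ Icc t₁ t₂) : ‖(vpCurve h 0 z s).2 - (vpCurve h 0 z t₁).2‖ ≤ p / 4 := by
  have hF0 : 0 ≤ F := (norm_nonneg _).trans (hF s hs 0)
  have := (convex_Icc t₁ t₂).norm_image_sub_le_of_norm_hasDerivWithin_le
    (f := fun s => (vpCurve h 0 z s).2) (f' := fun s => G s (vpCurve h 0 z s).1) (C := F)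
    (fun x _ => (vpCurve_deriv_snd h 0 z x).hasDerivWithinAt) (fun x hx => hF x hx _)
    (left_mem_Icc.2 (hs.1.trans hs.2)) hs
  refine this.trans (le_trans ?_ hΔ)
  rw [Real.norm_of_nonneg (by linarith [hs.1])]
  gcongr
  exact hs.2

/-- The function controlling the good set. -/
def vpg2 {G : ℝ → E3 → E3} (h : VPReg G) (p r t₁ : ℝ) (zh : E3 × E3) (s : ℝ) (z : E3 × E3) : ℝ :=
  if p < ‖(vpCurve h 0 z t₁).2‖ ∧ p < ‖(vpCurve h 0 z t₁).2 - (vpCurve h 0 zh t₁).2‖ then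
    2 / ((r / ‖(vpCurve h 0 z t₁).2‖ ^ 2) ^ 2 +
      (inner ℝ ((vpCurve h 0 z s).1 - (vpCurve h 0 zh s).1)
        ((vpCurve h 0 z t₁).2 - (vpCurve h 0 zh t₁).2) /
        ‖(vpCurve h 0 z t₁).2 - (vpCurve h 0 zh t₁).2‖) ^ 2)
  else 0

lemma vpg2_measurable {G : ℝ → E3 → E3} (h : VPReg G) (p r t₁ : ℝ) (zh : E3 × E3) :
    Measurable fun q : ℝ × (E3 × E3) => vpg2 h p r t₁ zh q.1 q.2 := by
  have h1 : Measurable fun q : ℝ × (E3 × E3) => vpCurve h 0 q.2 q.1 :=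
    (vpCurve_continuous_fwd h).measurable
  have h2 : Measurable fun q : ℝ × (E3 × E3) => vpCurve h 0 q.2 t₁ :=
    (vpCurve_continuous_start h 0 t₁).measurable.comp measurable_snd
  have h3 : Measurable fun q : ℝ × (E3 × E3) => vpCurve h 0 zh q.1 :=
    (vpCurve_continuous h 0 zh).measurable.comp measurable_fst
  unfold vpg2
  refine Measurable.ite ?_ ?_ measurable_const
  · exact (measurableSet_lt measurable_const h2.snd.norm).inter
      (measurableSet_lt measurable_const (h2.snd.sub_const _).norm)
  have h4 : Measurable fun q : ℝ × (E3 × E3) => (inner ℝ ((vpCurve h 0 q.2 q.1).1 -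
      (vpCurve h 0 zh q.1).1) ((vpCurve h 0 q.2 t₁).2 - (vpCurve h 0 zh t₁).2) : ℝ) :=
    Measurable.inner (by fun_prop) (by fun_prop)
  fun_prop

lemma vpg2_nonneg {G : ℝ → E3 → E3} (h : VPReg G) (p r t₁ : ℝ) (zh : E3 × E3) (s : ℝ)
    (z : E3 × E3) : 0 ≤ vpg2 h p r t₁ zh s z := by
  unfold vpg2; split_ifs <;> positivity

lemma vpg2_time {G : ℝ → E3 → E3} (h : VPReg G) {t₁ t₂ F p r : ℝ} (hp : 0 < p) (hr : 0 < r)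
    (ht : t₁ ≤ t₂)
    (hF : ∀ s ∈ Icc t₁ t₂, ∀ x, ‖G s x‖ ≤ F) (hΔ : F * (t₂ - t₁) ≤ p / 4) (zh z : E3 × E3) :
    ∫⁻ s in Icc t₁ t₂, ENNReal.ofReal (vpg2 h p r t₁ zh s z) ≤
      ENNReal.ofReal (4 * π / (p * r) * ‖(vpCurve h 0 z t₁).2‖ ^ 2) := by
  by_cases hU : p < ‖(vpCurve h 0 z t₁).2‖ ∧ p < ‖(vpCurve h 0 z t₁).2 - (vpCurve h 0 zh t₁).2‖
  swap
  · simp [vpg2, hU]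
  simp only [vpg2, if_pos hU]
  set v := (vpCurve h 0 z t₁).2 with hv
  set u := v - (vpCurve h 0 zh t₁).2 with hu
  have hv0 : 0 < ‖v‖ := hp.trans hU.1
  have hu0 : 0 < ‖u‖ := hp.trans hU.2
  refine (vp_time_int (h := fun s => inner ℝ ((vpCurve h 0 z s).1 - (vpCurve h 0 zh s).1) u / ‖u‖)
    (h' := fun s => inner ℝ ((vpCurve h 0 z s).2 - (vpCurve h 0 zh s).2) u / ‖u‖)
    (m := p / 2) (l := r / ‖v‖ ^ 2) (fun s => ?_) ?_ ht (by positivity) (by positivity)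
    (fun s hs => ?_)).trans ?_
  · have := ((vpCurve_deriv_fst h 0 z s).sub (vpCurve_deriv_fst h 0 zh s)).inner ℝ
      (hasDerivAt_const s u)
    have h2 := this.div_const ‖u‖
    simpa using h2
  · have := vpCurve_continuous h 0 z
    have := vpCurve_continuous h 0 zh
    fun_prop
  · have h1 := vp_speed_change h hF hΔ z hs
    have h2 := vp_speed_change h hF hΔ zh hs
    set a := (vpCurve h 0 z s).2 - (vpCurve h 0 z t₁).2 with ha
    set b := (vpCurve h 0 zh s).2 - (vpCurve h 0 zh t₁).2 with hb
    have e : (vpCurve h 0 z s).2 - (vpCurve h 0 zh s).2 = u + (a - b) := by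
      rw [hu, hv, ha, hb]; abel
    simp only [e]
    rw [inner_add_left, real_inner_self_eq_norm_sq, le_div_iff₀ hu0]
    have h3 : |inner ℝ (a - b) u| ≤ (p / 2) * ‖u‖ := by
      refine (abs_real_inner_le_norm _ _).trans ?_
      gcongr
      refine (norm_sub_le _ _).trans ?_
      linarith
    have h4 := (abs_le.1 h3).1
    nlinarith [hU.2]
  · refine ENNReal.ofReal_le_ofReal (le_of_eq ?_)
    field_simp
    ring

lemma vp_interval {f₀ : E3 × E3 → ℝ} {A Lf R0 : ℝ} (hf : VPData f₀ A Lf R0)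
    {c ε : ℝ} {G : ℝ → E3 → E3} (hs : VPSol f₀ c ε G) {CK : ℝ}
    (hCK : ∀ t, vpKin f₀ hs.reg t ≤ CK) {t₁ t₂ F p r P : ℝ} (hp : 0 < p) (hr : 0 < r) (hP0 : 0 ≤ P)
    (ht : t₁ ≤ t₂) (hP : ∀ s ∈ Icc t₁ t₂, ∀ z, ‖z‖ ≤ R0 → ‖(vpCurve hs.reg 0 z s).2‖ ≤ P)
    (hF : ∀ s ∈ Icc t₁ t₂, ∀ x, ‖G s x‖ ≤ F) (hΔ : F * (t₂ - t₁) ≤ p / 4) (zh : E3 × E3) :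
    ∫⁻ s in Icc t₁ t₂, ∫⁻ z, ENNReal.ofReal (vpq ε ((vpCurve hs.reg 0 zh s).1 -
      (vpCurve hs.reg 0 z s).1)) ∂(vpμ f₀) ≤
    ENNReal.ofReal ((t₂ - t₁) * (((vpμ f₀).real univ + 16 * (A * (vpκ * vpκ))) * p ^ 2 +
      2 * (A * (vpκ * vpκ)) * (r * P)) + 4 * π * CK / (p * r)) := by
  have := vpμ_finite hf
  have hA := hf.hA
  have hκ := vpκ_nonneg
  set h := hs.reg with hh
  have hCK0 : 0 ≤ CK := (vpKin_nonneg f₀ h 0).trans (hCK 0)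
  -- the three localizations
  set a₁ : E3 → E3 → ℝ := fun v w => p⁻¹ * (if ‖v - w‖ ≤ 2 * p then 1 else 0) with ha₁
  set a₂ : E3 → ℝ := fun w => 2 * r * (if ‖0 - w‖ ≤ P then (‖0 - w‖ ^ 2)⁻¹ else 0) with ha₂
  have h1m : ∀ v, Measurable (a₁ v) := fun v => Measurable.const_mul
    (Measurable.ite (measurableSet_le (by fun_prop) (by fun_prop)) (by fun_prop) (by fun_prop)) _
  have h2m : Measurable a₂ := Measurable.const_mul
    (Measurable.ite (measurableSet_le (by fun_prop) (by fun_prop)) (by fun_prop) (by fun_prop)) _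
  have h10 : ∀ v w, 0 ≤ a₁ v w := fun v w => by
    simp only [ha₁]; split_ifs <;> positivity
  have h20 : ∀ w, 0 ≤ a₂ w := fun w => by
    simp only [ha₂]; split_ifs <;> positivity
  have h1B : ∀ v, ∫⁻ w, ENNReal.ofReal (a₁ v w) ≤ ENNReal.ofReal (p⁻¹ * (vpκ * (2 * p) ^ 3)) := by
    intro v
    rw [ENNReal.ofReal_mul (by positivity)]
    refine le_trans (le_of_eq ?_) (mul_le_mul' le_rfl (vp_ball0 (by positivity) v))
    rw [← lintegral_const_mul' _ _ (by simp)]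
    refine lintegral_congr fun w => ?_
    rw [← ENNReal.ofReal_mul (by positivity)]
  have h2B : ∫⁻ w, ENNReal.ofReal (a₂ w) ≤ ENNReal.ofReal (2 * r * (vpκ * P)) := by
    rw [ENNReal.ofReal_mul (by positivity)]
    refine le_trans (le_of_eq ?_) (mul_le_mul' le_rfl (vp_ball2 hP0 0))
    rw [← lintegral_const_mul' _ _ ENNReal.ofReal_ne_top]
    refine lintegral_congr fun w => ?_
    rw [← ENNReal.ofReal_mul (by positivity)]
  -- pointwise bound
  have hpt : ∀ s ∈ Icc t₁ t₂, ∀ z, ‖z‖ ≤ R0 →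
      vpq ε ((vpCurve h 0 zh s).1 - (vpCurve h 0 z s).1) ≤
      p ^ 2 + vpgq ε (a₁ 0) (vpCurve h 0 zh s).1 (vpCurve h 0 z s) +
      vpgq ε (a₁ (vpCurve h 0 zh s).2) (vpCurve h 0 zh s).1 (vpCurve h 0 z s) +
      vpgq ε a₂ (vpCurve h 0 zh s).1 (vpCurve h 0 z s) + vpg2 h p r t₁ zh s z := by
    intro s hs' z hz
    have d1 := vp_speed_change h hF hΔ z hs'
    have d2 := vp_speed_change h hF hΔ zh hs'
    have d3 := hP s hs' z hz
    have n1 := vpgq_nonneg ε (a₁ 0) (vpCurve h 0 zh s).1 (vpCurve h 0 z s)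
    have n2 := vpgq_nonneg ε (a₁ (vpCurve h 0 zh s).2) (vpCurve h 0 zh s).1 (vpCurve h 0 z s)
    have n3 := vpgq_nonneg ε a₂ (vpCurve h 0 zh s).1 (vpCurve h 0 z s)
    have n4 := vpg2_nonneg h p r t₁ zh s z
    have n5 : 0 < p ^ 2 := by positivity
    have hfar : ∀ x : E3, p⁻¹ < ‖x‖ → vpq ε x ≤ p ^ 2 := by
      intro x hx
      have := vpq_le (ε := ε) (by positivity) hx.le
      rwa [inv_pow, inv_inv] at this
    by_cases c1 : ‖(vpCurve h 0 z t₁).2‖ ≤ p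
    · have c2 : ‖0 - (vpCurve h 0 z s).2‖ ≤ 2 * p := by
        rw [zero_sub, norm_neg]
        have := norm_le_norm_add_norm_sub' (vpCurve h 0 z s).2 (vpCurve h 0 z t₁).2
        linarith
      by_cases c3 : ‖(vpCurve h 0 zh s).1 - (vpCurve h 0 z s).1‖ ≤ p⁻¹
      · have : vpgq ε (a₁ 0) (vpCurve h 0 zh s).1 (vpCurve h 0 z s) =
            vpq ε ((vpCurve h 0 zh s).1 - (vpCurve h 0 z s).1) := by
          rw [vpgq, if_pos]
          simp only [ha₁]
          rw [if_pos c2, mul_one]; exact c3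
        linarith
      · have := hfar _ (not_le.1 c3)
        linarith
    by_cases c1' : ‖(vpCurve h 0 z t₁).2 - (vpCurve h 0 zh t₁).2‖ ≤ p
    · have c2 : ‖(vpCurve h 0 zh s).2 - (vpCurve h 0 z s).2‖ ≤ 2 * p := by
        have e : (vpCurve h 0 zh s).2 - (vpCurve h 0 z s).2 =
          ((vpCurve h 0 zh s).2 - (vpCurve h 0 zh t₁).2) - ((vpCurve h 0 z s).2 -
            (vpCurve h 0 z t₁).2) - ((vpCurve h 0 z t₁).2 - (vpCurve h 0 zh t₁).2) := by abel
        rw [e]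
        refine (norm_sub_le _ _).trans ?_
        have := norm_sub_le ((vpCurve h 0 zh s).2 - (vpCurve h 0 zh t₁).2) ((vpCurve h 0 z s).2 -
            (vpCurve h 0 z t₁).2)
        linarith
      by_cases c3 : ‖(vpCurve h 0 zh s).1 - (vpCurve h 0 z s).1‖ ≤ p⁻¹
      · have : vpgq ε (a₁ (vpCurve h 0 zh s).2) (vpCurve h 0 zh s).1 (vpCurve h 0 z s) =
            vpq ε ((vpCurve h 0 zh s).1 - (vpCurve h 0 z s).1) := by
          rw [vpgq, if_pos]
          simp only [ha₁]
          rw [if_pos c2, mul_one]; exact c3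
        linarith
      · have := hfar _ (not_le.1 c3)
        linarith
    push Not at c1 c1'
    set v := (vpCurve h 0 z t₁).2 with hv
    set u := v - (vpCurve h 0 zh t₁).2 with hu
    have hv0 : 0 < ‖v‖ := hp.trans c1
    have hu0 : 0 < ‖u‖ := hp.trans c1'
    set l := r / ‖v‖ ^ 2 with hl
    have hl0 : 0 < l := by positivity
    by_cases c3 : ‖(vpCurve h 0 zh s).1 - (vpCurve h 0 z s).1‖ ≤ l
    · have : vpgq ε a₂ (vpCurve h 0 zh s).1 (vpCurve h 0 z s) =
          vpq ε ((vpCurve h 0 zh s).1 - (vpCurve h 0 z s).1) := by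
        rw [vpgq, if_pos]
        simp only [ha₂]
        rw [zero_sub, norm_neg, if_pos d3]
        refine c3.trans ?_
        have e1 : ‖(vpCurve h 0 z s).2‖ ≤ 5 / 4 * ‖v‖ := by
          have := norm_le_norm_add_norm_sub' (vpCurve h 0 z s).2 v
          linarith
        have e2 : 0 < ‖(vpCurve h 0 z s).2‖ := by
          have := norm_le_norm_add_norm_sub' v (vpCurve h 0 z s).2
          rw [norm_sub_rev] at this
          linarith
        rw [hl, ← div_eq_mul_inv, div_le_div_iff₀ (by positivity) (by positivity)]
        have : ‖(vpCurve h 0 z s).2‖ ^ 2 ≤ (5 / 4 * ‖v‖) ^ 2 := by gcongr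
        nlinarith [sq_nonneg ‖v‖]
      linarith
    · push Not at c3
      have : vpq ε ((vpCurve h 0 zh s).1 - (vpCurve h 0 z s).1) ≤ vpg2 h p r t₁ zh s z := by
        rw [vpg2, if_pos ⟨c1, c1'⟩, ← hv, ← hu, ← hl]
        set y := (vpCurve h 0 zh s).1 - (vpCurve h 0 z s).1 with hy
        have e1 : (vpCurve h 0 z s).1 - (vpCurve h 0 zh s).1 = -y := by rw [hy]; abel
        rw [e1]
        have e2 : (inner ℝ (-y) u / ‖u‖) ^ 2 ≤ ‖y‖ ^ 2 := by
          refine sq_le_sq' ?_ ?_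
          · rw [le_div_iff₀ hu0]
            have := (abs_le.1 (abs_real_inner_le_norm (-y) u)).1
            rw [norm_neg] at this
            linarith
          · rw [div_le_iff₀ hu0]
            have := (abs_le.1 (abs_real_inner_le_norm (-y) u)).2
            rwa [norm_neg] at this
        have e3 : l ^ 2 ≤ ‖y‖ ^ 2 := by gcongr
        have e4 : 0 < ‖y‖ := hl0.trans c3
        unfold vpq
        rw [inv_eq_one_div, div_le_div_iff₀ (by positivity) (by positivity)]
        nlinarith [sq_nonneg ε]
      linarith
  -- integrate in z
  set K₁ : ℝ := ((vpμ f₀).real univ + 16 * (A * (vpκ * vpκ))) * p ^ 2 +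
      2 * (A * (vpκ * vpκ)) * (r * P) with hK₁
  have hK₁0 : 0 ≤ K₁ := by positivity
  have hz : ∀ s ∈ Icc t₁ t₂, ∫⁻ z, ENNReal.ofReal (vpq ε ((vpCurve h 0 zh s).1 -
      (vpCurve h 0 z s).1)) ∂(vpμ f₀) ≤ ENNReal.ofReal K₁ +
      ∫⁻ z, ENNReal.ofReal (vpg2 h p r t₁ zh s z) ∂(vpμ f₀) := by
    intro s hs'
    have hcm := (vpCurve_continuous_start h 0 s).measurable
    have hgm : ∀ a : E3 → ℝ, Measurable a → Measurable fun z => ENNReal.ofReal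
        (vpgq ε a (vpCurve h 0 zh s).1 (vpCurve h 0 z s)) := by
      intro a ha
      exact ((vpgq_measurable ε ha).comp
        (by fun_prop : Measurable fun z => ((vpCurve h 0 zh s).1, vpCurve h 0 z s))).ennreal_ofReal
    have hm1 := hgm _ (h1m 0)
    have hm2 := hgm _ (h1m (vpCurve h 0 zh s).2)
    have hm3 := hgm _ h2m
    calc ∫⁻ z, ENNReal.ofReal (vpq ε ((vpCurve h 0 zh s).1 - (vpCurve h 0 z s).1)) ∂(vpμ f₀)
        ≤ ∫⁻ z, (ENNReal.ofReal (p ^ 2) +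
            ENNReal.ofReal (vpgq ε (a₁ 0) (vpCurve h 0 zh s).1 (vpCurve h 0 z s)) +
            ENNReal.ofReal (vpgq ε (a₁ (vpCurve h 0 zh s).2) (vpCurve h 0 zh s).1
              (vpCurve h 0 z s)) +
            ENNReal.ofReal (vpgq ε a₂ (vpCurve h 0 zh s).1 (vpCurve h 0 z s)) +
            ENNReal.ofReal (vpg2 h p r t₁ zh s z)) ∂(vpμ f₀) := by
          refine lintegral_mono_ae ?_
          filter_upwards [vpμ_ae hf] with z hz
          have n1 := vpgq_nonneg ε (a₁ 0) (vpCurve h 0 zh s).1 (vpCurve h 0 z s)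
          have n2 := vpgq_nonneg ε (a₁ (vpCurve h 0 zh s).2) (vpCurve h 0 zh s).1 (vpCurve h 0 z s)
          have n3 := vpgq_nonneg ε a₂ (vpCurve h 0 zh s).1 (vpCurve h 0 z s)
          have n4 := vpg2_nonneg h p r t₁ zh s z
          rw [← ENNReal.ofReal_add (by positivity) (by positivity),
            ← ENNReal.ofReal_add (by positivity) (by positivity),
            ← ENNReal.ofReal_add (by positivity) (by positivity),
            ← ENNReal.ofReal_add (by positivity) (by positivity)]
          exact ENNReal.ofReal_le_ofReal (hpt s hs' z hz)
      _ = ENNReal.ofReal (p ^ 2) * vpμ f₀ univ +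
            (∫⁻ z, ENNReal.ofReal (vpgq ε (a₁ 0) (vpCurve h 0 zh s).1 (vpCurve h 0 z s)) ∂(vpμ f₀)) +
            (∫⁻ z, ENNReal.ofReal (vpgq ε (a₁ (vpCurve h 0 zh s).2) (vpCurve h 0 zh s).1
              (vpCurve h 0 z s)) ∂(vpμ f₀)) +
            (∫⁻ z, ENNReal.ofReal (vpgq ε a₂ (vpCurve h 0 zh s).1 (vpCurve h 0 z s)) ∂(vpμ f₀)) +
            ∫⁻ z, ENNReal.ofReal (vpg2 h p r t₁ zh s z) ∂(vpμ f₀) := by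
          rw [lintegral_add_left (by fun_prop), lintegral_add_left (by fun_prop),
            lintegral_add_left (by fun_prop), lintegral_add_left (by fun_prop), lintegral_const]
      _ ≤ ENNReal.ofReal (p ^ 2) * ENNReal.ofReal ((vpμ f₀).real univ) +
            ENNReal.ofReal (A * (vpκ * (p⁻¹ * (vpκ * (2 * p) ^ 3)))) +
            ENNReal.ofReal (A * (vpκ * (p⁻¹ * (vpκ * (2 * p) ^ 3)))) +
            ENNReal.ofReal (A * (vpκ * (2 * r * (vpκ * P)))) +
            ∫⁻ z, ENNReal.ofReal (vpg2 h p r t₁ zh s z) ∂(vpμ f₀) := by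
          gcongr
          · simp
          · exact vp_loc hf h s (h1m _) (h10 _) (h1B _) _
          · exact vp_loc hf h s (h1m _) (h10 _) (h1B _) _
          · exact vp_loc hf h s h2m h20 h2B _
      _ = _ := by
          rw [← ENNReal.ofReal_mul (by positivity), ← ENNReal.ofReal_add (by positivity) (by positivity),
            ← ENNReal.ofReal_add (by positivity) (by positivity),
            ← ENNReal.ofReal_add (by positivity) (by positivity)]
          congr 2
          rw [hK₁]; field_simp; ring
  calc _ ≤ ∫⁻ s in Icc t₁ t₂, (ENNReal.ofReal K₁ +
        ∫⁻ z, ENNReal.ofReal (vpg2 h p r t₁ zh s z) ∂(vpμ f₀)) :=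
        setLIntegral_mono' measurableSet_Icc hz
    _ = ENNReal.ofReal K₁ * ENNReal.ofReal (t₂ - t₁) +
        ∫⁻ z, (∫⁻ s in Icc t₁ t₂, ENNReal.ofReal (vpg2 h p r t₁ zh s z)) ∂(vpμ f₀) := by
        rw [lintegral_add_left (by fun_prop), setLIntegral_const, Real.volume_Icc]
        congr 1
        rw [lintegral_lintegral_swap]
        exact (vpg2_measurable h p r t₁ zh).ennreal_ofReal.aemeasurable
    _ ≤ ENNReal.ofReal K₁ * ENNReal.ofReal (t₂ - t₁) +
        ∫⁻ z, ENNReal.ofReal (4 * π / (p * r) * ‖(vpCurve h 0 z t₁).2‖ ^ 2) ∂(vpμ f₀) := by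
        gcongr with z
        exact vpg2_time h hp hr ht hF hΔ zh z
    _ ≤ ENNReal.ofReal K₁ * ENNReal.ofReal (t₂ - t₁) +
        ENNReal.ofReal (4 * π / (p * r) * CK) := by
        gcongr
        rw [← ofReal_integral_eq_lintegral_ofReal]
        · refine ENNReal.ofReal_le_ofReal ?_
          rw [integral_const_mul]
          gcongr
          exact hCK t₁
        · exact (vpKin_integrable hf h hs.bd t₁).const_mul _
        · exact Eventually.of_forall fun z => by positivity
    _ = _ := by
        have : 0 ≤ t₂ - t₁ := by linarith
        rw [← ENNReal.ofReal_mul hK₁0, ← ENNReal.ofReal_add (by positivity) (by positivity)]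
        congr 1
        ring

end VPten

section VPeleven
open Set Filter Topology
open scoped NNReal ENNReal

lemma vp_increment {f₀ : E3 × E3 → ℝ} {A Lf R0 : ℝ} (hf : VPData f₀ A Lf R0)
    {c ε : ℝ} {G : ℝ → E3 → E3} (hs : VPSol f₀ c ε G) {CK : ℝ}
    (hCK : ∀ t, vpKin f₀ hs.reg t ≤ CK) {t₁ t₂ F p r P : ℝ} (hp : 0 < p) (hr : 0 < r) (hP0 : 0 ≤ P)
    (ht : t₁ ≤ t₂) (hP : ∀ s ∈ Icc t₁ t₂, ∀ z, ‖z‖ ≤ R0 → ‖(vpCurve hs.reg 0 z s).2‖ ≤ P)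
    (hF : ∀ s ∈ Icc t₁ t₂, ∀ x, ‖G s x‖ ≤ F) (hΔ : F * (t₂ - t₁) ≤ p / 4) (zh : E3 × E3) :
    ‖(vpCurve hs.reg 0 zh t₂).2 - (vpCurve hs.reg 0 zh t₁).2‖ ≤
    |c| * ((t₂ - t₁) * (((vpμ f₀).real univ + 16 * (A * (vpκ * vpκ))) * p ^ 2 +
      2 * (A * (vpκ * vpκ)) * (r * P)) + 4 * π * CK / (p * r)) := by
  have := vpμ_finite hf
  have hA := hf.hA
  have hκ := vpκ_nonneg
  have hCK0 : 0 ≤ CK := (vpKin_nonneg f₀ hs.reg 0).trans (hCK 0)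
  have ht' : 0 ≤ t₂ - t₁ := by linarith
  have hcont : Continuous fun s => G s (vpCurve hs.reg 0 zh s).1 :=
    hs.reg.cont.comp (continuous_id.prodMk (vpCurve_continuous hs.reg 0 zh).fst)
  have e := intervalIntegral.integral_eq_sub_of_hasDerivAt (a := t₁) (b := t₂)
    (fun s _ => vpCurve_deriv_snd hs.reg 0 zh s) (hcont.intervalIntegrable _ _)
  rw [← e, intervalIntegral.integral_of_le ht, ← integral_Icc_eq_integral_Ioc]
  refine vp_norm_integral_le (by positivity) ?_
  rw [ENNReal.ofReal_mul (abs_nonneg _)]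
  refine le_trans ?_ (mul_le_mul' le_rfl (vp_interval hf hs hCK hp hr hP0 ht hP hF hΔ zh))
  rw [← lintegral_const_mul' _ _ ENNReal.ofReal_ne_top]
  exact lintegral_mono fun s => vpG_enorm hs s _

lemma vp_total {f₀ : E3 × E3 → ℝ} {A Lf R0 : ℝ} (hf : VPData f₀ A Lf R0)
    {c ε : ℝ} {G : ℝ → E3 → E3} (hs : VPSol f₀ c ε G) {CK : ℝ}
    (hCK : ∀ t, vpKin f₀ hs.reg t ≤ CK) {t F p r P : ℝ} (hp : 0 < p) (hr : 0 < r) (hP0 : 0 ≤ P)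
    (ht : 0 ≤ t) (hP : ∀ s ∈ Icc 0 t, ∀ z, ‖z‖ ≤ R0 → ‖(vpCurve hs.reg 0 z s).2‖ ≤ P)
    (hF : ∀ s ∈ Icc 0 t, ∀ x, ‖G s x‖ ≤ F) (zh : E3 × E3) :
    ‖(vpCurve hs.reg 0 zh t).2 - zh.2‖ ≤
    |c| * (t * (((vpμ f₀).real univ + 16 * (A * (vpκ * vpκ))) * p ^ 2 +
      2 * (A * (vpκ * vpκ)) * (r * P)) + (4 * F * t / p + 2) * (4 * π * CK / (p * r))) := by
  have := vpμ_finite hf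
  have hA := hf.hA
  have hκ := vpκ_nonneg
  have hCK0 : 0 ≤ CK := (vpKin_nonneg f₀ hs.reg 0).trans (hCK 0)
  have hF0 : 0 ≤ F := (norm_nonneg _).trans (hF 0 ⟨le_rfl, ht⟩ 0)
  set K₁ := ((vpμ f₀).real univ + 16 * (A * (vpκ * vpκ))) * p ^ 2 +
      2 * (A * (vpκ * vpκ)) * (r * P) with hK₁
  set K₂ := 4 * π * CK / (p * r) with hK₂
  have hK₁0 : 0 ≤ K₁ := by positivity
  have hK₂0 : 0 ≤ K₂ := by positivity
  set N : ℕ := ⌈4 * F * t / p⌉₊ + 1 with hN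
  have hN0 : (0:ℝ) < N := by rw [hN]; positivity
  have hN1 : 4 * F * t / p ≤ N := by
    rw [hN]; push_cast
    linarith [Nat.le_ceil (4 * F * t / p)]
  have hN2 : (N:ℝ) ≤ 4 * F * t / p + 2 := by
    rw [hN]; push_cast
    linarith [Nat.ceil_lt_add_one (a := 4 * F * t / p) (by positivity)]
  have hind : ∀ k : ℕ, k ≤ N → ‖(vpCurve hs.reg 0 zh (k * (t / N))).2 - zh.2‖ ≤
      k * (|c| * (t / N * K₁ + K₂)) := by
    intro k
    induction k with
    | zero => intro _; simp [vpCurve_self]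
    | succ k ih =>
      intro hk
      have ih' := ih (by omega)
      have hkN : ((k + 1 : ℕ) : ℝ) * (t / N) ≤ t := by
        have : ((k + 1 : ℕ) : ℝ) ≤ N := by exact_mod_cast hk
        rw [← mul_div_assoc, div_le_iff₀ hN0]
        nlinarith
      have hsub : Icc ((k:ℝ) * (t / N)) (((k + 1 : ℕ) : ℝ) * (t / N)) ⊆ Icc 0 t := by
        intro s hs
        exact ⟨le_trans (by positivity) hs.1, hs.2.trans hkN⟩
      have hlen : ((k + 1 : ℕ) : ℝ) * (t / N) - k * (t / N) = t / N := by push_cast; ring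
      have h1 := vp_increment hf hs hCK (t₁ := k * (t / N)) (t₂ := ((k + 1 : ℕ) : ℝ) * (t / N))
        (F := F) hp hr hP0 (by push_cast; nlinarith [div_nonneg ht hN0.le])
        (fun s hs => hP s (hsub hs)) (fun s hs => hF s (hsub hs)) (by
          rw [hlen]
          rw [div_le_iff₀ hp] at hN1
          rw [← mul_div_assoc, div_le_iff₀ hN0]
          linarith) zh
      rw [hlen] at h1
      have h2 := norm_sub_le_norm_sub_add_norm_sub (vpCurve hs.reg 0 zh (((k + 1 : ℕ) : ℝ) * (t / N))).2
        (vpCurve hs.reg 0 zh (k * (t / N))).2 zh.2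
      push_cast at h1 h2 ⊢
      rw [← hK₁, ← hK₂] at h1
      linarith
  have h1 := hind N le_rfl
  have e : (N:ℝ) * (t / N) = t := by field_simp
  rw [e] at h1
  refine h1.trans ?_
  calc _ = |c| * (t * K₁ + N * K₂) := by
        rw [mul_left_comm, mul_add, ← mul_assoc, e]
    _ ≤ _ := by gcongr

lemma vp_max_exists {G : ℝ → E3 → E3} (h : VPReg G) {T R0 : ℝ} (hT : 0 ≤ T) (hR0 : 0 ≤ R0) :
    ∃ s₁ ∈ Icc 0 T, ∃ z₁ : E3 × E3, ‖z₁‖ ≤ R0 ∧ ∀ s ∈ Icc 0 T, ∀ z, ‖z‖ ≤ R0 →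
      ‖(vpCurve h 0 z s).2‖ ≤ ‖(vpCurve h 0 z₁ s₁).2‖ := by
  have hcK : IsCompact (Icc (0:ℝ) T ×ˢ Metric.closedBall (0 : E3 × E3) R0) :=
    isCompact_Icc.prod (isCompact_closedBall _ _)
  obtain ⟨q, hmem, hmax⟩ := hcK.exists_isMaxOn
    (f := fun q : ℝ × (E3 × E3) => ‖(vpCurve h 0 q.2 q.1).2‖)
    ⟨(0, 0), ⟨left_mem_Icc.2 hT, by simp [hR0]⟩⟩
    (vpCurve_continuous_fwd h).snd.norm.continuousOn
  refine ⟨q.1, hmem.1, q.2, by simpa using hmem.2, fun s hs z hz => ?_⟩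
  have hm : ((s, z) : ℝ × (E3 × E3)) ∈ Icc (0:ℝ) T ×ˢ Metric.closedBall (0 : E3 × E3) R0 :=
    mem_prod.2 ⟨hs, mem_closedBall_zero_iff.2 hz⟩
  exact isMaxOn_iff.1 hmax (s, z) hm

set_option maxHeartbeats 800000 in
/-- The a priori bound on the momenta, uniform in the regularization. -/
lemma vp_apriori {f₀ : E3 × E3 → ℝ} {A Lf R0 : ℝ} (hf : VPData f₀ A Lf R0) (c : ℝ) :
    ∃ CP : ℝ, 0 ≤ CP ∧ ∀ (ε : ℝ) (_ : 0 < ε) (G : ℝ → E3 → E3) (hs : VPSol f₀ c ε G) (t : ℝ),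
      0 ≤ t → ∀ z, ‖z‖ ≤ R0 → ‖(vpCurve hs.reg 0 z t).2‖ ≤ CP * (1 + t) ^ (9 / 2 : ℝ) := by
  have := vpμ_finite hf
  obtain ⟨CK, hCK0, hCK⟩ := vpKin_bound hf c
  have hA := hf.hA
  have hκ := vpκ_nonneg
  have hR0 := hf.hR0
  set M := (vpμ f₀).real univ with hM
  have hM0 : 0 ≤ M := by positivity
  set CE := |c| * (A * (vpκ * vpκ) + 2 * (M + CK)) with hCE
  have hCE0 : 0 ≤ CE := by positivity
  set k₁ := M + 16 * (A * (vpκ * vpκ)) + 2 * (A * (vpκ * vpκ)) with hk₁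
  set D := |c| * (k₁ + (4 * CE + 2) * (4 * π * CK)) with hD
  have hk₁0 : 0 ≤ k₁ := by positivity
  have hD0 : 0 ≤ D := by positivity
  set E := 1 + R0 + D with hE
  refine ⟨E ^ (9 / 2 : ℝ), by positivity, fun ε hε G hs T hT z hz => ?_⟩
  obtain ⟨s₁, hs₁, z₁, hz₁', hmax'⟩ := vp_max_exists hs.reg hT hR0.le
  set Pm := ‖(vpCurve hs.reg 0 z₁ s₁).2‖ with hPm
  set b := (max 1 Pm) ^ ((18 : ℕ) : ℝ)⁻¹ with hb
  have hb18 : b ^ 18 = max 1 Pm := Real.rpow_inv_natCast_pow (by positivity) (by norm_num)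
  have hb1 : 1 ≤ b := Real.one_le_rpow (le_max_left _ _) (by positivity)
  have hb0 : 0 < b := by linarith
  have hP : ∀ s ∈ Icc 0 T, ∀ z, ‖z‖ ≤ R0 → ‖(vpCurve hs.reg 0 z s).2‖ ≤ b ^ 18 := by
    intro s hs' z hz
    rw [hb18]
    exact (hmax' s hs' z hz).trans (le_max_right _ _)
  have hF : ∀ s ∈ Icc 0 T, ∀ x, ‖G s x‖ ≤ CE * b ^ 24 := fun s hs' x =>
    vp_force_bound hf hs (hCK ε hε G hs s) hb1 (hP s hs') x
  have hsub : Icc 0 s₁ ⊆ Icc 0 T := Icc_subset_Icc_right hs₁.2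
  have hs10 : 0 ≤ s₁ := hs₁.1
  have htot := vp_total hf hs (hCK ε hε G hs) (p := b ^ 7) (r := (b ^ 4)⁻¹) (P := b ^ 18)
    (F := CE * b ^ 24) (by positivity) (by positivity) (by positivity) hs₁.1
    (fun s h => hP s (hsub h)) (fun s h => hF s (hsub h)) z₁
  have hPmb : Pm ≤ R0 + D * (1 + T) * b ^ 14 := by
    have h1 := norm_le_norm_add_norm_sub' (vpCurve hs.reg 0 z₁ s₁).2 z₁.2
    have h2 := (norm_snd_le z₁).trans hz₁'
    have h3 : |c| * (s₁ * ((M + 16 * (A * (vpκ * vpκ))) * (b ^ 7) ^ 2 +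
      2 * (A * (vpκ * vpκ)) * ((b ^ 4)⁻¹ * b ^ 18)) + (4 * (CE * b ^ 24) * s₁ / b ^ 7 + 2) *
        (4 * π * CK / (b ^ 7 * (b ^ 4)⁻¹))) ≤ D * (1 + T) * b ^ 14 := by
      have e1 : (b ^ 4)⁻¹ * b ^ 18 = b ^ 14 := by field_simp
      have e2 : (4 * (CE * b ^ 24) * s₁ / b ^ 7 + 2) * (4 * π * CK / (b ^ 7 * (b ^ 4)⁻¹)) =
        (4 * CE * s₁ * b ^ 14 + 2 * (b ^ 3)⁻¹) * (4 * π * CK) := by field_simp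
      have e3 : (b ^ 3)⁻¹ ≤ b ^ 14 := (inv_le_one_of_one_le₀ (one_le_pow₀ hb1)).trans
        (one_le_pow₀ hb1)
      rw [e1, e2]
      calc _ ≤ |c| * (s₁ * ((M + 16 * (A * (vpκ * vpκ))) * (b ^ 7) ^ 2 +
          2 * (A * (vpκ * vpκ)) * b ^ 14) + (4 * CE * s₁ * b ^ 14 + 2 * b ^ 14) *
            (4 * π * CK)) := by gcongr
        _ = |c| * (s₁ * k₁ + (4 * CE * s₁ + 2) * (4 * π * CK)) * b ^ 14 := by rw [hk₁]; ring
        _ ≤ |c| * ((1 + T) * k₁ + (4 * CE * (1 + T) + 2 * (1 + T)) * (4 * π * CK)) * b ^ 14 := by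
            have : s₁ ≤ 1 + T := by linarith [hs₁.2]
            gcongr
            linarith
        _ = _ := by rw [hD]; ring
    linarith
  have hb14 : 1 ≤ (1 + T) * b ^ 14 := by
    have := one_le_pow₀ (n := 14) hb1
    nlinarith
  have hfin : b ^ 18 ≤ E * (1 + T) * b ^ 14 := by
    rw [hb18, hE]
    refine max_le ?_ ?_
    · nlinarith [mul_nonneg hD0 (zero_le_one.trans hb14)]
    · nlinarith [mul_nonneg hD0 (zero_le_one.trans hb14)]
  have hb4 : b ^ 4 ≤ E * (1 + T) := by
    have : b ^ 18 = b ^ 4 * b ^ 14 := by ring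
    rw [this] at hfin
    exact le_of_mul_le_mul_right hfin (by positivity)
  have hE0 : 0 ≤ E := by positivity
  calc ‖(vpCurve hs.reg 0 z T).2‖ ≤ b ^ 18 := hP T (right_mem_Icc.2 hT) z hz
    _ = (b ^ 4) ^ (9 / 2 : ℝ) := by
        rw [← Real.rpow_natCast, ← Real.rpow_natCast, ← Real.rpow_mul hb0.le]
        norm_num
    _ ≤ (E * (1 + T)) ^ (9 / 2 : ℝ) := Real.rpow_le_rpow (by positivity) hb4 (by norm_num)
    _ = _ := Real.mul_rpow hE0 (by linarith)

end VPeleven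

section VPtwelve
open Set Filter Topology
open scoped NNReal ENNReal

/-- The density generated by transporting `f₀` along the flow. -/
def vpρ (f₀ : E3 × E3 → ℝ) {G : ℝ → E3 → E3} (h : VPReg G) (t : ℝ) (y : E3) : ℝ :=
  ∫ w, f₀ (vpCurve h t (y, w) 0)

/-- Volume of a ball. -/
def vpVol (P : ℝ) : ℝ := volume.real (Metric.closedBall (0 : E3) P)

lemma vpVol_nonneg (P : ℝ) : 0 ≤ vpVol P := measureReal_nonneg

/-- Support control at time `t`. -/
def VPSupp (R0 : ℝ) {G : ℝ → E3 → E3} (h : VPReg G) (t P R : ℝ) : Prop :=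
  ∀ z, ‖z‖ ≤ R0 → ‖(vpCurve h 0 z t).2‖ ≤ P ∧ ‖(vpCurve h 0 z t).1‖ ≤ R

lemma VPSupp.of_ne {f₀ : E3 × E3 → ℝ} {A Lf R0 : ℝ} (hf : VPData f₀ A Lf R0)
    {G : ℝ → E3 → E3} {h : VPReg G} {t P R : ℝ} (hS : VPSupp R0 h t P R) {y w : E3}
    (hne : f₀ (vpCurve h t (y, w) 0) ≠ 0) : ‖w‖ ≤ P ∧ ‖y‖ ≤ R := by
  have h1 : ‖vpCurve h t (y, w) 0‖ ≤ R0 := by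
    by_contra hc
    exact hne (hf.supp _ (not_le.1 hc))
  have := hS _ h1
  rwa [vpCurve_inv] at this

lemma vpρ_eq_ball {f₀ : E3 × E3 → ℝ} {A Lf R0 : ℝ} (hf : VPData f₀ A Lf R0)
    {G : ℝ → E3 → E3} {h : VPReg G} {t P R : ℝ} (hS : VPSupp R0 h t P R) (y : E3) :
    vpρ f₀ h t y = ∫ w in Metric.closedBall 0 P, f₀ (vpCurve h t (y, w) 0) := by
  unfold vpρ
  rw [setIntegral_eq_integral_of_forall_compl_eq_zero]
  intro w hw
  by_contra hne
  exact hw (mem_closedBall_zero_iff.2 (hS.of_ne hf hne).1)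

lemma vp_ker_cont {f₀ : E3 × E3 → ℝ} {A Lf R0 : ℝ} (hf : VPData f₀ A Lf R0)
    {G : ℝ → E3 → E3} (h : VPReg G) :
    Continuous (Function.uncurry fun (p : ℝ × E3) (w : E3) => f₀ (vpCurve h p.1 (p.2, w) 0)) := by
  have h1 : Continuous fun q : (ℝ × E3) × E3 => ((q.1.1, (q.1.2, q.2)) : ℝ × E3 × E3) := by fun_prop
  exact hf.cont.comp ((vpCurve_continuous_bwd h).comp h1)

lemma vpSupp_exists {G : ℝ → E3 → E3} (h : VPReg G) (R0 T : ℝ) :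
    ∃ P : ℝ, ∀ t, |t| ≤ T → VPSupp R0 h t P P := by
  have hcK : IsCompact (Icc (-T) T ×ˢ Metric.closedBall (0 : E3 × E3) R0) :=
    isCompact_Icc.prod (isCompact_closedBall _ _)
  obtain ⟨P, hP⟩ := hcK.exists_bound_of_continuousOn (vpCurve_continuous_fwd h).continuousOn
  refine ⟨P, fun t ht z hz => ?_⟩
  have h1 := hP (t, z) (mem_prod.2 ⟨abs_le.1 ht, mem_closedBall_zero_iff.2 hz⟩)
  exact ⟨(norm_snd_le _).trans h1, (norm_fst_le _).trans h1⟩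

lemma vpρ_continuous {f₀ : E3 × E3 → ℝ} {A Lf R0 : ℝ} (hf : VPData f₀ A Lf R0)
    {G : ℝ → E3 → E3} (h : VPReg G) : Continuous fun p : ℝ × E3 => vpρ f₀ h p.1 p.2 := by
  rw [continuous_iff_continuousAt]
  intro p₀
  obtain ⟨P, hP⟩ := vpSupp_exists h R0 (|p₀.1| + 1)
  have h1 : Continuous fun p : ℝ × E3 => ∫ w in Metric.closedBall (0 : E3) P,
      f₀ (vpCurve h p.1 (p.2, w) 0) :=
    continuous_parametric_integral_of_continuous (vp_ker_cont hf h) (isCompact_closedBall _ _)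
  refine h1.continuousAt.congr ?_
  have h2 : ∀ᶠ p : ℝ × E3 in 𝓝 p₀, |p.1| < |p₀.1| + 1 :=
    (continuous_fst.abs.continuousAt (x := p₀)).eventually_lt_const (by simp)
  filter_upwards [h2] with p hp
  exact (vpρ_eq_ball hf (hP p.1 hp.le) p.2).symm

lemma vpρ_cmp {f₀ : E3 × E3 → ℝ} {A Lf R0 : ℝ} (hf : VPData f₀ A Lf R0)
    {G G' : ℝ → E3 → E3} {h : VPReg G} {h' : VPReg G'} {t P R R' : ℝ} (hS : VPSupp R0 h t P R)
    (hS' : VPSupp R0 h' t P R') {y y' : E3} {b : ℝ}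
    (hb : ∀ w, ‖vpCurve h t (y, w) 0 - vpCurve h' t (y', w) 0‖ ≤ b) :
    |vpρ f₀ h t y - vpρ f₀ h' t y'| ≤ Lf * b * vpVol P := by
  have hc : ∀ {G : ℝ → E3 → E3} (h : VPReg G) (y : E3),
      Continuous fun w => f₀ (vpCurve h t (y, w) 0) := fun h y =>
    hf.cont.comp ((vpCurve_continuous_start h t 0).comp (by fun_prop))
  have hi : ∀ {G : ℝ → E3 → E3} (h : VPReg G) (y : E3),
      IntegrableOn (fun w => f₀ (vpCurve h t (y, w) 0)) (Metric.closedBall 0 P) := fun h y =>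
    (hc h y).continuousOn.integrableOn_compact (isCompact_closedBall _ _)
  rw [vpρ_eq_ball hf hS, vpρ_eq_ball hf hS', ← integral_sub (hi h y) (hi h' y'),
    ← Real.norm_eq_abs]
  refine norm_setIntegral_le_of_norm_le_const ?_ ?_
  · exact (isCompact_closedBall _ _).measure_lt_top
  · intro w _
    exact (hf.lip _ _).trans (mul_le_mul_of_nonneg_left (hb w) hf.hLf)

lemma vpρ_den {f₀ : E3 × E3 → ℝ} {A Lf R0 : ℝ} (hf : VPData f₀ A Lf R0)
    {G : ℝ → E3 → E3} {h : VPReg G} {t P R : ℝ} (hS : VPSupp R0 h t P R) (hR : 0 < R) :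
    VPDen (vpρ f₀ h t) (A * vpVol P) R := by
  refine ⟨?_, fun y => ?_, fun y hy => ?_, hR⟩
  · exact (vpρ_continuous hf h).comp (by fun_prop : Continuous fun y : E3 => (t, y))
  · rw [vpρ_eq_ball hf hS, ← Real.norm_eq_abs]
    refine norm_setIntegral_le_of_norm_le_const ?_ ?_
    · exact (isCompact_closedBall _ _).measure_lt_top
    · intro w _
      rw [Real.norm_eq_abs, abs_of_nonneg (hf.nonneg _)]
      exact hf.bd _
  · unfold vpρ
    rw [integral_eq_zero_of_ae]
    refine Eventually.of_forall fun w => ?_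
    by_contra hne
    exact absurd (hS.of_ne hf hne).2 (not_le.2 hy)

lemma vpSol_fld {f₀ : E3 × E3 → ℝ} {A Lf R0 : ℝ} (hf : VPData f₀ A Lf R0) {c ε : ℝ} (hε : 0 < ε)
    {G : ℝ → E3 → E3} (hs : VPSol f₀ c ε G) (t : ℝ) (x : E3) :
    G t x = c • vpFld ε (vpρ f₀ hs.reg t) x := by
  rw [hs.eq t x]
  congr 1
  unfold vpμ
  obtain ⟨P, hP⟩ := vpSupp_exists hs.reg R0 |t|
  have hS := hP t le_rfl
  have hKc : Continuous (vpK ε) := vpK_continuous hε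
  have hΨ := vpCurve_continuous_start hs.reg t 0
  have e1 : ∫ z, vpK ε (x - (vpCurve hs.reg 0 z t).1)
        ∂(volume.withDensity fun z => ENNReal.ofReal (f₀ z)) =
      ∫ z, f₀ z • vpK ε (x - (vpCurve hs.reg 0 z t).1) := by
    rw [integral_withDensity_eq_integral_toReal_smul₀ (by
      exact hf.cont.measurable.ennreal_ofReal.aemeasurable) (by simp)]
    refine integral_congr_ae (Eventually.of_forall fun z => ?_)
    simp only [ENNReal.toReal_ofReal (hf.nonneg z)]
  have hg : Continuous fun ζ : E3 × E3 => f₀ (vpCurve hs.reg t ζ 0) • vpK ε (x - ζ.1) :=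
    (hf.cont.comp hΨ).smul (hKc.comp (by fun_prop))
  have e2 : ∫ z, f₀ z • vpK ε (x - (vpCurve hs.reg 0 z t).1) =
      ∫ ζ, f₀ (vpCurve hs.reg t ζ 0) • vpK ε (x - ζ.1) := by
    have mp := vpCurve_mp hs.reg 0 t
    have e := integral_map (μ := volume) mp.measurable.aemeasurable
      (f := fun ζ : E3 × E3 => f₀ (vpCurve hs.reg t ζ 0) • vpK ε (x - ζ.1))
      hg.aestronglyMeasurable
    rw [mp.map_eq] at e
    rw [e]
    refine integral_congr_ae (Eventually.of_forall fun z => ?_)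
    simp only [vpCurve_inv]
  have hsupp : HasCompactSupport fun ζ : E3 × E3 =>
      f₀ (vpCurve hs.reg t ζ 0) • vpK ε (x - ζ.1) := by
    refine HasCompactSupport.intro (isCompact_closedBall (0 : E3 × E3) P) fun ζ hζ => ?_
    by_contra hne
    have h1 : f₀ (vpCurve hs.reg t (ζ.1, ζ.2) 0) ≠ 0 := fun h0 => hne (by
      change f₀ (vpCurve hs.reg t ζ 0) • vpK ε (x - ζ.1) = 0
      rw [show ζ = (ζ.1, ζ.2) from rfl, h0, zero_smul])
    have h2 := hS.of_ne hf h1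
    exact hζ (mem_closedBall_zero_iff.2 (by rw [Prod.norm_def]; exact max_le h2.2 h2.1))
  have hintg := hg.integrable_of_hasCompactSupport hsupp (μ := volume)
  have e3 : ∫ ζ, f₀ (vpCurve hs.reg t ζ 0) • vpK ε (x - ζ.1) =
      ∫ y, ∫ w, f₀ (vpCurve hs.reg t (y, w) 0) • vpK ε (x - y) := integral_prod _ hintg
  rw [e1, e2, e3]
  unfold vpFld vpρ
  refine integral_congr_ae (Eventually.of_forall fun y => ?_)
  exact integral_smul_const _ _

end VPtwelve

section VPthirteen
open Set Filter Topology
open scoped NNReal ENNReal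

lemma vp_iter {ι : Type*} {a b : ι → ℝ} {N0 B : ℝ} (hN0 : 0 ≤ N0) (hB : 0 ≤ B)
    (h0 : ∀ i, a i ≤ N0 * b i)
    (step : ∀ N, 0 ≤ N → (∀ i, a i ≤ N * b i) → ∀ i, a i ≤ (N / 2 + B) * b i) (i : ι) :
    a i ≤ 2 * B * b i := by
  have hk : ∀ k : ℕ, ∀ i, a i ≤ (N0 * (1 / 2) ^ k + 2 * B * (1 - (1 / 2) ^ k)) * b i := by
    intro k
    induction k with
    | zero => simpa using h0
    | succ k ih =>
      have hp : (1 / 2 : ℝ) ^ k ≤ 1 := pow_le_one₀ (by norm_num) (by norm_num)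
      have h1 := step _ (by
        have : 0 ≤ 1 - (1 / 2 : ℝ) ^ k := by linarith
        positivity) ih
      intro i
      refine (h1 i).trans (le_of_eq ?_)
      congr 1
      rw [pow_succ]
      ring
  have hl : Tendsto (fun k : ℕ => (N0 * (1 / 2) ^ k + 2 * B * (1 - (1 / 2) ^ k)) * b i) atTop
      (𝓝 ((N0 * 0 + 2 * B * (1 - 0)) * b i)) := by
    have h2 := tendsto_pow_atTop_nhds_zero_of_lt_one (r := (1 / 2 : ℝ)) (by norm_num) (by norm_num)
    exact ((h2.const_mul N0).add ((h2.const_sub 1).const_mul (2 * B))).mul_const _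
  have := ge_of_tendsto' hl (fun k => hk k i)
  simpa using this

lemma vpSupp_of_speed {G : ℝ → E3 → E3} (h : VPReg G) {R0 T P : ℝ} (hP0 : 0 ≤ P)
    (hP : ∀ s ∈ Icc 0 T, ∀ z, ‖z‖ ≤ R0 → ‖(vpCurve h 0 z s).2‖ ≤ P) {t : ℝ} (ht : t ∈ Icc 0 T) :
    VPSupp R0 h t P (R0 + T * P) := by
  intro z hz
  refine ⟨hP t ht z hz, ?_⟩
  have := (convex_Icc (0:ℝ) T).norm_image_sub_le_of_norm_hasDerivWithin_le
    (f := fun s => (vpCurve h 0 z s).1) (f' := fun s => (vpCurve h 0 z s).2) (C := P)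
    (fun x _ => (vpCurve_deriv_fst h 0 z x).hasDerivWithinAt) (fun x hx => hP x hx z hz)
    (left_mem_Icc.2 (ht.1.trans ht.2)) ht
  rw [vpCurve_self, sub_zero, Real.norm_eq_abs, abs_of_nonneg ht.1] at this
  have h2 := norm_le_norm_add_norm_sub' (vpCurve h 0 z t).1 z.1
  have h3 := (norm_fst_le z).trans hz
  nlinarith [ht.2]

lemma vp_unif_supp {f₀ : E3 × E3 → ℝ} {A Lf R0 : ℝ} (hf : VPData f₀ A Lf R0) (c T : ℝ)
    (_hT : 0 ≤ T) : ∃ P : ℝ, 0 ≤ P ∧ ∀ (ε : ℝ) (_ : 0 < ε) (G : ℝ → E3 → E3) (hs : VPSol f₀ c ε G),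
      ∀ t ∈ Icc 0 T, VPSupp R0 hs.reg t P (R0 + T * P) := by
  obtain ⟨CP, hCP0, hCP⟩ := vp_apriori hf c
  refine ⟨CP * (1 + T) ^ (9 / 2 : ℝ), by positivity, fun ε hε G hs t ht => ?_⟩
  refine vpSupp_of_speed hs.reg (by positivity) (fun s hs' z hz => ?_) ht
  refine (hCP ε hε G hs s hs'.1 z hz).trans ?_
  have := hs'.1
  have := hs'.2
  gcongr

lemma vp_lip_flow {G : ℝ → E3 → E3} (h : VPReg G) {T N lam : ℝ} (hN : 0 ≤ N) (hl : 0 < lam)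
    (hL : ∀ t ∈ Icc 0 T, ∀ x y, ‖G t x - G t y‖ ≤ N * exp (lam * t) * ‖x - y‖) {t : ℝ}
    (ht : t ∈ Icc 0 T) (z z' : E3 × E3) :
    ‖vpCurve h t z 0 - vpCurve h t z' 0‖ ≤
      exp (t + N * (exp (lam * t) - 1) / lam) * ‖z - z'‖ := by
  have key := vp_curve_cmp h (vpCurve_deriv h t z) (vpCurve_deriv h t z') (-1) (by simp) t t
    (N * exp (lam * t)) ht.1 (fun s => N * exp (lam * (t - s))) (fun _ => 0)
    (fun s => exp (s + N * (exp (lam * t) - exp (lam * (t - s))) / lam) * ‖z - z'‖)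
    (fun s => (1 + N * exp (lam * (t - s))) *
      (exp (s + N * (exp (lam * t) - exp (lam * (t - s))) / lam) * ‖z - z'‖))
    (fun s _ => by positivity)
    (fun s hs => by
      have := hs.1
      have : lam * (t - s) ≤ lam * t := by nlinarith
      gcongr)
    (fun s _ => le_rfl)
    (fun s hs x y => by
      have e : t + (-1) * s = t - s := by ring
      rw [e]
      exact hL (t - s) ⟨by linarith [hs.2], by linarith [hs.1, ht.2]⟩ x y)
    (fun s _ x => by simp)
    (fun s => by
      have h1 : HasDerivAt (fun s => exp (lam * (t - s))) (exp (lam * (t - s)) * (lam * (-1))) s :=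
        (((hasDerivAt_id s).const_sub t).const_mul lam).exp
      have h2 := ((hasDerivAt_id s).add
        (((h1.const_sub (exp (lam * t))).const_mul N).div_const lam)).exp.mul_const ‖z - z'‖
      refine h2.congr_deriv ?_
      simp only [Pi.add_apply, id]
      rw [show 1 + N * -(exp (lam * (t - s)) * (lam * -1)) / lam = 1 + N * exp (lam * (t - s)) by field_simp]
      ring)
    (by simp [vpCurve_self])
    (fun s _ => by simp)
  have e : t + (-1) * t = 0 := by ring
  rw [e] at key
  simpa using key

lemma vp_lip_step {f₀ : E3 × E3 → ℝ} {A Lf R0 : ℝ} (hf : VPData f₀ A Lf R0) {c ε : ℝ} (hε : 0 < ε)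
    {G : ℝ → E3 → E3} (hs : VPSol f₀ c ε G) {T P R N lam a₀ a₁ : ℝ} (_hT : 0 ≤ T) (hR : 0 < R)
    (hS : ∀ t ∈ Icc 0 T, VPSupp R0 hs.reg t P R)
    (ha₁ : a₁ = |c| * (8 * vpκ * (A * vpVol P)))
    (ha₀ : a₀ = |c| * (12 * vpκ * (Lf * vpVol P)) + a₁ * (1 + log (1 + R) + T))
    (hl : lam = 2 * a₁ + 1)
    (hN : 0 ≤ N)
    (hL : ∀ t ∈ Icc 0 T, ∀ x y, ‖G t x - G t y‖ ≤ N * exp (lam * t) * ‖x - y‖) :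
    ∀ t ∈ Icc 0 T, ∀ x y, ‖G t x - G t y‖ ≤ (N / 2 + a₀) * exp (lam * t) * ‖x - y‖ := by
  intro t ht x y
  have hA := hf.hA
  have hκ := vpκ_nonneg
  have hV := vpVol_nonneg P
  have hLf := hf.hLf
  have ha₁0 : 0 ≤ a₁ := by rw [ha₁]; positivity
  have hlam : 0 < lam := by linarith
  have hlogR : 0 ≤ log (1 + R) := log_nonneg (by linarith)
  set S := t + N * (exp (lam * t) - 1) / lam with hSdef
  have hexp1 : 1 ≤ exp (lam * t) := one_le_exp (by have := ht.1; positivity)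
  have hS0 : 0 ≤ S := by
    have h1 : 0 ≤ N * (exp (lam * t) - 1) / lam :=
      div_nonneg (mul_nonneg hN (by linarith)) hlam.le
    linarith [ht.1]
  have hflow := vp_lip_flow hs.reg hN hlam hL ht
  rw [← hSdef] at hflow
  have hden := vpρ_den hf (hS t ht) hR
  have hρ : ∀ y y', |vpρ f₀ hs.reg t y - vpρ f₀ hs.reg t y'| ≤
      Lf * vpVol P * exp S * ‖y - y'‖ := by
    intro y y'
    refine (vpρ_cmp hf (hS t ht) (hS t ht) (b := exp S * ‖y - y'‖) (fun w => ?_)).trans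
      (le_of_eq (by ring))
    refine (hflow _ _).trans (le_of_eq ?_)
    simp [Prod.norm_def]
  have hmain := vpFld_lip_all hε.le (d := exp (-S)) (exp_pos _) hden
    (L := Lf * vpVol P * exp S) (by positivity) hρ x y
  rw [vpSol_fld hf hε hs t x, vpSol_fld hf hε hs t y, ← smul_sub, norm_smul, Real.norm_eq_abs]
  refine (mul_le_mul_of_nonneg_left hmain (abs_nonneg c)).trans ?_
  rw [← mul_assoc]
  refine mul_le_mul_of_nonneg_right ?_ (norm_nonneg _)
  have e1 : exp (-S) * (Lf * vpVol P * exp S) = Lf * vpVol P := by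
    rw [mul_comm (Lf * vpVol P), ← mul_assoc, ← exp_add]
    simp
  have e2 : log (1 + R / exp (-S)) ≤ log (1 + R) + S := by
    have : log (1 + R) + S = log ((1 + R) * exp S) := by
      rw [log_mul (by linarith) (exp_pos _).ne', log_exp]
    rw [this]
    apply log_le_log (by positivity)
    rw [exp_neg, div_inv_eq_mul]
    nlinarith [one_le_exp hS0]
  rw [e1]
  have e3 : S ≤ T + N * exp (lam * t) / lam := by
    have : N * (exp (lam * t) - 1) / lam ≤ N * exp (lam * t) / lam := by
      gcongr
      linarith
    linarith [ht.2]
  have e4 : a₁ * (N * exp (lam * t) / lam) ≤ N / 2 * exp (lam * t) := by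
    rw [mul_div_assoc', div_le_iff₀ hlam]
    have := mul_nonneg hN (exp_pos (lam * t)).le
    have e : lam * (N * exp (lam * t)) = (2 * a₁ + 1) * (N * exp (lam * t)) := by rw [← hl]
    nlinarith
  have ha₀0 : 0 ≤ a₀ := by
    have := ht.1.trans ht.2
    rw [ha₀]
    positivity
  calc |c| * (12 * vpκ * (Lf * vpVol P) + 8 * vpκ * (A * vpVol P) * (1 + log (1 + R / exp (-S))))
      ≤ |c| * (12 * vpκ * (Lf * vpVol P) + 8 * vpκ * (A * vpVol P) *
          (1 + (log (1 + R) + (T + N * exp (lam * t) / lam)))) := by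
        gcongr
        exact e2.trans (by linarith)
    _ = a₀ + a₁ * (N * exp (lam * t) / lam) := by rw [ha₀, ha₁]; ring
    _ ≤ a₀ * exp (lam * t) + N / 2 * exp (lam * t) := by nlinarith
    _ = _ := by ring

lemma vp_unif_lip {f₀ : E3 × E3 → ℝ} {A Lf R0 : ℝ} (hf : VPData f₀ A Lf R0) (c T : ℝ)
    (hT : 0 ≤ T) : ∃ L : ℝ, 0 ≤ L ∧ ∀ (ε : ℝ) (_ : 0 < ε) (G : ℝ → E3 → E3) (_ : VPSol f₀ c ε G),
      ∀ t ∈ Icc 0 T, ∀ x y, ‖G t x - G t y‖ ≤ L * ‖x - y‖ := by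
  obtain ⟨P, hP0, hP⟩ := vp_unif_supp hf c T hT
  have hA := hf.hA
  have hκ := vpκ_nonneg
  have hV := vpVol_nonneg P
  have hLf := hf.hLf
  have hR : 0 < R0 + T * P := by have := hf.hR0; positivity
  set R := R0 + T * P
  obtain ⟨a₁, ha₁⟩ : ∃ a₁, a₁ = |c| * (8 * vpκ * (A * vpVol P)) := ⟨_, rfl⟩
  obtain ⟨a₀, ha₀⟩ : ∃ a₀, a₀ = |c| * (12 * vpκ * (Lf * vpVol P)) +
    a₁ * (1 + log (1 + R) + T) := ⟨_, rfl⟩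
  obtain ⟨lam, hl⟩ : ∃ lam, lam = 2 * a₁ + 1 := ⟨_, rfl⟩
  have ha₁0 : 0 ≤ a₁ := by rw [ha₁]; positivity
  have hlogR : 0 ≤ log (1 + R) := log_nonneg (by linarith)
  have ha₀0 : 0 ≤ a₀ := by rw [ha₀]; positivity
  refine ⟨2 * a₀ * exp (lam * T), by positivity, fun ε hε G hs t ht x y => ?_⟩
  obtain ⟨K, hK⟩ := hs.lip
  have hK' : ∀ t x y, ‖G t x - G t y‖ ≤ |K| * ‖x - y‖ := fun t x y =>
    (hK t x y).trans (by gcongr; exact le_abs_self K)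
  have key := vp_iter (ι := Icc (0:ℝ) T × E3 × E3)
    (a := fun i => ‖G i.1 i.2.1 - G i.1 i.2.2‖)
    (b := fun i => exp (lam * i.1) * ‖i.2.1 - i.2.2‖) (N0 := |K|) (B := a₀) (abs_nonneg K) ha₀0
    (fun i => by
      have : 1 ≤ exp (lam * i.1) := one_le_exp (by have := i.1.2.1; have : 0 ≤ lam := (by linarith); positivity)
      refine (hK' _ _ _).trans ?_
      have h2 := mul_nonneg (abs_nonneg K) (norm_nonneg (i.2.1 - i.2.2))
      nlinarith)
    (fun N hN hi i => by
      have := vp_lip_step hf hε hs hT hR (hP ε hε G hs) ha₁ ha₀ hl hN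
        (fun t ht x y => by simpa only [mul_assoc] using hi (⟨t, ht⟩, x, y)) i.1 i.1.2 i.2.1 i.2.2
      simpa only [mul_assoc] using this) (⟨t, ht⟩, x, y)
  refine key.trans ?_
  simp only
  rw [← mul_assoc]
  have := ht.2
  have : 0 ≤ lam := by linarith
  gcongr

end VPthirteen

section VPfourteen
open Set Filter Topology
open scoped NNReal ENNReal

lemma vp_diff_flow {G G' : ℝ → E3 → E3} (h : VPReg G) (h' : VPReg G') {T N L lam : ℝ} (hN : 0 ≤ N)
    (hL0 : 0 ≤ L) (hl : 0 < lam)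
    (hL : ∀ t ∈ Icc 0 T, ∀ x y, ‖G t x - G t y‖ ≤ L * ‖x - y‖)
    (hD : ∀ t ∈ Icc 0 T, ∀ x, ‖G t x - G' t x‖ ≤ N * exp (lam * t)) {t : ℝ}
    (ht : t ∈ Icc 0 T) (z : E3 × E3) :
    ‖vpCurve h t z 0 - vpCurve h' t z 0‖ ≤
      exp ((1 + L) * T) * (N * exp (lam * t) / lam) := by
  have key := vp_curve_cmp h (vpCurve_deriv h t z) (vpCurve_deriv h' t z) (-1) (by simp) t t
    L ht.1 (fun s => L) (fun s => N * exp (lam * (t - s)))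
    (fun s => exp ((1 + L) * s) * (N * (exp (lam * t) - exp (lam * (t - s))) / lam))
    (fun s => exp ((1 + L) * s) * (1 + L) * (N * (exp (lam * t) - exp (lam * (t - s))) / lam) +
      exp ((1 + L) * s) * (N * exp (lam * (t - s))))
    (fun s _ => hL0) (fun s hs => le_rfl)
    (fun s _ => by positivity)
    (fun s hs x y => by
      have e : t + (-1) * s = t - s := by ring
      rw [e]
      exact hL (t - s) ⟨by linarith [hs.2], by linarith [hs.1, ht.2]⟩ x y)
    (fun s hs x => by
      have e : t + (-1) * s = t - s := by ring
      rw [e]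
      exact hD (t - s) ⟨by linarith [hs.2], by linarith [hs.1, ht.2]⟩ x)
    (fun s => by
      have h1 : HasDerivAt (fun s => exp (lam * (t - s))) (exp (lam * (t - s)) * (lam * (-1))) s :=
        (((hasDerivAt_id s).const_sub t).const_mul lam).exp
      have h3 : HasDerivAt (fun s => exp ((1 + L) * s)) (exp ((1 + L) * s) * ((1 + L) * 1)) s :=
        ((hasDerivAt_id s).const_mul (1 + L)).exp
      have h2 := h3.mul (((h1.const_sub (exp (lam * t))).const_mul N).div_const lam)
      refine h2.congr_deriv ?_
      rw [show N * -(exp (lam * (t - s)) * (lam * -1)) / lam = N * exp (lam * (t - s)) by field_simp]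
      ring)
    (by simp [vpCurve_self])
    (fun s hs => by
      have h1 : 1 ≤ exp ((1 + L) * s) := one_le_exp (by have := hs.1; positivity)
      have h2 : 0 ≤ N * exp (lam * (t - s)) := by positivity
      nlinarith)
  have e : t + (-1) * t = 0 := by ring
  rw [e] at key
  refine key.trans ?_
  have := ht.2
  have h1 : 1 ≤ exp (lam * t) := one_le_exp (by have := ht.1; positivity)
  gcongr
  · simp only [sub_self, mul_zero, exp_zero]
    exact div_nonneg (mul_nonneg hN (by linarith)) hl.le
  · linarith [exp_pos (lam * (t - t))]

lemma vp_diff_const {G G' : ℝ → E3 → E3} (h : VPReg G) (h' : VPReg G') {T L η : ℝ} (hη : 0 ≤ η)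
    (hL0 : 0 ≤ L)
    (hL : ∀ t ∈ Icc 0 T, ∀ x y, ‖G t x - G t y‖ ≤ L * ‖x - y‖)
    (hD : ∀ t ∈ Icc 0 T, ∀ x, ‖G t x - G' t x‖ ≤ η) {t : ℝ}
    (ht : t ∈ Icc 0 T) (σ a : ℝ) (hσ : |σ| = 1) (ha : ∀ s ∈ Icc 0 t, a + σ * s ∈ Icc 0 T)
    (z : E3 × E3) :
    ‖vpCurve h a z (a + σ * t) - vpCurve h' a z (a + σ * t)‖ ≤ exp ((1 + L) * T) * (η * T) := by
  have key := vp_curve_cmp h (vpCurve_deriv h a z) (vpCurve_deriv h' a z) σ hσ a t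
    L ht.1 (fun s => L) (fun s => η)
    (fun s => exp ((1 + L) * s) * (η * s))
    (fun s => exp ((1 + L) * s) * ((1 + L) * 1) * (η * s) + exp ((1 + L) * s) * (η * 1))
    (fun s _ => hL0) (fun s hs => le_rfl)
    (fun s _ => hη)
    (fun s hs x y => hL _ (ha s hs) x y)
    (fun s hs x => hD _ (ha s hs) x)
    (fun s => by
      have h3 : HasDerivAt (fun s => exp ((1 + L) * s)) (exp ((1 + L) * s) * ((1 + L) * 1)) s :=
        ((hasDerivAt_id s).const_mul (1 + L)).exp
      exact h3.mul ((hasDerivAt_id s).const_mul η))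
    (by simp [vpCurve_self])
    (fun s hs => by
      have h1 : 1 ≤ exp ((1 + L) * s) := one_le_exp (by have := hs.1; positivity)
      nlinarith)
  refine key.trans ?_
  have := ht.2
  have := ht.1
  gcongr

lemma vp_fld_cmp {f₀ : E3 × E3 → ℝ} {A Lf R0 : ℝ} (hf : VPData f₀ A Lf R0)
    {G G' : ℝ → E3 → E3} {h : VPReg G} {h' : VPReg G'} {t P R : ℝ} (hR : 0 < R)
    (hS : VPSupp R0 h t P R) (hS' : VPSupp R0 h' t P R) {b ε ε' : ℝ} (hε : 0 ≤ ε) (hε' : 0 ≤ ε')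
    (hb : ∀ z, ‖vpCurve h t z 0 - vpCurve h' t z 0‖ ≤ b) (x : E3) :
    ‖vpFld ε (vpρ f₀ h t) x - vpFld ε' (vpρ f₀ h' t) x‖ ≤
      Lf * b * vpVol P * (2 * vpκ * R) + A * vpVol P * (6 * vpκ * (ε + ε')) := by
  have h1 := vpρ_den hf hS hR
  have h2 := vpρ_den hf hS' hR
  have hd : VPDen (fun y => vpρ f₀ h t y - vpρ f₀ h' t y) (Lf * b * vpVol P) R :=
    ⟨h1.cont.sub h2.cont, fun y => vpρ_cmp hf hS hS' (fun w => hb _),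
      fun y hy => by rw [h1.supp y hy, h2.supp y hy, sub_zero], hR⟩
  have e1 := vpFld_norm ε hd x
  rw [← vpFld_sub ε h1 h2] at e1
  have e2 := vpFld_diff hε hε' h2 x
  exact (norm_sub_le_norm_sub_add_norm_sub _ _ _).trans (add_le_add e1 e2)

lemma vp_cauchy {f₀ : E3 × E3 → ℝ} {A Lf R0 : ℝ} (hf : VPData f₀ A Lf R0) (c T : ℝ)
    (hT : 0 ≤ T) : ∃ C : ℝ, 0 ≤ C ∧ ∀ (ε ε' : ℝ) (_ : 0 < ε) (_ : 0 < ε') (G G' : ℝ → E3 → E3)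
      (_ : VPSol f₀ c ε G) (_ : VPSol f₀ c ε' G'),
      ∀ t ∈ Icc 0 T, ∀ x, ‖G t x - G' t x‖ ≤ C * (ε + ε') := by
  obtain ⟨P, hP0, hP⟩ := vp_unif_supp hf c T hT
  obtain ⟨L, hL0, hL⟩ := vp_unif_lip hf c T hT
  have hA := hf.hA
  have hκ := vpκ_nonneg
  have hV := vpVol_nonneg P
  have hLf := hf.hLf
  have hR : 0 < R0 + T * P := by have := hf.hR0; positivity
  set R := R0 + T * P
  obtain ⟨D, hD⟩ : ∃ D, D = |c| * (Lf * vpVol P * (2 * vpκ * R)) * exp ((1 + L) * T) := ⟨_, rfl⟩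
  obtain ⟨lam, hl⟩ : ∃ lam, lam = 2 * D + 1 := ⟨_, rfl⟩
  have hD0 : 0 ≤ D := by rw [hD]; positivity
  have hlam : 0 < lam := by linarith
  refine ⟨2 * (|c| * (A * vpVol P * (6 * vpκ))) * exp (lam * T), by positivity,
    fun ε ε' hε hε' G G' hs hs' t ht x => ?_⟩
  obtain ⟨K, hK⟩ := hs.bd
  obtain ⟨K', hK'⟩ := hs'.bd
  have key := vp_iter (ι := Icc (0:ℝ) T × E3)
    (a := fun i => ‖G i.1 i.2 - G' i.1 i.2‖)
    (b := fun i => exp (lam * i.1)) (N0 := |K| + |K'|)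
    (B := |c| * (A * vpVol P * (6 * vpκ * (ε + ε')))) (by positivity) (by positivity)
    (fun i => by
      have h1 : 1 ≤ exp (lam * i.1) := one_le_exp (by have := i.1.2.1; positivity)
      have h2 : ‖G i.1 i.2 - G' i.1 i.2‖ ≤ |K| + |K'| := (norm_sub_le _ _).trans
        (add_le_add ((hK _ _).trans (le_abs_self _)) ((hK' _ _).trans (le_abs_self _)))
      have h3 : 0 ≤ |K| + |K'| := by positivity
      nlinarith)
    (fun N hN hi i => by
      have hd : ∀ t ∈ Icc 0 T, ∀ x, ‖G t x - G' t x‖ ≤ N * exp (lam * t) :=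
        fun t ht x => hi (⟨t, ht⟩, x)
      obtain ⟨⟨t, ht⟩, x⟩ := i
      simp only
      have hb := vp_diff_flow hs.reg hs'.reg hN hL0 hlam (hL ε hε G hs) hd ht
      have hc := vp_fld_cmp hf hR (hP ε hε G hs t ht) (hP ε' hε' G' hs' t ht) hε.le hε'.le hb x
      rw [vpSol_fld hf hε hs t x, vpSol_fld hf hε' hs' t x, ← smul_sub, norm_smul,
        Real.norm_eq_abs]
      refine (mul_le_mul_of_nonneg_left hc (abs_nonneg c)).trans ?_
      have e1 : 1 ≤ exp (lam * t) := one_le_exp (by have := ht.1; positivity)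
      have e4 : D * (N * exp (lam * t) / lam) ≤ N / 2 * exp (lam * t) := by
        rw [mul_div_assoc', div_le_iff₀ hlam]
        have := mul_nonneg hN (exp_pos (lam * t)).le
        have e : lam * (N * exp (lam * t)) = (2 * D + 1) * (N * exp (lam * t)) := by rw [← hl]
        nlinarith
      have e5 : 0 ≤ |c| * (A * vpVol P * (6 * vpκ * (ε + ε'))) := by positivity
      calc _ = D * (N * exp (lam * t) / lam) + |c| * (A * vpVol P * (6 * vpκ * (ε + ε'))) := by
            rw [hD]; ring
        _ ≤ N / 2 * exp (lam * t) + |c| * (A * vpVol P * (6 * vpκ * (ε + ε'))) * exp (lam * t) := by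
            nlinarith
        _ = _ := by ring) (⟨t, ht⟩, x)
  refine key.trans ?_
  simp only
  have := ht.2
  calc _ ≤ 2 * (|c| * (A * vpVol P * (6 * vpκ * (ε + ε')))) * exp (lam * T) := by gcongr
    _ = _ := by ring

lemma vp_lim_seq {f₀ : E3 × E3 → ℝ} {A Lf R0 : ℝ} (hf : VPData f₀ A Lf R0) (c : ℝ) :
    ∃ (e : ℕ → ℝ) (Gn : ℕ → ℝ → E3 → E3) (G : ℝ → E3 → E3), (∀ n, 0 < e n) ∧
      Tendsto e atTop (𝓝 0) ∧ (∀ n, VPSol f₀ c (e n) (Gn n)) ∧ (∀ t, G t = G (max t 0)) ∧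
      ∀ T, 0 ≤ T → ∃ C, 0 ≤ C ∧ ∀ n, ∀ t ∈ Icc 0 T, ∀ x, ‖Gn n t x - G t x‖ ≤ C * e n := by
  choose Gn hGn using fun n : ℕ => vp_sol_exists hf c (ε := 1 / ((n:ℝ) + 1)) (by positivity)
  have he0 : ∀ n : ℕ, (0:ℝ) < 1 / ((n:ℝ) + 1) := fun n => by positivity
  have hlim0 : Tendsto (fun n : ℕ => 1 / ((n:ℝ) + 1)) atTop (𝓝 0) :=
    tendsto_one_div_add_atTop_nhds_zero_nat
  have hlim : ∀ t, 0 ≤ t → ∀ x, ∃ y, Tendsto (fun n => Gn n t x) atTop (𝓝 y) := by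
    intro t ht x
    obtain ⟨C, hC0, hC⟩ := vp_cauchy hf c t ht
    apply cauchySeq_tendsto_of_complete
    refine cauchySeq_of_le_tendsto_0 (fun n : ℕ => C * (1 / ((n:ℝ) + 1) + 1 / ((n:ℝ) + 1))) ?_ ?_
    · intro n m N hn hm
      rw [dist_eq_norm]
      refine (hC _ _ (he0 n) (he0 m) _ _ (hGn n) (hGn m) t (right_mem_Icc.2 ht) x).trans ?_
      have h1 : (N:ℝ) ≤ n := by exact_mod_cast hn
      have h2 : (N:ℝ) ≤ m := by exact_mod_cast hm
      gcongr
    · simpa using (hlim0.add hlim0).const_mul C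
  choose! Gl hGl using hlim
  refine ⟨_, Gn, fun t => Gl (max t 0), he0, hlim0, hGn, fun t => by simp, fun T hT => ?_⟩
  obtain ⟨C, hC0, hC⟩ := vp_cauchy hf c T hT
  refine ⟨C, hC0, fun n t ht x => ?_⟩
  simp only [max_eq_left ht.1]
  have h1 : Tendsto (fun m => ‖Gn n t x - Gn m t x‖) atTop (𝓝 ‖Gn n t x - Gl t x‖) :=
    (tendsto_const_nhds.sub (hGl t ht.1 x)).norm
  have h2 : Tendsto (fun m : ℕ => C * (1 / ((n:ℝ) + 1) + 1 / ((m:ℝ) + 1))) atTop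
      (𝓝 (C * (1 / ((n:ℝ) + 1) + 0))) := (hlim0.const_add _).const_mul C
  rw [add_zero] at h2
  exact le_of_tendsto_of_tendsto' h1 h2 fun m =>
    hC _ _ (he0 n) (he0 m) _ _ (hGn n) (hGn m) t ht x

lemma vp_limit {f₀ : E3 × E3 → ℝ} {A Lf R0 : ℝ} (hf : VPData f₀ A Lf R0) (c : ℝ) :
    ∃ (G : ℝ → E3 → E3) (h : VPReg G) (CP : ℝ), 0 ≤ CP ∧ (∀ t, G t = G (max t 0)) ∧
      (∀ t, 0 ≤ t → ∀ z, ‖z‖ ≤ R0 → ‖(vpCurve h 0 z t).2‖ ≤ CP * (1 + t) ^ (9 / 2 : ℝ)) ∧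
      ∀ t, 0 ≤ t → ∀ x, G t x = c • vpFld 0 (vpρ f₀ h t) x := by
  obtain ⟨CP, hCP0, hCP⟩ := vp_apriori hf c
  obtain ⟨e, Gn, G, he, hlim, hGn, hmax, hconv⟩ := vp_lim_seq hf c
  have hpt : ∀ t, 0 ≤ t → ∀ x, Tendsto (fun n => Gn n t x) atTop (𝓝 (G t x)) := by
    intro t ht x
    obtain ⟨C, hC0, hC⟩ := hconv t ht
    rw [tendsto_iff_norm_sub_tendsto_zero]
    refine squeeze_zero (fun _ => norm_nonneg _) (fun n => hC n t (right_mem_Icc.2 ht) x) ?_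
    simpa using hlim.const_mul C
  have hlip : ∀ T, 0 ≤ T → ∃ L, 0 ≤ L ∧ ∀ t ∈ Icc 0 T, ∀ x y, ‖G t x - G t y‖ ≤ L * ‖x - y‖ := by
    intro T hT
    obtain ⟨L, hL0, hL⟩ := vp_unif_lip hf c T hT
    refine ⟨L, hL0, fun t ht x y => ?_⟩
    exact le_of_tendsto' ((hpt t ht.1 x).sub (hpt t ht.1 y)).norm
      fun n => hL _ (he n) _ (hGn n) t ht x y
  have hmaxI : ∀ {t T : ℝ}, |t| ≤ T → max t 0 ∈ Icc 0 T := fun {t T} ht =>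
    ⟨le_max_right _ _, max_le ((le_abs_self t).trans ht) ((abs_nonneg t).trans ht)⟩
  have hreg : VPReg G := by
    constructor
    · have hu : TendstoLocallyUniformly (fun n (p : ℝ × E3) => Gn n (max p.1 0) p.2)
          (fun p => G p.1 p.2) atTop := by
        rw [Metric.tendstoLocallyUniformly_iff]
        intro δ hδ p₀
        obtain ⟨C, hC0, hC⟩ := hconv (|p₀.1| + 1) (by positivity)
        refine ⟨{p | |p.1| < |p₀.1| + 1}, ?_, ?_⟩
        · exact (continuous_fst.abs.continuousAt (x := p₀)).eventually_lt_const (by simp)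
        · have h1 : Tendsto (fun n => C * e n) atTop (𝓝 0) := by simpa using hlim.const_mul C
          filter_upwards [h1.eventually_lt_const hδ] with n hn p hp
          rw [dist_comm, dist_eq_norm, hmax p.1]
          exact (hC n _ (hmaxI (le_of_lt hp)) p.2).trans_lt hn
      refine hu.continuous (Eventually.frequently (Eventually.of_forall fun n => ?_))
      exact (hGn n).reg.cont.comp (by fun_prop :
        Continuous fun p : ℝ × E3 => ((max p.1 0, p.2) : ℝ × E3))
    · intro T
      obtain ⟨L, hL0, hL⟩ := hlip (max T 0) (le_max_right _ _)
      refine ⟨⟨L, hL0⟩, fun t ht => LipschitzWith.of_dist_le_mul fun x y => ?_⟩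
      rw [dist_eq_norm, dist_eq_norm, hmax t]
      exact hL _ (hmaxI (ht.trans (le_max_left _ _))) x y
  -- flows converge
  have hflow : ∀ t, 0 ≤ t → ∃ D, 0 ≤ D ∧ ∀ n z,
      ‖vpCurve hreg 0 z t - vpCurve (hGn n).reg 0 z t‖ ≤ D * e n ∧
      ‖vpCurve hreg t z 0 - vpCurve (hGn n).reg t z 0‖ ≤ D * e n := by
    intro t ht
    obtain ⟨C, hC0, hC⟩ := hconv t ht
    obtain ⟨L, hL0, hL⟩ := hlip t ht
    refine ⟨exp ((1 + L) * t) * (C * t), by positivity, fun n z => ?_⟩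
    have hn := he n
    have hd : ∀ s ∈ Icc 0 t, ∀ x, ‖G s x - Gn n s x‖ ≤ C * e n := fun s hs x => by
      rw [norm_sub_rev]
      exact hC n s hs x
    have h1 := vp_diff_const hreg (hGn n).reg (by positivity) hL0 hL hd (right_mem_Icc.2 ht) 1 0
      (by simp) (fun s hs => by simpa using hs) z
    have h2 := vp_diff_const hreg (hGn n).reg (by positivity) hL0 hL hd (right_mem_Icc.2 ht) (-1) t
      (by simp) (fun s hs => ⟨by linarith [hs.2], by linarith [hs.1]⟩) z
    have e0 : (0:ℝ) + 1 * t = t := by ring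
    have e1 : t + (-1) * t = 0 := by ring
    rw [e0] at h1
    rw [e1] at h2
    exact ⟨h1.trans (le_of_eq (by ring)), h2.trans (le_of_eq (by ring))⟩
  have hbd : ∀ t, 0 ≤ t → ∀ z, ‖z‖ ≤ R0 →
      ‖(vpCurve hreg 0 z t).2‖ ≤ CP * (1 + t) ^ (9 / 2 : ℝ) := by
    intro t ht z hz
    obtain ⟨D, hD0, hD⟩ := hflow t ht
    have h1 : Tendsto (fun n => CP * (1 + t) ^ (9 / 2 : ℝ) + D * e n) atTop
        (𝓝 (CP * (1 + t) ^ (9 / 2 : ℝ) + D * 0)) := (hlim.const_mul D).const_add _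
    rw [mul_zero, add_zero] at h1
    refine ge_of_tendsto' h1 fun n => ?_
    have h2 := hCP _ (he n) _ (hGn n) t ht z hz
    have h3 := (norm_snd_le (vpCurve hreg 0 z t - vpCurve (hGn n).reg 0 z t)).trans (hD n z).1
    rw [Prod.snd_sub] at h3
    have h4 := norm_le_norm_add_norm_sub' (vpCurve hreg 0 z t).2 (vpCurve (hGn n).reg 0 z t).2
    linarith
  refine ⟨G, hreg, CP, hCP0, hmax, hbd, fun t ht x => ?_⟩
  obtain ⟨D, hD0, hD⟩ := hflow t ht
  set P := CP * (1 + t) ^ (9 / 2 : ℝ) with hPdef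
  have hP0 : 0 ≤ P := by positivity
  have hmono : ∀ s ∈ Icc 0 t, CP * (1 + s) ^ (9 / 2 : ℝ) ≤ P := fun s hs => by
    have := hs.1
    have := hs.2
    rw [hPdef]
    gcongr
  have hS : VPSupp R0 hreg t P (R0 + t * P) := vpSupp_of_speed hreg hP0
    (fun s hs z hz => (hbd s hs.1 z hz).trans (hmono s hs)) (right_mem_Icc.2 ht)
  have hSn : ∀ n, VPSupp R0 (hGn n).reg t P (R0 + t * P) := fun n => vpSupp_of_speed _ hP0
    (fun s hs z hz => (hCP _ (he n) _ (hGn n) s hs.1 z hz).trans (hmono s hs)) (right_mem_Icc.2 ht)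
  have hR : 0 < R0 + t * P := by have := hf.hR0; positivity
  have hF : Tendsto (fun n => vpFld (e n) (vpρ f₀ (hGn n).reg t) x) atTop
      (𝓝 (vpFld 0 (vpρ f₀ hreg t) x)) := by
    rw [tendsto_iff_norm_sub_tendsto_zero]
    refine squeeze_zero (fun _ => norm_nonneg _) (fun n => (norm_sub_rev _ _).le.trans
      (vp_fld_cmp hf hR hS (hSn n) le_rfl (he n).le (fun z => (hD n z).2) x)) ?_
    have : Tendsto (fun n => Lf * (D * e n) * vpVol P * (2 * vpκ * (R0 + t * P)) +
      A * vpVol P * (6 * vpκ * (0 + e n))) atTop (𝓝 (Lf * (D * 0) * vpVol P *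
        (2 * vpκ * (R0 + t * P)) + A * vpVol P * (6 * vpκ * (0 + 0)))) :=
      ((((hlim.const_mul D).const_mul Lf).mul_const _).mul_const _).add
        (((hlim.const_add 0).const_mul (6 * vpκ)).const_mul _)
    simpa using this
  have h1 := hF.const_smul c
  refine tendsto_nhds_unique (hpt t ht x) (h1.congr fun n => ?_)
  exact (vpSol_fld hf (he n) (hGn n) t x).symm

end VPfourteen

section VPfifteen
open Set Filter Topology
open scoped NNReal ENNReal

lemma vpρ_loc {f₀ : E3 × E3 → ℝ} {A Lf R0 : ℝ} (hf : VPData f₀ A Lf R0)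
    {G : ℝ → E3 → E3} (h : VPReg G) (T : ℝ) : ∃ M R L : ℝ, 0 ≤ L ∧ ∀ t, |t| ≤ T →
      VPDen (vpρ f₀ h t) M R ∧ ∀ y y', |vpρ f₀ h t y - vpρ f₀ h t y'| ≤ L * ‖y - y'‖ := by
  obtain ⟨P, hP⟩ := vpSupp_exists h R0 T
  obtain ⟨K, hK⟩ := h.lip T
  have hLf := hf.hLf
  have hV := vpVol_nonneg P
  refine ⟨A * vpVol P, max P 1, Lf * exp ((1 + K) * (2 * T)) * vpVol P, by positivity,
    fun t ht => ⟨vpρ_den hf (fun z hz => ⟨(hP t ht z hz).1, (hP t ht z hz).2.trans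
      (le_max_left _ _)⟩) (by positivity), fun y y' => ?_⟩⟩
  refine (vpρ_cmp hf (hP t ht) (hP t ht) (b := exp ((1 + K) * (2 * T)) * ‖y - y'‖)
    (fun w => ?_)).trans (le_of_eq (by ring))
  refine (vpCurve_lip h hK ht (by simpa using (abs_nonneg t).trans ht) _ _).trans (le_of_eq ?_)
  simp [Prod.norm_def]

lemma vpDFld_continuous {f₀ : E3 × E3 → ℝ} {A Lf R0 : ℝ} (hf : VPData f₀ A Lf R0)
    {G : ℝ → E3 → E3} (h : VPReg G) {d : ℝ} (hd : 0 < d) :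
    Continuous fun p : ℝ × E3 => vpDFld d (vpρ f₀ h p.1) p.2 := by
  rw [continuous_iff_continuousAt]
  intro p₀
  obtain ⟨M, R, L, hL0, hM⟩ := vpρ_loc hf h (|p₀.1| + 1)
  have hρ := vpρ_continuous hf h
  have hK := vpK_fderiv_continuous hd
  have hc : Continuous (Function.uncurry fun (p : ℝ × E3) (y : E3) =>
      vpρ f₀ h p.1 y • fderiv ℝ (vpK d) (p.2 - y)) := by
    refine Continuous.smul (hρ.comp (by fun_prop : Continuous fun q : (ℝ × E3) × E3 =>
      ((q.1.1, q.2) : ℝ × E3))) (hK.comp (by fun_prop : Continuous fun q : (ℝ × E3) × E3 =>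
      q.1.2 - q.2))
  have h1 : Continuous fun p : ℝ × E3 => ∫ y in Metric.closedBall (0 : E3) R,
      vpρ f₀ h p.1 y • fderiv ℝ (vpK d) (p.2 - y) :=
    continuous_parametric_integral_of_continuous hc (isCompact_closedBall _ _)
  refine h1.continuousAt.congr ?_
  have h2 : ∀ᶠ p : ℝ × E3 in 𝓝 p₀, |p.1| < |p₀.1| + 1 :=
    (continuous_fst.abs.continuousAt (x := p₀)).eventually_lt_const (by simp)
  filter_upwards [h2] with p hp
  unfold vpDFld
  rw [setIntegral_eq_integral_of_forall_compl_eq_zero]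
  intro y hy
  have h3 : R < ‖y‖ := by simpa using hy
  rw [(hM p.1 hp.le).1.supp y h3]
  exact zero_smul ℝ (fderiv ℝ (vpK d) (p.2 - y))

lemma vpDFld_diff {d d' : ℝ} (hd : 0 < d) (hd' : 0 < d') {ρ : E3 → ℝ} {M R L : ℝ}
    (h : VPDen ρ M R) (hL0 : 0 ≤ L) (hL : ∀ y y', |ρ y - ρ y'| ≤ L * ‖y - y'‖) (x : E3) :
    ‖vpDFld d ρ x - vpDFld d' ρ x‖ ≤ 6 * vpκ * (d + d') * L := by
  have hκ := vpκ_nonneg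
  have h1 := (vpFld_hasFDerivAt hd h x).sub (vpFld_hasFDerivAt hd' h x)
  refine h1.le_of_lip' (by positivity) (Eventually.of_forall fun x' => ?_)
  exact vpFld_diff_lip hd.le hd'.le h hL0 hL x' x

lemma vp_DG {f₀ : E3 × E3 → ℝ} {A Lf R0 : ℝ} (hf : VPData f₀ A Lf R0)
    {G : ℝ → E3 → E3} (h : VPReg G) : ∃ D : ℝ × E3 → E3 →L[ℝ] E3, Continuous D ∧
      ∀ t x, HasFDerivAt (vpFld 0 (vpρ f₀ h t)) (D (t, x)) x := by
  have he0 : ∀ n : ℕ, (0:ℝ) < 1 / ((n:ℝ) + 1) := fun n => by positivity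
  have hlim0 : Tendsto (fun n : ℕ => 1 / ((n:ℝ) + 1)) atTop (𝓝 0) :=
    tendsto_one_div_add_atTop_nhds_zero_nat
  set e : ℕ → ℝ := fun n => 1 / ((n:ℝ) + 1) with he
  have hκ := vpκ_nonneg
  have hlim : ∀ p : ℝ × E3, ∃ y, Tendsto (fun n => vpDFld (e n) (vpρ f₀ h p.1) p.2) atTop
      (𝓝 y) := by
    intro p
    obtain ⟨M, R, L, hL0, hM⟩ := vpρ_loc hf h |p.1|
    apply cauchySeq_tendsto_of_complete
    refine cauchySeq_of_le_tendsto_0 (fun n : ℕ => 6 * vpκ * (e n + e n) * L) ?_ ?_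
    · intro n m N hn hm
      rw [dist_eq_norm]
      refine (vpDFld_diff (he0 n) (he0 m) (hM _ le_rfl).1 hL0 (hM _ le_rfl).2 p.2).trans ?_
      have h1 : (N:ℝ) ≤ n := by exact_mod_cast hn
      have h2 : (N:ℝ) ≤ m := by exact_mod_cast hm
      have h3 : e n ≤ e N := by simp only [he]; gcongr
      have h4 : e m ≤ e N := by simp only [he]; gcongr
      gcongr
    · have := ((hlim0.add hlim0).const_mul (6 * vpκ)).mul_const L
      simpa using this
  choose D hD using hlim
  have hest : ∀ T, ∃ C : ℝ, ∀ n, ∀ p : ℝ × E3, |p.1| ≤ T →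
      ‖vpDFld (e n) (vpρ f₀ h p.1) p.2 - D p‖ ≤ C * e n := by
    intro T
    obtain ⟨M, R, L, hL0, hM⟩ := vpρ_loc hf h T
    refine ⟨6 * vpκ * L, fun n p hp => ?_⟩
    have h1 : Tendsto (fun m => ‖vpDFld (e n) (vpρ f₀ h p.1) p.2 -
      vpDFld (e m) (vpρ f₀ h p.1) p.2‖) atTop (𝓝 ‖vpDFld (e n) (vpρ f₀ h p.1) p.2 - D p‖) :=
      (tendsto_const_nhds.sub (hD p)).norm
    have h2 : Tendsto (fun m : ℕ => 6 * vpκ * (e n + e m) * L) atTop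
      (𝓝 (6 * vpκ * (e n + 0) * L)) := ((hlim0.const_add _).const_mul (6 * vpκ)).mul_const L
    refine (le_of_tendsto_of_tendsto' h1 h2 fun m =>
      vpDFld_diff (he0 n) (he0 m) (hM _ hp).1 hL0 (hM _ hp).2 p.2).trans (le_of_eq (by ring))
  have hCe : ∀ C : ℝ, Tendsto (fun n => C * e n) atTop (𝓝 0) := fun C => by
    simpa using hlim0.const_mul C
  refine ⟨D, ?_, fun t x => ?_⟩
  · have hu : TendstoLocallyUniformly (fun n (p : ℝ × E3) => vpDFld (e n) (vpρ f₀ h p.1) p.2)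
        D atTop := by
      rw [Metric.tendstoLocallyUniformly_iff]
      intro δ hδ p₀
      obtain ⟨C, hC⟩ := hest (|p₀.1| + 1)
      refine ⟨{p | |p.1| < |p₀.1| + 1}, ?_, ?_⟩
      · exact (continuous_fst.abs.continuousAt (x := p₀)).eventually_lt_const (by simp)
      · filter_upwards [(hCe C).eventually_lt_const hδ] with n hn p hp
        rw [dist_comm, dist_eq_norm]
        exact (hC n p (le_of_lt hp)).trans_lt hn
    exact hu.continuous (Eventually.frequently (Eventually.of_forall fun n =>
      vpDFld_continuous hf h (he0 n)))
  · obtain ⟨C, hC⟩ := hest |t|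
    obtain ⟨M, R, L, hL0, hM⟩ := vpρ_loc hf h |t|
    refine hasFDerivAt_of_tendstoUniformly (l := atTop)
      (f := fun n => vpFld (e n) (vpρ f₀ h t)) (f' := fun n x => vpDFld (e n) (vpρ f₀ h t) x)
      (g' := fun x => D (t, x)) ?_ (fun n x => vpFld_hasFDerivAt (he0 n) (hM t le_rfl).1 x) ?_ x
    · rw [Metric.tendstoUniformly_iff]
      intro δ hδ
      filter_upwards [(hCe C).eventually_lt_const hδ] with n hn x
      rw [dist_comm, dist_eq_norm]
      exact (hC n (t, x) le_rfl).trans_lt hn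
    · intro x
      rw [tendsto_iff_norm_sub_tendsto_zero]
      refine squeeze_zero (fun _ => norm_nonneg _) (fun n =>
        vpFld_diff (he0 n).le le_rfl (hM t le_rfl).1 x) ?_
      have := ((hlim0.add_const 0).const_mul (6 * vpκ)).const_mul M
      have e0 : M * (6 * vpκ * (0 + 0)) = 0 := by ring
      rw [e0] at this
      exact this

end VPfifteen

section VPsixteen
open Set Filter Topology
open scoped NNReal ENNReal

lemma vp_gron {E : Type*} [NormedAddCommGroup E] [NormedSpace ℝ E] {u u' : ℝ → E}
    (hu : ∀ s, HasDerivAt u (u' s) s) {a b T A B : ℝ} (h0 : u a = 0) (hA : 0 ≤ A) (hB : 0 ≤ B)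
    (ha : |a| ≤ T) (hb : |b| ≤ T) (hu' : ∀ s, |s| ≤ T → ‖u' s‖ ≤ A * ‖u s‖ + B) :
    ‖u b‖ ≤ B * (2 * T) * exp (A * (2 * T)) := by
  have hT : 0 ≤ T := (abs_nonneg a).trans ha
  have hba : |b - a| ≤ 2 * T := by
    rw [abs_le] at *; constructor <;> linarith [ha.1, ha.2, hb.1, hb.2]
  have hs : ∀ s ∈ Icc (0:ℝ) 1, |a + s * (b - a)| ≤ T := by
    intro s hs
    rw [abs_le] at *
    constructor <;> nlinarith [ha.1, ha.2, hb.1, hb.2, hs.1, hs.2]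
  have key := vp_cmp (T := 1) (A := 2 * T * A) (u := fun s => u (a + s * (b - a)))
    (u' := fun s => (b - a) • u' (a + s * (b - a)))
    (B := fun s => 2 * T * B * s * exp (2 * T * A * s))
    (B' := fun s => 2 * T * B * exp (2 * T * A * s) +
      2 * T * B * s * (exp (2 * T * A * s) * (2 * T * A)))
    (a := fun _ => 2 * T * A) (b := fun _ => 2 * T * B) ?_ ?_ ?_ ?_ ?_ ?_ 1 (by simp)
  · simp only [one_mul, add_sub_cancel, mul_one] at key
    refine key.trans (le_of_eq ?_)
    rw [show 2 * T * A = A * (2 * T) by ring]; ring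
  · intro s _
    have h1 : HasDerivAt (fun s : ℝ => a + s * (b - a)) (b - a) s := by
      simpa using ((hasDerivAt_id s).mul_const (b - a)).const_add a
    exact ((hu _).scomp s h1).hasDerivWithinAt
  · intro s
    have h1 : HasDerivAt (fun s : ℝ => 2 * T * B * s) (2 * T * B) s := by
      simpa using (hasDerivAt_id s).const_mul (2 * T * B)
    have h2 : HasDerivAt (fun s : ℝ => 2 * T * A * s) (2 * T * A) s := by
      simpa using (hasDerivAt_id s).const_mul (2 * T * A)
    exact h1.mul h2.exp
  · simp [h0]
  · intro s _; exact le_rfl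
  · intro s hs1
    rw [norm_smul, Real.norm_eq_abs]
    have := hu' _ (hs s hs1)
    calc |b - a| * ‖u' (a + s * (b - a))‖ ≤ (2 * T) * (A * ‖u (a + s * (b - a))‖ + B) := by
          gcongr
      _ = _ := by ring
  · intro s hs1
    have h1 : 1 ≤ exp (2 * T * A * s) := by
      have := hs1.1
      exact Real.one_le_exp (by positivity)
    have h2 : 2 * T * B * 1 ≤ 2 * T * B * exp (2 * T * A * s) := by gcongr
    nlinarith

lemma vp_strict_continuous {E F : Type*} [NormedAddCommGroup E] [NormedSpace ℝ E]
    [NormedAddCommGroup F] [NormedSpace ℝ F] {f : E → F} {f' : E → E →L[ℝ] F}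
    (hf : ∀ x, HasStrictFDerivAt f (f' x) x) : Continuous f' := by
  rw [continuous_iff_continuousAt]
  intro x
  rw [ContinuousAt, Metric.tendsto_nhds]
  intro ε hε
  have h1 := (hasStrictFDerivAt_iff_isLittleO.1 (hf x)).def (half_pos hε)
  have h2 : ∀ᶠ y in 𝓝 x, ∀ᶠ p in 𝓝 (y, y), ‖f p.1 - f p.2 - f' x (p.1 - p.2)‖ ≤
      ε / 2 * ‖p.1 - p.2‖ :=
    (continuous_id.prodMk continuous_id).continuousAt.eventually
      (eventually_eventually_nhds.2 h1)
  filter_upwards [h2] with y hy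
  rw [dist_eq_norm]
  have h3 : HasFDerivAt (fun z => f z - f' x z) (f' y - f' x) y :=
    (hf y).hasFDerivAt.sub (f' x).hasFDerivAt
  refine (h3.le_of_lip' (half_pos hε).le ?_).trans_lt (half_lt_self hε)
  have h4 : Tendsto (fun z : E => (z, y)) (𝓝 y) (𝓝 (y, y)) :=
    (Continuous.prodMk_left y).tendsto y
  filter_upwards [h4.eventually hy] with z hz
  refine le_trans (le_of_eq ?_) hz
  congr 1
  simp only [map_sub]
  abel

def vpDY (DG : ℝ × E3 → E3 →L[ℝ] E3) (p : ℝ × E3 × E3) : (E3 × E3) →L[ℝ] (E3 × E3) :=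
  (ContinuousLinearMap.inl ℝ E3 E3).comp (ContinuousLinearMap.snd ℝ E3 E3) +
  (ContinuousLinearMap.inr ℝ E3 E3).comp ((DG (p.1, p.2.1)).comp (ContinuousLinearMap.fst ℝ E3 E3))

lemma vpDY_continuous {DG : ℝ × E3 → E3 →L[ℝ] E3} (hc : Continuous DG) :
    Continuous (vpDY DG) := by
  unfold vpDY
  refine continuous_const.add (continuous_const.clm_comp (Continuous.clm_comp ?_ continuous_const))
  exact hc.comp (continuous_fst.prodMk (continuous_fst.comp continuous_snd))

lemma vpDY_deriv {G : ℝ → E3 → E3} {DG : ℝ × E3 → E3 →L[ℝ] E3}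
    (hD : ∀ t x, HasFDerivAt (G t) (DG (t, x)) x) (t : ℝ) (z : E3 × E3) :
    HasFDerivAt (vpVF G t) (vpDY DG (t, z)) z := by
  have h1 : HasFDerivAt (fun z : E3 × E3 => z.2) (ContinuousLinearMap.snd ℝ E3 E3) z :=
    hasFDerivAt_snd
  have h2 : HasFDerivAt (fun z : E3 × E3 => G t z.1)
      ((DG (t, z.1)).comp (ContinuousLinearMap.fst ℝ E3 E3)) z :=
    (hD t z.1).comp z hasFDerivAt_fst
  have h3 := h1.prodMk h2
  refine HasFDerivAt.congr_fderiv (f := vpVF G t) h3 ?_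
  ext w <;> simp [vpDY]

lemma vp_flow_strict {G : ℝ → E3 → E3} (h : VPReg G) {DG : ℝ × E3 → E3 →L[ℝ] E3}
    (hc : Continuous DG) (hD : ∀ t x, HasFDerivAt (G t) (DG (t, x)) x) (a b : ℝ) (z₀ : E3 × E3) :
    ∃ W : (E3 × E3) →L[ℝ] (E3 × E3), HasStrictFDerivAt (fun z => vpCurve h a z b) W z₀ := by
  set γ := vpCurve h a z₀ with hγ
  have hγc : Continuous γ := vpCurve_continuous h a z₀
  set L : ℝ → (E3 × E3) →L[ℝ] (E3 × E3) := fun s => vpDY DG (s, γ s) with hL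
  have hLc : Continuous L := (vpDY_continuous hc).comp (continuous_id.prodMk hγc)
  have hbd : ∀ T : ℝ, ∃ M : ℝ≥0, ∀ t, |t| ≤ T → ‖L t‖ ≤ M := by
    intro T
    obtain ⟨M, hM⟩ := (isCompact_Icc (a := -T) (b := T)).exists_bound_of_continuousOn
      hLc.continuousOn
    exact ⟨M.toNNReal, fun t ht => (hM t (abs_le.1 ht)).trans (Real.le_coe_toNNReal M)⟩
  obtain ⟨W, hWa, hW⟩ := vp_ode_global (fun t (W : (E3 × E3) →L[ℝ] (E3 × E3)) => (L t).comp W)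
    (fun W => hLc.clm_comp continuous_const)
    (fun T => by
      obtain ⟨M, hM⟩ := hbd T
      refine ⟨M, fun t ht => LipschitzWith.of_dist_le_mul fun W W' => ?_⟩
      rw [dist_eq_norm, dist_eq_norm, ← ContinuousLinearMap.comp_sub]
      exact (ContinuousLinearMap.opNorm_comp_le _ _).trans
        (mul_le_mul_of_nonneg_right (hM t ht) (norm_nonneg _)))
    a (ContinuousLinearMap.id ℝ (E3 × E3))
  refine ⟨W b, ?_⟩
  rw [hasStrictFDerivAt_iff_isLittleO, Asymptotics.isLittleO_iff]
  intro η hη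
  set T := max |a| |b| with hT
  have hT0 : 0 ≤ T := (abs_nonneg a).trans (le_max_left _ _)
  obtain ⟨M, hM⟩ := hbd T
  obtain ⟨K, hK⟩ := h.lip T
  set C := exp ((1 + K) * (2 * T)) with hC
  have hC0 : 0 < C := exp_pos _
  set η' := η / (C * (2 * T + 1) * exp (M * (2 * T))) with hη'
  have hη'0 : 0 < η' := by positivity
  have htube : ∀ᶠ ξ : E3 × E3 in 𝓝 0, ∀ s ∈ Icc (-T) T,
      ‖vpDY DG (s, γ s + ξ) - L s‖ < η' := by
    refine isCompact_Icc.eventually_forall_of_forall_eventually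
      (P := fun ξ s => ‖vpDY DG (s, γ s + ξ) - L s‖ < η') fun s _ => ?_
    have hcont : Continuous fun p : (E3 × E3) × ℝ => ‖vpDY DG (p.2, γ p.2 + p.1) - L p.2‖ := by
      refine (((vpDY_continuous hc).comp (continuous_snd.prodMk
        ((hγc.comp continuous_snd).add continuous_fst))).sub (hLc.comp continuous_snd)).norm
    refine hcont.continuousAt.eventually_lt_const ?_
    simpa [hL] using hη'0
  obtain ⟨d, hd0, hd⟩ := Metric.eventually_nhds_iff_ball.1 htube
  have hz : ∀ᶠ z in 𝓝 z₀, C * ‖z - z₀‖ < d := by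
    have hcont : Continuous fun z : E3 × E3 => C * ‖z - z₀‖ := by fun_prop
    exact hcont.continuousAt.eventually_lt_const (by simpa using hd0)
  have hzz : ∀ᶠ p : (E3 × E3) × (E3 × E3) in 𝓝 (z₀, z₀), C * ‖p.1 - z₀‖ < d ∧
      C * ‖p.2 - z₀‖ < d := by
    rw [nhds_prod_eq]; exact hz.prod_mk hz
  filter_upwards [hzz] with p hp
  obtain ⟨hp1, hp2⟩ := hp
  have haT : |a| ≤ T := le_max_left _ _
  have hbT : |b| ≤ T := le_max_right _ _
  have key := vp_gron (u := fun s => vpCurve h a p.1 s - vpCurve h a p.2 s - W s (p.1 - p.2))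
    (u' := fun s => vpVF G s (vpCurve h a p.1 s) - vpVF G s (vpCurve h a p.2 s) -
      ((L s).comp (W s)) (p.1 - p.2)) (a := a) (b := b) (T := T) (A := M)
      (B := η' * (C * ‖p.1 - p.2‖)) ?_ ?_ M.2 (by positivity) haT hbT ?_
  · refine key.trans ?_
    have e1 : η' * (C * ‖p.1 - p.2‖) * (2 * T) * exp (M * (2 * T)) ≤
      η' * (C * ‖p.1 - p.2‖) * (2 * T + 1) * exp (M * (2 * T)) := by
      gcongr; linarith
    refine e1.trans (le_of_eq ?_)
    rw [hη']
    have : 2 * T + 1 ≠ 0 := by positivity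
    field_simp
  · intro s
    exact ((vpCurve_deriv h a p.1 s).sub (vpCurve_deriv h a p.2 s)).sub
      ((hW s).clm_apply (hasDerivAt_const s (p.1 - p.2)) |>.congr_deriv (by simp))
  · simp [vpCurve_self, hWa]
  · intro s hs
    have hb1 : ‖vpCurve h a p.1 s - γ s‖ < d := (vpCurve_lip h hK haT hs p.1 z₀).trans_lt hp1
    have hb2 : ‖vpCurve h a p.2 s - γ s‖ < d := (vpCurve_lip h hK haT hs p.2 z₀).trans_lt hp2
    have hmv : ‖vpVF G s (vpCurve h a p.1 s) - vpVF G s (vpCurve h a p.2 s) -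
        L s (vpCurve h a p.1 s - vpCurve h a p.2 s)‖ ≤
        η' * ‖vpCurve h a p.1 s - vpCurve h a p.2 s‖ := by
      refine Convex.norm_image_sub_le_of_norm_hasFDerivWithin_le' (s := Metric.ball (γ s) d)
        (f' := fun z => vpDY DG (s, z)) (fun z _ => (vpDY_deriv hD s z).hasFDerivWithinAt)
        (fun z hz => ?_) (convex_ball _ _) ?_ ?_
      · have := hd (z - γ s) (by simpa [dist_eq_norm] using hz) s (abs_le.1 hs)
        rw [add_sub_cancel] at this
        exact this.le
      · simpa [dist_eq_norm] using hb2
      · simpa [dist_eq_norm] using hb1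
    have hl := vpCurve_lip h hK haT hs p.1 p.2
    set X := vpCurve h a p.1 s
    set X' := vpCurve h a p.2 s
    have e : vpVF G s X - vpVF G s X' - ((L s).comp (W s)) (p.1 - p.2) =
        L s (X - X' - W s (p.1 - p.2)) + (vpVF G s X - vpVF G s X' - L s (X - X')) := by
      rw [map_sub (L s) (X - X'), ContinuousLinearMap.comp_apply]; abel
    rw [e]
    refine (norm_add_le _ _).trans (add_le_add ?_ (hmv.trans ?_))
    · exact ((L s).le_opNorm _).trans (mul_le_mul_of_nonneg_right (hM s hs) (norm_nonneg _))
    · gcongr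

lemma vpCurve_continuous_all {G : ℝ → E3 → E3} (h : VPReg G) :
    Continuous fun q : ℝ × ℝ × E3 × E3 => vpCurve h q.2.1 q.2.2 q.1 := by
  have h1 : Continuous fun q : ℝ × ℝ × E3 × E3 =>
      vpCurve h 0 (vpCurve h q.2.1 q.2.2 0) q.1 :=
    (vpCurve_continuous_fwd h).comp (continuous_fst.prodMk
      ((vpCurve_continuous_bwd h).comp continuous_snd))
  refine h1.congr fun q => ?_
  exact vpCurve_trans h _ _ _ _

lemma vpVF_continuous {G : ℝ → E3 → E3} (h : VPReg G) :
    Continuous fun q : ℝ × E3 × E3 => vpVF G q.1 q.2 := by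
  unfold vpVF
  exact (continuous_snd.comp continuous_snd).prodMk
    (h.cont.comp (continuous_fst.prodMk (continuous_fst.comp continuous_snd)))

lemma vp_base_strict {G : ℝ → E3 → E3} (h : VPReg G) (t₀ : ℝ) (z₀ : E3 × E3) :
    ∃ W : (ℝ × E3 × E3) →L[ℝ] (E3 × E3),
      HasStrictFDerivAt (fun p : ℝ × E3 × E3 => vpCurve h p.1 p.2 t₀) W (t₀, z₀) := by
  set Y₀ := vpVF G t₀ z₀ with hY
  refine ⟨ContinuousLinearMap.snd ℝ ℝ (E3 × E3) -
    (ContinuousLinearMap.fst ℝ ℝ (E3 × E3)).smulRight Y₀, ?_⟩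
  rw [hasStrictFDerivAt_iff_isLittleO, Asymptotics.isLittleO_iff]
  intro η hη
  set T := |t₀| + 1 with hT
  have hT0 : 0 ≤ T := by positivity
  obtain ⟨K, hK⟩ := h.lip T
  set C := exp ((1 + K) * (2 * T)) with hC
  have hC0 : 0 < C := exp_pos _
  set η' := min (η / 2) 1 with hη'
  have hη'0 : 0 < η' := lt_min (by positivity) one_pos
  have hη'1 : η' ≤ 1 := min_le_right _ _
  have hη'2 : η' ≤ η / 2 := min_le_left _ _
  have hev : ∀ᶠ q : ℝ × ℝ × E3 × E3 in 𝓝 (t₀, t₀, z₀),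
      ‖vpVF G q.1 (vpCurve h q.2.1 q.2.2 q.1) - Y₀‖ < η' := by
    have hcont : Continuous fun q : ℝ × ℝ × E3 × E3 =>
        ‖vpVF G q.1 (vpCurve h q.2.1 q.2.2 q.1) - Y₀‖ :=
      (((vpVF_continuous h).comp (continuous_fst.prodMk (vpCurve_continuous_all h))).sub
        continuous_const).norm
    refine hcont.continuousAt.eventually_lt_const ?_
    simpa [vpCurve_self, hY] using hη'0
  obtain ⟨d, hd0, hd⟩ := Metric.eventually_nhds_iff_ball.1 hev
  set Q := (1 + (K:ℝ)) * C * (2 + ‖Y₀‖) with hQ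
  have hQ0 : 0 < Q := by positivity
  set d' := min (min d 1) (η / 2 / Q) with hd'
  have hd'0 : 0 < d' := by positivity
  have hball : ∀ᶠ p : (ℝ × E3 × E3) × (ℝ × E3 × E3) in 𝓝 ((t₀, z₀), (t₀, z₀)),
      p.1 ∈ Metric.ball (t₀, z₀) d' ∧ p.2 ∈ Metric.ball (t₀, z₀) d' := by
    rw [nhds_prod_eq]
    have hb : ∀ᶠ p in 𝓝 (t₀, z₀), p ∈ Metric.ball (t₀, z₀) d' := Metric.ball_mem_nhds _ hd'0
    exact Filter.Eventually.prod_mk hb hb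
  filter_upwards [hball] with p hp
  obtain ⟨⟨t₁, z₁⟩, ⟨t₂, z₂⟩⟩ := p
  simp only at hp ⊢
  obtain ⟨hp1, hp2⟩ := hp
  have ht1 : |t₁ - t₀| < d' := by
    have := (Metric.mem_ball.1 hp1); rw [Prod.dist_eq, max_lt_iff] at this; exact this.1
  have ht2 : |t₂ - t₀| < d' := by
    have := (Metric.mem_ball.1 hp2); rw [Prod.dist_eq, max_lt_iff] at this; exact this.1
  have hdd : d' ≤ d := (min_le_left _ _).trans (min_le_left _ _)
  have hd1 : d' ≤ 1 := (min_le_left _ _).trans (min_le_right _ _)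
  have hdQ : Q * d' ≤ η / 2 := by
    have : d' ≤ η / 2 / Q := min_le_right _ _
    rw [le_div_iff₀ hQ0] at this; linarith
  have hsT : ∀ s ∈ Metric.ball t₀ d', |s| ≤ T := by
    intro s hs
    rw [Metric.mem_ball, Real.dist_eq] at hs
    have := abs_add_le t₀ (s - t₀)
    rw [add_sub_cancel] at this
    linarith
  set N := ‖((t₁, z₁) : ℝ × E3 × E3) - (t₂, z₂)‖ with hN
  have hNt : |t₁ - t₂| ≤ N := by
    rw [hN]; exact norm_fst_le (((t₁, z₁) : ℝ × E3 × E3) - (t₂, z₂))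
  have hNz : ‖z₁ - z₂‖ ≤ N := by
    rw [hN]; exact norm_snd_le (((t₁, z₁) : ℝ × E3 × E3) - (t₂, z₂))
  have hN0 : 0 ≤ N := norm_nonneg _
  set γ₁ := vpCurve h t₁ z₁ with hγ₁
  set γ₂ := vpCurve h t₂ z₂ with hγ₂
  have hs1 : γ₁ t₁ = z₁ := vpCurve_self h _ _
  have hs2 : γ₂ t₂ = z₂ := vpCurve_self h _ _
  have m1 : t₁ ∈ Metric.ball t₀ d' := by simpa [Real.dist_eq] using ht1
  have m2 : t₂ ∈ Metric.ball t₀ d' := by simpa [Real.dist_eq] using ht2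
  have m0 : t₀ ∈ Metric.ball t₀ d' := Metric.mem_ball_self hd'0
  -- second part
  have hA : ‖γ₂ t₁ - z₂ - (t₁ - t₂) • Y₀‖ ≤ η' * |t₁ - t₂| := by
    have := (convex_ball t₀ d').norm_image_sub_le_of_norm_hasDerivWithin_le
      (f := fun s => γ₂ s - s • Y₀) (f' := fun s => vpVF G s (γ₂ s) - Y₀) (C := η')
      (x := t₂) (y := t₁) (fun s _ => ?_) (fun s hs => ?_) m2 m1
    · rw [Real.norm_eq_abs] at this
      refine le_trans (le_of_eq ?_) this
      congr 1
      simp only [hs2, sub_smul]; abel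
    · have e1 : HasDerivAt (fun s : ℝ => s • Y₀) Y₀ s := by
        simpa using (hasDerivAt_id s).smul_const Y₀
      exact ((vpCurve_deriv h t₂ z₂ s).sub e1).hasDerivWithinAt
    · refine (hd (s, t₂, z₂) ?_).le
      rw [Metric.mem_ball, Prod.dist_eq, max_lt_iff]
      exact ⟨(Metric.mem_ball.1 hs).trans_le hdd, (Metric.mem_ball.1 hp2).trans_le hdd⟩
  have hw : ‖z₁ - γ₂ t₁‖ ≤ (2 + ‖Y₀‖) * N := by
    have e : z₁ - γ₂ t₁ = (z₁ - z₂) - (γ₂ t₁ - z₂ - (t₁ - t₂) • Y₀) - (t₁ - t₂) • Y₀ := by abel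
    rw [e]
    refine (norm_sub_le _ _).trans ?_
    have e2 := norm_sub_le (z₁ - z₂) (γ₂ t₁ - z₂ - (t₁ - t₂) • Y₀)
    have e3 : ‖(t₁ - t₂) • Y₀‖ ≤ N * ‖Y₀‖ := by
      rw [norm_smul, Real.norm_eq_abs]; gcongr
    have e4 : η' * |t₁ - t₂| ≤ 1 * N := by gcongr
    linarith
  have hB : ‖(γ₁ t₀ - γ₂ t₀) - (γ₁ t₁ - γ₂ t₁)‖ ≤ Q * N * |t₀ - t₁| := by
    have := (convex_ball t₀ d').norm_image_sub_le_of_norm_hasDerivWithin_le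
      (f := fun s => γ₁ s - γ₂ s) (f' := fun s => vpVF G s (γ₁ s) - vpVF G s (γ₂ s))
      (C := Q * N) (x := t₁) (y := t₀) (fun s _ => ?_) (fun s hs => ?_) m1 m0
    · exact this
    · exact ((vpCurve_deriv h t₁ z₁ s).sub (vpCurve_deriv h t₂ z₂ s)).hasDerivWithinAt
    · have e1 := (vpVF_lip (hK s (hsT s hs))).dist_le_mul (γ₁ s) (γ₂ s)
      rw [dist_eq_norm, dist_eq_norm] at e1
      have e2 := vp_curve_lip h (vpCurve_deriv h t₁ z₁) (vpCurve_deriv h t₂ z₂) hK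
        (hsT _ m1) (hsT _ hs)
      have e3 : exp ((1 + K) * |s - t₁|) ≤ C := by
        rw [hC]
        have a1 := hsT _ m1
        have a2 := hsT _ hs
        have a3 : |s - t₁| ≤ 2 * T := by
          rw [abs_le] at *; constructor <;> linarith [a1.1, a1.2, a2.1, a2.2]
        gcongr
      refine e1.trans ?_
      push_cast
      have e4 : ‖γ₁ s - γ₂ s‖ ≤ C * ((2 + ‖Y₀‖) * N) := by
        refine e2.trans ?_
        have : ‖γ₁ t₁ - γ₂ t₁‖ ≤ (2 + ‖Y₀‖) * N := by rw [hs1]; exact hw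
        exact mul_le_mul e3 this (norm_nonneg _) hC0.le
      calc (1 + (K:ℝ)) * ‖γ₁ s - γ₂ s‖ ≤ (1 + K) * (C * ((2 + ‖Y₀‖) * N)) := by gcongr
        _ = _ := by rw [hQ]; ring
  have e : γ₁ t₀ - γ₂ t₀ - (ContinuousLinearMap.snd ℝ ℝ (E3 × E3) -
      (ContinuousLinearMap.fst ℝ ℝ (E3 × E3)).smulRight Y₀) ((t₁, z₁) - (t₂, z₂)) =
      ((γ₁ t₀ - γ₂ t₀) - (γ₁ t₁ - γ₂ t₁)) - (γ₂ t₁ - z₂ - (t₁ - t₂) • Y₀) := by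
    rw [hs1]
    simp
    abel
  rw [e]
  refine (norm_sub_le _ _).trans ((add_le_add hB hA).trans ?_)
  have f1 : Q * N * |t₀ - t₁| ≤ Q * N * d' := by
    rw [abs_sub_comm]; gcongr
  have f2 : η' * |t₁ - t₂| ≤ η / 2 * N := by gcongr
  have f3 : Q * N * d' ≤ η / 2 * N := by nlinarith
  linarith

lemma vp_bwd_contDiff {G : ℝ → E3 → E3} (h : VPReg G) {DG : ℝ × E3 → E3 →L[ℝ] E3}
    (hc : Continuous DG) (hD : ∀ t x, HasFDerivAt (G t) (DG (t, x)) x) :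
    ContDiff ℝ 1 fun p : ℝ × E3 × E3 => vpCurve h p.1 p.2 0 := by
  have hS : ∀ p : ℝ × E3 × E3, ∃ W : (ℝ × E3 × E3) →L[ℝ] (E3 × E3),
      HasStrictFDerivAt (fun p : ℝ × E3 × E3 => vpCurve h p.1 p.2 0) W p := by
    rintro ⟨t₀, z₀⟩
    obtain ⟨W₁, h1⟩ := vp_base_strict h t₀ z₀
    obtain ⟨W₂, h2⟩ := vp_flow_strict h hc hD t₀ 0 z₀
    have h2' : HasStrictFDerivAt (fun z => vpCurve h t₀ z 0) W₂ (vpCurve h t₀ z₀ t₀) := by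
      rw [vpCurve_self]; exact h2
    refine ⟨W₂.comp W₁, ?_⟩
    have h3 := HasStrictFDerivAt.comp (g := fun z => vpCurve h t₀ z 0)
      (f := fun p : ℝ × E3 × E3 => vpCurve h p.1 p.2 t₀) (t₀, z₀) h2' h1
    refine h3.congr_of_eventuallyEq (Eventually.of_forall fun p => ?_)
    exact vpCurve_trans h _ _ _ _
  choose W hW using hS
  rw [contDiff_one_iff_hasFDerivAt]
  exact ⟨W, vp_strict_continuous hW, fun p => (hW p).hasFDerivAt⟩

end VPsixteen

section VPseventeen
open Set Filter Topology
open scoped NNReal ENNReal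

lemma vpData_exists {f₀ : E3 × E3 → ℝ} (h0 : ∀ z, 0 ≤ f₀ z) (hs : ContDiff ℝ 1 f₀)
    (hc : HasCompactSupport f₀) : ∃ A Lf R0, VPData f₀ A Lf R0 := by
  obtain ⟨A, hA⟩ := hc.exists_bound_of_continuous hs.continuous
  obtain ⟨K, hK⟩ := hs.lipschitzWith_of_hasCompactSupport hc one_ne_zero
  obtain ⟨R, hR⟩ := hc.isCompact.isBounded.exists_norm_le
  refine ⟨A, K, max R 1, ⟨h0, hs.continuous, fun z => (le_abs_self _).trans (hA z), fun z z' => ?_,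
    fun z hz => ?_, by positivity, K.2⟩⟩
  · have := hK.dist_le_mul z z'
    rwa [dist_eq_norm, dist_eq_norm, Real.norm_eq_abs] at this
  · by_contra hne
    have := hR z (subset_tsupport _ hne)
    exact absurd hz (not_lt.2 (this.trans (le_max_left _ _)))

lemma vpK_zero (x : E3) : vpK 0 x = (‖x‖ ^ 3)⁻¹ • x := by
  unfold vpK vpS
  simp

lemma vpField_eq (f₀ : E3 × E3 → ℝ) {G : ℝ → E3 → E3} (h : VPReg G) (t : ℝ) (x : E3) :
    vpField (fun p : ℝ × E3 × E3 => f₀ (vpCurve h p.1 p.2 0)) t x =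
      (4 * π)⁻¹ • vpFld 0 (vpρ f₀ h t) x := by
  unfold vpField vpFld
  congr 1
  refine integral_congr_ae (Eventually.of_forall fun y => ?_)
  simp only [vpK_zero, smul_smul]
  rw [div_eq_mul_inv]
  rfl

lemma vp_main {β : ℝ} {f₀ : E3 × E3 → ℝ} {A Lf R0 : ℝ} (hf : VPData f₀ A Lf R0)
    (hs : ContDiff ℝ 1 f₀) : ∃ (F : ℝ × E3 × E3 → ℝ) (CP : ℝ), 0 ≤ CP ∧
      IsGlobalVPSolution β F ∧ (∀ x v, F (0, x, v) = f₀ (x, v)) ∧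
      ∀ t, 0 ≤ t → ∀ x v, F (t, x, v) ≠ 0 → ‖v‖ ≤ CP * (1 + t) ^ (9 / 2 : ℝ) := by
  obtain ⟨G, h, CP, hCP, hGm, hspeed, hG⟩ := vp_limit hf (β * (4 * π)⁻¹)
  obtain ⟨D, hDc, hD⟩ := vp_DG hf h
  have hDG : ∀ t x, HasFDerivAt (G t)
      ((fun p : ℝ × E3 => (β * (4 * π)⁻¹) • D (max p.1 0, p.2)) (t, x)) x := by
    intro t x
    have e : G t = fun x => (β * (4 * π)⁻¹) • vpFld 0 (vpρ f₀ h (max t 0)) x := by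
      rw [hGm t]; funext y; exact hG _ (le_max_right _ _) y
    rw [e]
    exact (hD (max t 0) x).const_smul (β * (4 * π)⁻¹)
  have hDGc : Continuous fun p : ℝ × E3 => (β * (4 * π)⁻¹) • D (max p.1 0, p.2) := by
    have h1 : Continuous fun p : ℝ × E3 => D (max p.1 0, p.2) :=
      hDc.comp ((continuous_fst.max continuous_const).prodMk continuous_snd)
    fun_prop
  have hC1 := vp_bwd_contDiff h hDGc hDG
  set F : ℝ × E3 × E3 → ℝ := fun p => f₀ (vpCurve h p.1 p.2 0) with hF
  have hFs : ContDiff ℝ 1 F := hs.comp hC1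
  have hmono : ∀ T, ∀ s ∈ Icc 0 T, CP * (1 + s) ^ (9 / 2 : ℝ) ≤ CP * (1 + T) ^ (9 / 2 : ℝ) := by
    intro T s hs
    have := hs.1
    have := hs.2
    gcongr
  have hsup : ∀ T, 0 ≤ T → ∀ t ∈ Icc 0 T, VPSupp R0 h t (CP * (1 + T) ^ (9 / 2 : ℝ))
      (R0 + T * (CP * (1 + T) ^ (9 / 2 : ℝ))) := fun T hT t ht =>
    vpSupp_of_speed h (by positivity)
      (fun s hs z hz => (hspeed s hs.1 z hz).trans (hmono T s hs)) ht
  refine ⟨F, CP, hCP, ⟨fun z => hf.nonneg _, hFs, ?_, ?_⟩, ?_, ?_⟩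
  · intro t x v ht
    have hcurve : HasDerivAt (fun s => (s, vpCurve h t (x, v) s)) ((1:ℝ), v, G t x) t := by
      have := (hasDerivAt_id t).prodMk (vpCurve_deriv h t (x, v) t)
      rw [vpCurve_self] at this
      exact this
    have hFd : HasFDerivAt F (fderiv ℝ F (t, x, v)) (t, vpCurve h t (x, v) t) := by
      rw [vpCurve_self]
      exact (hFs.differentiable one_ne_zero _).hasFDerivAt
    have hcomp := hFd.comp_hasDerivAt t hcurve
    have hconst : (F ∘ fun s => (s, vpCurve h t (x, v) s)) = fun _ => F (t, x, v) := by
      funext s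
      simp only [hF, Function.comp]
      rw [vpCurve_trans]
    rw [hconst] at hcomp
    have hz := hcomp.unique (hasDerivAt_const t (F (t, x, v)))
    have e : β • vpField F t x = G t x := by
      rw [hF, vpField_eq, hG t ht, smul_smul]
    rw [e]
    exact hz
  · intro T hT
    rw [isBounded_iff_forall_norm_le]
    refine ⟨max T (max (R0 + T * (CP * (1 + T) ^ (9 / 2 : ℝ))) (CP * (1 + T) ^ (9 / 2 : ℝ))), ?_⟩
    rintro ⟨t, x, v⟩ ⟨h1, h2, h3⟩
    have := (hsup T hT t ⟨h1, h2⟩).of_ne hf h3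
    rw [Prod.norm_mk, Prod.norm_mk]
    refine max_le_max ?_ (max_le_max this.2 this.1)
    rw [Real.norm_eq_abs, abs_of_nonneg h1]
    exact h2
  · intro x v
    simp only [hF, vpCurve_self]
  · intro t ht x v hne
    exact ((hsup t ht t ⟨ht, le_rfl⟩).of_ne hf hne).1

end VPseventeen

/-- Pfaffelmoser's theorem: global existence of classical solutions
of the Vlasov–Poisson system for general `C¹` compactly supported data, with the
momentum support bound `Q(t) ≤ C(1+t)^((51+δ)/11)`. -/
theorem pfaffelmoser_global_existence
    (β : ℝ) (hβ : β = 1 ∨ β = -1)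
    (f₀ : E3 × E3 → ℝ) (hf₀_nonneg : ∀ z, 0 ≤ f₀ z)
    (hf₀_smooth : ContDiff ℝ 1 f₀) (hf₀_supp : HasCompactSupport f₀)
    (δ : ℝ) (hδ : 0 < δ) :
    ∃ (F : ℝ × E3 × E3 → ℝ) (C : ℝ), 0 < C ∧
      IsGlobalVPSolution β F ∧
      (∀ x v, F (0, x, v) = f₀ (x, v)) ∧
      (∀ t : ℝ, 0 ≤ t → vpQ F t ≤ C * (1 + t) ^ ((51 + δ) / 11)) := by
  
  obtain ⟨A, Lf, R0, hf⟩ := vpData_exists hf₀_nonneg hf₀_smooth hf₀_supp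
  obtain ⟨F, CP, hCP, hF, h0, hQ⟩ := vp_main (β := β) hf hf₀_smooth
  refine ⟨F, CP + 1, by positivity, hF, h0, fun t ht => ?_⟩
  refine Real.sSup_le ?_ (by positivity)
  rintro r ⟨s, x, v, hs, hst, hne, rfl⟩
  have h1 : (1 + s) ^ (9 / 2 : ℝ) ≤ (1 + t) ^ ((51 + δ) / 11) :=
    (Real.rpow_le_rpow (by linarith) (by linarith) (by norm_num)).trans
      (Real.rpow_le_rpow_of_exponent_le (by linarith) (by linarith))
  refine (hQ s hs x v hne).trans (mul_le_mul (by linarith) h1 (by positivity) (by positivity))
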